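/- arXiv:1801.08776 — 6 statements merged into one kernel-verified Lean document; each statement's English description precedes it below -/
import Mathlib

section
/- Let u ≥ 2 be an integer and let q be a prime power with q ≡ 2^u + 1 (mod 2^{u+1}). Then for every positive integer e there exists a skew Hadamard difference family with exactly 2^{u−1} blocks in the additive group of the finite field F_{q^e}; that is, there exist 2^{u−1} subsets of F_{q^e}, each of size (q^e−1)/2 and each skew, which form a difference family with parameters (q^e, (q^e−1)/2, 2^{u−1}(q^e−3)/4). -/
open Finset
open scoped Classical

/-- A subset `B` of a finite additive abelian group is *skew* if
`B ∩ (-B) = ∅` and `B ∪ (-B) = G \ {0}`. -/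
def IsSkewSet {G : Type} [AddCommGroup G] [Fintype G] (B : Finset G) : Prop :=
  B ∩ B.image (fun x => -x) = ∅ ∧ B ∪ B.image (fun x => -x) = Finset.univ \ {0}

/-- `B` is a difference family with block size `k` and index `lam`:
every block has `k` elements, and every nonzero `g` is represented exactly `lam`
times as a difference `x - y` with `x ≠ y` from a common block. -/
def IsDiffFamily {G : Type} [AddCommGroup G] [Fintype G] {ℓ : ℕ}
    (B : Fin ℓ → Finset G) (k lam : ℕ) : Prop :=
  (∀ i, (B i).card = k) ∧
  ∀ g : G, g ≠ 0 →
    (∑ i, (((B i) ×ˢ (B i)).filter (fun p => p.1 ≠ p.2 ∧ p.1 - p.2 = g)).card) = lam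

/-- A finite field has a primitive complex additive character invariant under Frobenius. -/
theorem exists_primitive_addChar_pow_invariant (F : Type) [Field F] [Fintype F] (p : ℕ)
    [Fact p.Prime] [CharP F p] :
    ∃ ψ : AddChar F ℂ, ψ.IsPrimitive ∧ ∀ (i : ℕ) (x : F), ψ (x ^ p ^ i) = ψ x := by
  let _ : Algebra (ZMod p) F := ZMod.algebra F p
  let τ : F →+ ZMod p := (Algebra.trace (ZMod p) F).toAddMonoidHom
  have hτ (x : F) : τ x = Algebra.trace (ZMod p) F x := rfl
  have hfrob (x : F) : τ (x ^ p) = τ x := by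
    have := Algebra.trace_eq_of_algEquiv
      (FiniteField.frobeniusAlgEquivOfAlgebraic (ZMod p) F) x
    simpa [hτ, ZMod.card] using this
  refine ⟨(ZMod.stdAddChar (N := p)).compAddMonoidHom τ, AddChar.IsPrimitive.of_ne_one ?_, ?_⟩
  · intro h1
    obtain ⟨x, hx⟩ := Algebra.trace_surjective (ZMod p) F 1
    have h2 : ZMod.stdAddChar (N := p) 1 = ZMod.stdAddChar (N := p) 0 := by
      have := DFunLike.congr_fun h1 x
      simpa [hτ, hx] using this
    exact one_ne_zero (ZMod.injective_stdAddChar h2)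
  · intro i x
    have : τ (x ^ p ^ i) = τ x := by
      induction i with
      | zero => simp
      | succ i ih => rw [pow_succ, pow_mul, hfrob, ih]
    simp [this]

section CharacterSums

variable {F : Type} [Field F] [Fintype F] {ψ : AddChar F ℂ}

/-- If multiplication by `b ^ d` acts as `-1` on `φ`, where `x ↦ x ^ (d + 1)` fixes both `φ` and `ψ`,
then the Fourier transform of `φ` vanishes at `b`. -/
theorem sum_mul_addChar_eq_zero {h d : ℕ} (hh : Odd h)
    (hinj : Function.Injective fun x : F => x ^ (d + 1))
    (hψ : ∀ x, ψ (x ^ (d + 1)) = ψ x) {φ : F → ℂ} (hodd : ∀ x, φ (-x) = -φ x)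
    (hH : ∀ η x, η ^ h = 1 → φ (η * x) = φ x) (hfix : ∀ x, φ (x ^ (d + 1)) = φ x)
    {b : F} (hb0 : b ≠ 0) (hb : b ^ (d * h) = -1) :
    ∑ x, φ x * ψ (x * b) = 0 := by
  have h1 : ∑ x, φ x * ψ (x * b) = ∑ x, φ x * ψ (x * b ^ (d + 1)) := by
    refine Fintype.sum_bijective _ (Finite.injective_iff_bijective.mp hinj) _ _ fun x => ?_
    rw [hfix, ← mul_pow, hψ]
  have h2 : ∑ x, φ x * ψ (x * b ^ (d + 1)) = -∑ x, φ x * ψ (x * b) := by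
    rw [← Finset.sum_neg_distrib]
    refine Fintype.sum_equiv (Equiv.mulLeft₀ (b ^ d) (pow_ne_zero _ hb0)) _ _ fun x => ?_
    have h3 : φ (b ^ d * x) = -φ x := by
      rw [← hH (-b ^ d) x (by rw [hh.neg_pow, ← pow_mul, hb, neg_neg]), neg_mul, hodd, neg_neg]
    rw [Equiv.mulLeft₀_apply, h3, neg_mul, neg_neg, pow_succ]
    ring_nf
  have h3 := h1.trans h2
  linear_combination h3 / 2

/-- Fourier inversion for the correlation of an arbitrary function with itself. -/
theorem sum_fourier_mul_fourier_neg (hψ : ψ.IsPrimitive) (φ : F → ℂ) (g : F) :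
    ∑ a, (∑ x, φ x * ψ (x * a)) * (∑ x, φ x * ψ (x * -a)) * ψ (-(g * a)) =
      Fintype.card F * ∑ x, φ x * φ (x - g) := by
  have h1 (a : F) : (∑ x, φ x * ψ (x * a)) * (∑ x, φ x * ψ (x * -a)) * ψ (-(g * a)) =
      ∑ x, ∑ y, φ x * φ y * ψ (a * (x - g - y)) := by
    rw [Finset.sum_mul_sum, Finset.sum_mul]
    refine Finset.sum_congr rfl fun x _ => ?_
    rw [Finset.sum_mul]
    refine Finset.sum_congr rfl fun y _ => ?_
    have : a * (x - g - y) = x * a + y * -a + -(g * a) := by ring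
    rw [this, AddChar.map_add_eq_mul, AddChar.map_add_eq_mul]
    ring
  simp_rw [h1]
  rw [Finset.sum_comm, Finset.mul_sum]
  refine Finset.sum_congr rfl fun x _ => ?_
  rw [Finset.sum_comm]
  simp_rw [← Finset.mul_sum, AddChar.sum_mulShift _ hψ, sub_eq_zero]
  simp [mul_comm]

/-- Under the vanishing hypothesis, the Fourier transform of `f` at `s * a`, with `s` in the group
`K` of `n`-th roots of unity, only involves the values of `f` on the coset `a⁻¹ K`. -/
theorem fourier_eq_sum_subgroup {n : ℕ} (hn : n ≠ 0) {f : F → ℂ}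
    (f0 : f 0 = 0)
    (hvan : ∀ c b : F, b ≠ 0 → b ^ n ≠ 1 →
      ∑ x, (if x ^ n = 1 then f (x * c) else 0) * ψ (x * b) = 0)
    {a s : F} (ha : a ≠ 0) (hs : s ^ n = 1) :
    ∑ x, f x * ψ (x * (s * a)) =
      ∑ x, (if x ^ n = 1 then f (x * a⁻¹) else 0) * ψ (x * s) := by
  set K : Finset F := univ.filter (fun x => x ^ n = 1) with hK
  have hs0 : s ≠ 0 := by rintro rfl; simp [hn] at hs
  have h1 : ∑ x, f x * ψ (x * (s * a)) = ∑ x, f (x * a⁻¹) * ψ (x * s) := by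
    refine Fintype.sum_equiv (Equiv.mulRight₀ a ha) _ _ fun x => ?_
    simp only [Equiv.mulRight₀_apply]
    rw [mul_inv_cancel_right₀ ha]
    ring_nf
  have h2 : ∑ x, (if x ^ n = 1 then 0 else f (x * a⁻¹) * ψ (x * s)) = 0 := by
    have hcard : (K.card : ℂ) ≠ 0 := by
      have : (1 : F) ∈ K := by simp [hK]
      exact_mod_cast Finset.card_ne_zero_of_mem this
    refine (mul_eq_zero.mp ?_).resolve_left hcard
    rw [← nsmul_eq_mul, ← Finset.sum_const]
    have h3 : ∀ k ∈ K, ∑ x, (if x ^ n = 1 then 0 else f (x * a⁻¹) * ψ (x * s)) =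
        ∑ x, (if x ^ n = 1 then 0 else f (k * (x * a⁻¹)) * ψ (k * (x * s))) := by
      intro k hk
      have hkn : k ^ n = 1 := by simpa [hK] using hk
      have hk0 : k ≠ 0 := by rintro rfl; simp [hn] at hkn
      refine (Fintype.sum_equiv (Equiv.mulLeft₀ k hk0) _ _ fun x => ?_).symm
      simp only [Equiv.mulLeft₀_apply, mul_pow, hkn, one_mul, mul_assoc]
    rw [Finset.sum_congr rfl h3, Finset.sum_comm]
    refine Finset.sum_eq_zero fun x _ => ?_
    by_cases hx : x ^ n = 1
    · simp [hx]
    · simp only [hx, if_false]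
      by_cases hx0 : x = 0
      · simp [hx0, f0]
      · have := hvan (x * a⁻¹) (x * s) (mul_ne_zero hx0 hs0) (by rwa [mul_pow, hs, mul_one])
        rw [← this, hK, Finset.sum_filter]
        refine Finset.sum_congr rfl fun k _ => ?_
        split_ifs <;> simp
  rw [h1, ← sub_eq_zero, ← Finset.sum_sub_distrib]
  refine (Finset.sum_congr rfl fun x _ => ?_).trans h2
  split_ifs <;> simp

/-- Under the vanishing hypothesis, the power spectrum of `f` has the same sum over every coset of
the group of `n`-th roots of unity. -/
theorem sum_subgroup_fourier (hψ : ψ.IsPrimitive) {n : ℕ} (hn : n ≠ 0) (hneg : (-1 : F) ^ n = 1)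
    {f : F → ℂ} (f0 : f 0 = 0) (hodd : ∀ x, f (-x) = -f x) (hsq : ∀ x, x ≠ 0 → f x * f x = 1)
    (hvan : ∀ c b : F, b ≠ 0 → b ^ n ≠ 1 →
      ∑ x, (if x ^ n = 1 then f (x * c) else 0) * ψ (x * b) = 0)
    {a : F} (ha : a ≠ 0) :
    ∑ s with s ^ n = 1, (∑ x, f x * ψ (x * (s * a))) * (∑ x, f x * ψ (x * -(s * a))) =
      Fintype.card F * (#{s : F | s ^ n = 1} : ℂ) := by
  have hneg' (x : F) : (-x) ^ n = 1 ↔ x ^ n = 1 := by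
    rw [← neg_one_mul, mul_pow, hneg, one_mul]
  set φ : F → ℂ := fun x => if x ^ n = 1 then f (x * a⁻¹) else 0 with hφ
  have key := sum_fourier_mul_fourier_neg hψ φ 0
  have hφodd (x : F) : φ (-x) = -φ x := by
    simp only [hφ, hneg', neg_mul, hodd]
    split_ifs <;> simp
  have h1 : ∑ s with s ^ n = 1, (∑ x, f x * ψ (x * (s * a))) * (∑ x, f x * ψ (x * -(s * a))) =
      ∑ s with s ^ n = 1, (∑ x, φ x * ψ (x * s)) * (∑ x, φ x * ψ (x * -s)) := by
    refine Finset.sum_congr rfl fun s hs => ?_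
    have hs' : s ^ n = 1 := by simpa using hs
    rw [fourier_eq_sum_subgroup hn f0 hvan ha hs', ← neg_mul,
      fourier_eq_sum_subgroup hn f0 hvan ha ((hneg' s).2 hs')]
  have h2 : ∑ s with s ^ n = 1, (∑ x, φ x * ψ (x * s)) * (∑ x, φ x * ψ (x * -s)) =
      ∑ s, (∑ x, φ x * ψ (x * s)) * (∑ x, φ x * ψ (x * -s)) := by
    refine Finset.sum_subset (Finset.subset_univ _) fun s _ hs => ?_
    have hs' : ¬ s ^ n = 1 := by simpa using hs
    by_cases h0 : s = 0
    · subst h0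
      have : ∑ x, φ x = 0 := by
        have h3 : ∑ x, φ x = -∑ x, φ x := by
          rw [← Finset.sum_neg_distrib]
          exact Fintype.sum_equiv (Equiv.neg F) _ _ fun x => by simp [hφodd]
        linear_combination h3 / 2
      simp [this]
    · rw [hvan a⁻¹ s h0 hs', zero_mul]
  have h3 : ∑ x, φ x * φ (x - 0) = (#{s : F | s ^ n = 1} : ℂ) := by
    rw [Finset.card_filter]
    push_cast
    refine Finset.sum_congr rfl fun x _ => ?_
    simp only [hφ, sub_zero]
    split_ifs with hx
    · refine hsq _ (mul_ne_zero ?_ (inv_ne_zero ha))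
      rintro rfl
      simp [hn] at hx
    · simp
  rw [h1, h2, ← h3, ← key]
  simp

end CharacterSums

theorem exists_pow_two_pow_sub_one (u t : ℕ) (hu : 2 ≤ u) (q : ℕ)
    (hq : ∃ c, q = 2 ^ u * (2 * c + 1) + 1) :
    ∃ c, q ^ 2 ^ t = 2 ^ (u + t) * (2 * c + 1) + 1 := by
  induction t with
  | zero => simpa using hq
  | succ t ih =>
    obtain ⟨c, hc⟩ := ih
    obtain ⟨w, hw⟩ : ∃ w, u + t = w + 2 := ⟨u + t - 2, by omega⟩
    refine ⟨c + 2 ^ w * (2 * c + 1) ^ 2, ?_⟩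
    rw [pow_succ, pow_mul, hc, ← add_assoc, hw]
    ring

theorem exists_pow_two_pow_eq_neg_one {F : Type} [Field F] {y : F} {u N : ℕ}
    (hN : y ^ 2 ^ (u + N) = 1) (hu : y ^ 2 ^ u ≠ 1) : ∃ t, y ^ 2 ^ (u + t) = -1 := by
  induction N with
  | zero => exact absurd hN hu
  | succ N ih =>
    by_cases h : y ^ 2 ^ (u + N) = 1
    · exact ih h
    · rw [← add_assoc, pow_succ, pow_mul] at hN
      exact ⟨N, (eq_or_eq_neg_of_sq_eq_sq _ 1 (hN.trans (one_pow 2).symm)).resolve_left h⟩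

theorem exists_odd_sign_function (F : Type) [Field F] [Fintype F] (h2 : ringChar F ≠ 2) :
    ∃ σ : F → ℤ, σ 0 = 0 ∧ (∀ x, σ (-x) = -σ x) ∧ ∀ x, x ≠ 0 → σ x = 1 ∨ σ x = -1 := by
  let e := Fintype.equivFin F
  refine ⟨fun x => Int.sign ((e x : ℤ) - e (-x)), by simp, fun x => ?_, fun x hx => ?_⟩
  · simp only [neg_neg]
    rw [← Int.sign_neg, neg_sub]
  · have hne : (e x : ℤ) - e (-x) ≠ 0 := by
      intro h
      have : e x = e (-x) := Fin.ext (by omega)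
      exact hx ((Ring.eq_self_iff_eq_zero_of_char_ne_two h2).1 (e.injective this).symm)
    rcases lt_or_gt_of_ne hne with h | h
    · exact Or.inr (Int.sign_eq_neg_one_of_neg h)
    · exact Or.inl (Int.sign_eq_one_of_pos h)

theorem sum_range_mul_of_periodic {M : Type} [AddCommMonoid M] {f : ℕ → M} {c : ℕ}
    (hf : Function.Periodic f c) (t : ℕ) :
    ∑ j ∈ range (c * t), f j = t • ∑ j ∈ range c, f j := by
  induction t with
  | zero => simp
  | succ t ih =>
    rw [Nat.mul_succ, Finset.sum_range_add, ih, succ_nsmul]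
    congr 1
    refine Finset.sum_congr rfl fun j _ => ?_
    rw [add_comm, mul_comm, ← smul_eq_mul]
    exact hf.nsmul t j

section RootsOfUnity

variable {F : Type} [Field F] [Fintype F]

theorem sum_pow_eq_one_of_isPrimitiveRoot {κ : F} {n : ℕ} (hn : 0 < n) (hκ : IsPrimitiveRoot κ n)
    (Q : F → ℂ) : ∑ s with s ^ n = 1, Q s = ∑ j ∈ range n, Q (κ ^ j) := by
  symm
  refine Finset.sum_nbij (fun j => κ ^ j) ?_ ?_ ?_ fun _ _ => rfl
  · intro j _
    simp only [mem_filter, mem_univ, true_and]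
    rw [← pow_mul, mul_comm, pow_mul, hκ.pow_eq_one, one_pow]
  · intro i hi j hj hij
    exact hκ.pow_inj (by simpa using hi) (by simpa using hj) hij
  · intro s hs
    have : NeZero n := ⟨hn.ne'⟩
    obtain ⟨i, hi, rfl⟩ := hκ.eq_pow_of_pow_eq_one (by simpa using hs)
    exact ⟨i, by simpa using hi, rfl⟩

theorem exists_isPrimitiveRoot_of_dvd {n : ℕ} (hn : n ∣ Fintype.card F - 1) :
    ∃ κ : F, IsPrimitiveRoot κ n := by
  obtain ⟨g, hg⟩ := IsCyclic.exists_ofOrder_eq_natCard (α := Fˣ)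
  have h1 : IsPrimitiveRoot (g : F) (Fintype.card F - 1) := by
    rw [IsPrimitiveRoot.coe_units_iff, IsPrimitiveRoot.iff_orderOf, hg, Nat.card_eq_fintype_card, Fintype.card_units]
  obtain ⟨m, hm⟩ := hn
  have : 0 < Fintype.card F - 1 := by
    have := Fintype.one_lt_card (α := F); omega
  exact ⟨_, h1.pow this (hm.trans (mul_comm _ _))⟩

end RootsOfUnity

/-- Odd `±1`-valued functions whose correlations sum to `-ℓ` are the signs of a skew Hadamard
difference family. -/
theorem isDiffFamily_and_isSkewSet_of_odd {G : Type} [AddCommGroup G] [Fintype G] {ℓ : ℕ}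
    (hG : 3 ≤ Fintype.card G) (f : Fin ℓ → G → ℤ) (f0 : ∀ i, f i 0 = 0)
    (hodd : ∀ i x, f i (-x) = -f i x) (hf : ∀ i x, x ≠ 0 → f i x = 1 ∨ f i x = -1)
    (hcorr : ∀ g, g ≠ 0 → ∑ i, ∑ x, f i x * f i (x - g) = -ℓ) :
    IsDiffFamily (fun i => univ.filter (fun x => f i x = 1)) ((Fintype.card G - 1) / 2)
      (ℓ * (Fintype.card G - 3) / 4) ∧
    ∀ i, IsSkewSet (univ.filter (fun x => f i x = 1)) := by
  set v := Fintype.card G with hv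
  have hind (i x) : 2 * (if f i x = 1 then 1 else 0 : ℤ) = f i x + 1 - if x = 0 then 1 else 0 := by
    by_cases hx : x = 0
    · simp [hx, f0]
    · rcases hf i x hx with h | h <;> simp [hx, h]
  have hsum (i) : ∑ x, f i x = 0 := by
    have h1 : ∑ x, f i x = -∑ x, f i x := by
      rw [← Finset.sum_neg_distrib]
      exact Fintype.sum_equiv (Equiv.neg G) _ _ fun x => by simp [hodd]
    omega
  have hshift (i g) : ∑ x, f i (x - g) = 0 := by
    rw [← hsum i]
    exact Fintype.sum_equiv (Equiv.subRight g) _ _ fun x => rfl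
  have hcard (i) : 2 * ((#{x | f i x = 1} : ℕ) : ℤ) = v - 1 := by
    rw [Finset.card_filter]
    push_cast
    rw [Finset.mul_sum, Finset.sum_congr rfl fun x _ => hind i x, Finset.sum_sub_distrib,
      Finset.sum_add_distrib, hsum]
    simp [hv]
  refine ⟨⟨fun i => ?_, fun g hg => ?_⟩, fun i => ⟨?_, ?_⟩⟩
  · have := hcard i
    dsimp only
    omega
  · have hcount (i) : 4 * ((#{p ∈ univ.filter (fun x => f i x = 1) ×ˢ
        univ.filter (fun x => f i x = 1) | p.1 ≠ p.2 ∧ p.1 - p.2 = g} : ℕ) : ℤ) =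
        ∑ x, f i x * f i (x - g) + (v - 2) := by
      have h1 : #{p ∈ univ.filter (fun x => f i x = 1) ×ˢ
          univ.filter (fun x => f i x = 1) | p.1 ≠ p.2 ∧ p.1 - p.2 = g} =
          #{x | f i x = 1 ∧ f i (x - g) = 1} := by
        refine Finset.card_nbij' (fun p => p.1) (fun x => (x, x - g)) ?_ ?_ ?_ ?_
        · rintro ⟨x, y⟩ h
          simp only [coe_filter, mem_product, mem_filter, mem_univ, true_and, Set.mem_ofPred_eq] at h ⊢
          obtain ⟨⟨hx, hy⟩, -, rfl⟩ := h
          simpa using ⟨hx, hy⟩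
        · intro x h
          simp only [coe_filter, mem_product, mem_filter, mem_univ, true_and, Set.mem_ofPred_eq] at h ⊢
          refine ⟨h, fun h' => hg ?_, by abel⟩
          simpa using h'.symm
        · rintro ⟨x, y⟩ h
          simp only [coe_filter, mem_product, mem_filter, mem_univ, true_and, Set.mem_ofPred_eq] at h ⊢
          obtain ⟨-, -, rfl⟩ := h
          simp
        · intro x _
          rfl
      have h2 (x) : 4 * (if f i x = 1 ∧ f i (x - g) = 1 then 1 else 0 : ℤ) =
          f i x * f i (x - g) + f i x + f i (x - g) + 1
            - (if x = 0 then f i (x - g) + 1 else 0) - (if x = g then f i x + 1 else 0) := by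
        have h3 : (if f i x = 1 ∧ f i (x - g) = 1 then 1 else 0 : ℤ) =
            (if f i x = 1 then 1 else 0) * (if f i (x - g) = 1 then 1 else 0) := by
          split_ifs <;> simp_all
        have h4 := hind i (x - g)
        rw [sub_eq_zero] at h4
        have h5 := hind i x
        calc _ = (2 * (if f i x = 1 then 1 else 0 : ℤ)) *
              (2 * (if f i (x - g) = 1 then 1 else 0 : ℤ)) := by rw [h3]; ring
          _ = _ := by
            rw [h4, h5]
            split_ifs with hx hy hy
            · exact absurd (hx.symm.trans hy).symm hg
            all_goals ring
      rw [h1, Finset.card_filter]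
      push_cast
      rw [Finset.mul_sum, Finset.sum_congr rfl fun x _ => h2 x]
      simp only [Finset.sum_sub_distrib, Finset.sum_add_distrib, hsum, hshift]
      simp [hodd, hv]
      ring
    have h3 : 4 * ((∑ i, #{p ∈ univ.filter (fun x => f i x = 1) ×ˢ
        univ.filter (fun x => f i x = 1) | p.1 ≠ p.2 ∧ p.1 - p.2 = g} : ℕ) : ℤ) =
        ((ℓ * (v - 3) : ℕ) : ℤ) := by
      push_cast [Nat.cast_sub hG]
      rw [Finset.mul_sum, Finset.sum_congr rfl fun i _ => hcount i, Finset.sum_add_distrib,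
        hcorr g hg]
      simp
      ring
    dsimp only
    omega
  · ext x
    simp only [mem_inter, mem_filter, mem_univ, true_and, mem_image, notMem_empty, iff_false]
    rintro ⟨hx, y, hy, rfl⟩
    rw [hodd, hy] at hx
    omega
  · ext x
    simp only [mem_union, mem_filter, mem_univ, true_and, mem_image, mem_sdiff, mem_singleton]
    constructor
    · rintro (hx | ⟨y, hy, rfl⟩) h0
      · simp [h0, f0] at hx
      · rw [neg_eq_zero] at h0
        simp [h0, f0] at hy
    · intro hx
      rcases hf i x hx with h | h
      · exact Or.inl h
      · exact Or.inr ⟨-x, by rw [hodd, h, neg_neg], neg_neg x⟩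

section Cyclotomy

variable {F : Type} [Field F] [Fintype F]

/-- The power spectrum of `x ↦ σ (x ^ h)` sums to a constant over `2 ^ (u - 1)` consecutive powers
of `κ`. -/
theorem sum_pow_mul_fourier {u h : ℕ} (hu : 1 ≤ u) (hh : Odd h)
    {ψ : AddChar F ℂ} (hψ : ψ.IsPrimitive) {σ : F → ℤ} (σ0 : σ 0 = 0)
    (σodd : ∀ x, σ (-x) = -σ x) (hσ : ∀ x, x ≠ 0 → σ x = 1 ∨ σ x = -1)
    (hfrob : ∀ b : F, b ≠ 0 → b ^ (2 ^ u * h) ≠ 1 → ∃ d,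
      Function.Injective (fun x : F => x ^ (d + 1)) ∧ (∀ x, ψ (x ^ (d + 1)) = ψ x) ∧
      2 ^ u ∣ d ∧ b ^ (d * h) = -1)
    {κ : F} (hκ : IsPrimitiveRoot κ (2 ^ u * h)) {a : F} (ha : a ≠ 0) :
    ∑ j ∈ range (2 ^ (u - 1)), (∑ x, (σ (x ^ h) : ℂ) * ψ (x * (κ ^ j * a))) *
      (∑ x, (σ (x ^ h) : ℂ) * ψ (x * -(κ ^ j * a))) = Fintype.card F * 2 ^ (u - 1) := by
  obtain ⟨w, rfl⟩ : ∃ w, u = w + 1 := ⟨u - 1, by omega⟩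
  rw [Nat.add_sub_cancel]
  set n := 2 ^ (w + 1) * h with hn
  have h0 : 0 < h := hh.pos
  have hn0 : 0 < n := by positivity
  have hneven : Even n := by
    rw [hn, pow_succ]
    exact ⟨2 ^ w * h, by ring⟩
  have hhn : h ∣ n := Dvd.intro_left _ rfl
  have hsodd (x : F) : (σ ((-x) ^ h) : ℂ) = -(σ (x ^ h) : ℂ) := by
    rw [hh.neg_pow, σodd, Int.cast_neg]
  have hvan : ∀ c b : F, b ≠ 0 → b ^ n ≠ 1 →
      ∑ x, (if x ^ n = 1 then (σ ((x * c) ^ h) : ℂ) else 0) * ψ (x * b) = 0 := by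
    intro c b hb0 hb
    obtain ⟨d, hinj, hψd, ⟨t, rfl⟩, hbd⟩ := hfrob b hb0 hb
    refine sum_mul_addChar_eq_zero hh hinj hψd
      (φ := fun x => if x ^ n = 1 then (σ ((x * c) ^ h) : ℂ) else 0) ?_ ?_ ?_ hb0 hbd
    · intro x
      simp only [hneven.neg_pow, neg_mul, hsodd]
      split_ifs <;> simp
    · intro η x hη
      have hη' : η ^ n = 1 := by
        obtain ⟨m, hm⟩ := hhn
        rw [hm, pow_mul, hη, one_pow]
      simp only [mul_pow, hη, hη', one_mul]
    · intro x
      have h1 : (x ^ (2 ^ (w + 1) * t + 1)) ^ n = 1 ↔ x ^ n = 1 := by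
        rw [pow_right_comm]
        exact ⟨fun hx => hinj (by simpa using hx), fun hx => by rw [hx, one_pow]⟩
      simp only [h1]
      split_ifs with hx
      · have h2 : (x ^ (2 ^ (w + 1) * t + 1)) ^ h = x ^ h := by
          have : (x ^ (2 ^ (w + 1) * t + 1)) ^ h = (x ^ n) ^ t * x ^ h := by rw [hn]; ring
          rw [this, hx, one_pow, one_mul]
        rw [mul_pow, h2, ← mul_pow]
      · rfl
  have hsq (x : F) (hx : x ≠ 0) : (σ (x ^ h) : ℂ) * σ (x ^ h) = 1 := by
    rcases hσ _ (pow_ne_zero h hx) with h1 | h1 <;> simp [h1]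
  have key := sum_subgroup_fourier hψ hn0.ne' hneven.neg_one_pow
    (f := fun x => (σ (x ^ h) : ℂ)) (by simp [h0.ne', σ0]) hsodd hsq hvan ha
  have hκneg : (κ ^ 2 ^ w) ^ h = -1 := by
    have h1 : ((κ ^ 2 ^ w) ^ h) ^ 2 = 1 ^ 2 := by
      have : ((κ ^ 2 ^ w) ^ h) ^ 2 = κ ^ n := by rw [hn]; ring
      rw [this, hκ.pow_eq_one, one_pow]
    refine (eq_or_eq_neg_of_sq_eq_sq _ _ h1).resolve_left fun h2 => ?_
    rw [← pow_mul] at h2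
    refine hκ.pow_ne_one_of_pos_of_lt (by positivity) ?_ h2
    rw [hn, pow_succ]
    have : 0 < 2 ^ w * h := by positivity
    linarith
  have hκ0 : κ ≠ 0 := hκ.ne_zero hn0.ne'
  have hper (b : F) : ∑ x, (σ (x ^ h) : ℂ) * ψ (x * (κ ^ 2 ^ w * b)) =
      -∑ x, (σ (x ^ h) : ℂ) * ψ (x * b) := by
    rw [← Finset.sum_neg_distrib]
    refine Fintype.sum_equiv (Equiv.mulLeft₀ (κ ^ 2 ^ w) (pow_ne_zero _ hκ0)) _ _ fun x => ?_
    rw [Equiv.mulLeft₀_apply, mul_pow, hκneg, neg_one_mul, σodd, Int.cast_neg, neg_mul, neg_neg]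
    ring_nf
  set Q : F → ℂ := fun b => (∑ x, (σ (x ^ h) : ℂ) * ψ (x * (b * a))) *
    (∑ x, (σ (x ^ h) : ℂ) * ψ (x * -(b * a))) with hQ
  have hQper : Function.Periodic (fun j : ℕ => Q (κ ^ j)) (2 ^ w) := by
    intro j
    have h1 : κ ^ (j + 2 ^ w) * a = κ ^ 2 ^ w * (κ ^ j * a) := by ring
    simp only [hQ]
    rw [h1, ← mul_neg, hper, hper, neg_mul_neg]
  have hcard : (#{s : F | s ^ n = 1} : ℂ) = n := by
    have := sum_pow_eq_one_of_isPrimitiveRoot hn0 hκ (fun _ => 1)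
    simpa using this
  have hsplit : n = 2 ^ w * (2 * h) := by rw [hn]; ring
  rw [sum_pow_eq_one_of_isPrimitiveRoot hn0 hκ Q, hcard] at key
  rw [hsplit, sum_range_mul_of_periodic hQper, nsmul_eq_mul] at key
  have hne : ((2 * h : ℕ) : ℂ) ≠ 0 := by exact_mod_cast (by positivity : 0 < 2 * h).ne'
  refine mul_left_cancel₀ hne (key.trans ?_)
  push_cast
  ring

/-- A function whose dilates by powers of `κ` have constant total power spectrum away from zero has
constant total correlation away from zero. -/
theorem sum_correlation_eq_neg {ψ : AddChar F ℂ} (hψ : ψ.IsPrimitive) {f : F → ℤ}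
    (hodd : ∀ x, f (-x) = -f x) {κ : F} (hκ : κ ≠ 0) {ℓ : ℕ}
    (hf : ∀ a, a ≠ 0 → ∑ j ∈ range ℓ, (∑ x, (f x : ℂ) * ψ (x * (κ ^ j * a))) *
      (∑ x, (f x : ℂ) * ψ (x * -(κ ^ j * a))) = Fintype.card F * ℓ)
    {g : F} (hg : g ≠ 0) :
    ∑ j ∈ range ℓ, ∑ x, f ((κ ^ j)⁻¹ * x) * f ((κ ^ j)⁻¹ * (x - g)) = -ℓ := by
  have hv : (Fintype.card F : ℂ) ≠ 0 := by exact_mod_cast Fintype.card_ne_zero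
  have hscale (j : ℕ) (b : F) : ∑ x, (f ((κ ^ j)⁻¹ * x) : ℂ) * ψ (x * b) =
      ∑ x, (f x : ℂ) * ψ (x * (κ ^ j * b)) := by
    have hj : κ ^ j ≠ 0 := pow_ne_zero j hκ
    refine (Fintype.sum_equiv (Equiv.mulLeft₀ (κ ^ j) hj) _ _ fun x => ?_).symm
    rw [Equiv.mulLeft₀_apply, inv_mul_cancel_left₀ hj]
    ring_nf
  have hsum : ∑ x, f x = 0 := by
    have h1 : ∑ x, f x = -∑ x, f x := by
      rw [← Finset.sum_neg_distrib]
      exact Fintype.sum_equiv (Equiv.neg F) _ _ fun x => by simp [hodd]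
    omega
  have hψg : ∑ a, ψ (-(g * a)) = 0 := by
    have := AddChar.sum_mulShift (-g) hψ
    simp only [neg_eq_zero, hg, if_false, Nat.cast_zero] at this
    rw [← this]
    exact Finset.sum_congr rfl fun a _ => by ring_nf
  have key : (Fintype.card F : ℂ) * ∑ j ∈ range ℓ, ∑ x,
      (f ((κ ^ j)⁻¹ * x) : ℂ) * f ((κ ^ j)⁻¹ * (x - g)) = Fintype.card F * -ℓ := by
    rw [Finset.mul_sum, Finset.sum_congr rfl fun j _ =>
      (sum_fourier_mul_fourier_neg hψ (fun x => (f ((κ ^ j)⁻¹ * x) : ℂ)) g).symm,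
      Finset.sum_comm]
    simp_rw [← Finset.sum_mul, hscale, mul_neg]
    have h1 (a : F) : (∑ j ∈ range ℓ, (∑ x, (f x : ℂ) * ψ (x * (κ ^ j * a))) *
        (∑ x, (f x : ℂ) * ψ (-(x * (κ ^ j * a))))) * ψ (-(g * a)) =
        Fintype.card F * ℓ * ψ (-(g * a)) - if a = 0 then (Fintype.card F * ℓ : ℂ) else 0 := by
      by_cases ha : a = 0
      · have : ∑ x, (f x : ℂ) = 0 := by exact_mod_cast hsum
        simp [ha, this]
      · have := hf a ha
        simp_rw [mul_neg] at this
        simp [this, ha]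
    rw [Finset.sum_congr rfl fun a _ => h1 a, Finset.sum_sub_distrib, ← Finset.mul_sum, hψg]
    simp
  have := mul_left_cancel₀ hv key
  exact_mod_cast this

end Cyclotomy

/-- **Theorem (main).** If `u ≥ 2`, `q` is a prime power with
`q ≡ 2^u + 1 (mod 2^(u+1))` and `e ≥ 1`, then the finite field of order `q^e`
admits a skew Hadamard difference family with `2^(u-1)` blocks, each of size
`(q^e - 1)/2`, with parameters `(q^e, (q^e-1)/2, 2^(u-1)(q^e-3)/4)`. -/
theorem skew_hadamard_difference_family_exists
    (u : ℕ) (hu : 2 ≤ u) (q : ℕ) (hq : IsPrimePow q)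
    (hmod : q % 2 ^ (u + 1) = 2 ^ u + 1)
    (e : ℕ) (he : 0 < e)
    (F : Type) [Field F] [Fintype F] (hF : Fintype.card F = q ^ e) :
    ∃ B : Fin (2 ^ (u - 1)) → Finset F,
      IsDiffFamily B ((q ^ e - 1) / 2) (2 ^ (u - 1) * (q ^ e - 3) / 4) ∧
      ∀ i, IsSkewSet (B i) := by
  obtain ⟨p, k, hp, hk, rfl⟩ := hq
  have hp' : p.Prime := hp.nat_prime
  have : Fact p.Prime := ⟨hp'⟩
  have hdiv := Nat.div_add_mod (p ^ k) (2 ^ (u + 1))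
  rw [hmod] at hdiv
  have hq2 : ∃ c, p ^ k = 2 ^ u * (2 * c + 1) + 1 := by
    refine ⟨p ^ k / 2 ^ (u + 1), ?_⟩
    rw [pow_succ] at hdiv ⊢
    linarith
  have hchar : CharP F p := by
    obtain ⟨m, hr, hm⟩ := FiniteField.card F (ringChar F)
    have h1 : p ∣ ringChar F ^ (m : ℕ) := by
      rw [← hm, hF, ← pow_mul]
      exact dvd_pow_self p (Nat.mul_ne_zero hk.ne' he.ne')
    have h2 := (Nat.prime_dvd_prime_iff_eq hp' hr).1 (hp'.dvd_of_dvd_pow h1)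
    exact h2 ▸ ringChar.charP F
  have hpodd : Odd p := by
    obtain ⟨c, hc⟩ := hq2
    refine Nat.Odd.of_mul_left (n := p ^ (k - 1)) ?_
    rw [← pow_succ', Nat.sub_add_cancel hk, hc]
    obtain ⟨w, rfl⟩ : ∃ w, u = w + 1 := ⟨u - 1, by omega⟩
    exact ⟨2 ^ w * (2 * c + 1), by ring⟩
  have hF2 : ringChar F ≠ 2 := by
    rw [ringChar.eq F p]
    rintro rfl
    exact absurd hpodd (by decide)
  obtain ⟨ψ, hψ, hψfrob⟩ := exists_primitive_addChar_pow_invariant F p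
  obtain ⟨σ, σ0, σodd, hσ⟩ := exists_odd_sign_function F hF2
  have hv1 : 1 < Fintype.card F := Fintype.one_lt_card
  obtain ⟨N, h, hh, hNh⟩ := Nat.exists_eq_two_pow_mul_odd (n := Fintype.card F - 1) (by omega)
  have hdvd : 2 ^ u ∣ Fintype.card F - 1 := by
    obtain ⟨c, hc⟩ := hq2
    rw [hF]
    refine dvd_trans ?_ (Nat.sub_one_dvd_pow_sub_one _ e)
    exact ⟨2 * c + 1, by omega⟩
  have huN : u ≤ N := by
    rw [hNh] at hdvd
    exact (Nat.pow_dvd_pow_iff_le_right (by norm_num)).1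
      ((Nat.Coprime.pow_left u (Nat.coprime_two_left.2 hh)).dvd_of_dvd_mul_right hdvd)
  obtain ⟨m, rfl⟩ := Nat.exists_eq_add_of_le huN
  obtain ⟨κ, hκ⟩ := exists_isPrimitiveRoot_of_dvd (F := F) (n := 2 ^ u * h)
    ⟨2 ^ m, by rw [hNh]; ring⟩
  have hκ0 : κ ≠ 0 := hκ.ne_zero (Nat.mul_ne_zero (by positivity) hh.pos.ne')
  have hfrob : ∀ b : F, b ≠ 0 → b ^ (2 ^ u * h) ≠ 1 → ∃ d,
      Function.Injective (fun x : F => x ^ (d + 1)) ∧ (∀ x, ψ (x ^ (d + 1)) = ψ x) ∧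
      2 ^ u ∣ d ∧ b ^ (d * h) = -1 := by
    intro b hb0 hb
    have h1 : (b ^ h) ^ 2 ^ (u + m) = 1 := by
      rw [← pow_mul, mul_comm, ← hNh, FiniteField.pow_card_sub_one_eq_one b hb0]
    have h2 : (b ^ h) ^ 2 ^ u ≠ 1 := by rwa [← pow_mul, mul_comm]
    obtain ⟨t, ht⟩ := exists_pow_two_pow_eq_neg_one h1 h2
    obtain ⟨c, hc⟩ := exists_pow_two_pow_sub_one u t hu _ hq2
    refine ⟨2 ^ (u + t) * (2 * c + 1), ?_, ?_, ?_, ?_⟩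
    · rw [← hc, ← pow_mul]
      exact iterateFrobenius_inj F p (k * 2 ^ t)
    · rw [← hc, ← pow_mul]
      exact hψfrob _
    · exact (pow_dvd_pow 2 (Nat.le_add_right u t)).mul_right _
    · have : b ^ (2 ^ (u + t) * (2 * c + 1) * h) = ((b ^ h) ^ 2 ^ (u + t)) ^ (2 * c + 1) := by ring
      rw [this, ht, Odd.neg_one_pow ⟨c, rfl⟩]
  have hodd (x : F) : σ ((-x) ^ h) = -σ (x ^ h) := by rw [hh.neg_pow, σodd]
  have hv3 : 3 ≤ Fintype.card F := by
    obtain ⟨c, hc⟩ := hdvd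
    have : 2 ^ 2 ≤ 2 ^ u := Nat.pow_le_pow_right (by norm_num) hu
    have h1 := Nat.le_of_dvd (by omega) (Dvd.intro c hc.symm)
    omega
  rw [← hF]
  refine ⟨_, isDiffFamily_and_isSkewSet_of_odd hv3
    (fun (j : Fin (2 ^ (u - 1))) x => σ (((κ ^ (j : ℕ))⁻¹ * x) ^ h)) ?_ ?_ ?_ ?_⟩
  · simp [hh.pos.ne', σ0]
  · intro j x
    rw [mul_neg, hodd]
  · intro j x hx
    exact hσ _ (pow_ne_zero _ (mul_ne_zero (inv_ne_zero (pow_ne_zero _ hκ0)) hx))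
  · intro g hg
    rw [Fin.sum_univ_eq_sum_range (fun j => ∑ x, σ (((κ ^ j)⁻¹ * x) ^ h) *
      σ (((κ ^ j)⁻¹ * (x - g)) ^ h))]
    refine sum_correlation_eq_neg hψ (f := fun x => σ (x ^ h)) hodd hκ0 (fun a ha => ?_) hg
    rw [sum_pow_mul_fourier (by omega) hh hψ σ0 σodd hσ hfrob hκ ha]
    push_cast
    rfl
end

section
/- Let u ≥ 2 be an integer, q a prime power with q ≡ 2^u + 1 (mod 2^{u+1}), t ≥ u+1 an integer, N = 2^t and f = 2^{t−u}. Let ω be a primitive element of F_{q^f} and for h = 0,1,…,N−1 set D_h = ∪_{j=0}^{N/2−1} C_{h+j}^{(N,q^f)} (indices mod N). Then the family {D_{2^{t−u}ℓ} : ℓ = 0,1,…,2^{u−1}−1} is a skew Hadamard difference family in (F_{q^f},+). -/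
open Finset
open scoped Classical

/-- The cyclotomic class `C_i^{(N,Q)} = γ^i ⟨γ^N⟩ = {γ^(i+Nj) : j ≥ 0}`. -/
noncomputable def cycClass {F : Type} [Field F] [Fintype F] (γ : F) (N i : ℕ) : Finset F :=
  Finset.univ.filter (fun x => ∃ j : ℕ, x = γ ^ (i + N * j))

/-- A finite field carries a primitive complex additive character invariant under Frobenius. -/
theorem exists_primitive_addChar_frobenius_invariant (K : Type) [Field K] [Fintype K] :
    ∃ ψ : AddChar K ℂ, ψ.IsPrimitive ∧ ∀ x, ψ (x ^ ringChar K) = ψ x := by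
  set p := ringChar K with hp
  have : Fact p.Prime := ⟨CharP.char_is_prime K _⟩
  let _ : Algebra (ZMod p) K := ZMod.algebra _ _
  have hζ := Complex.isPrimitiveRoot_exp p (NeZero.ne p)
  let χ : AddChar (ZMod p) ℂ := AddChar.zmodChar p hζ.pow_eq_one
  have hχ : χ.IsPrimitive := AddChar.zmodChar_primitive_of_primitive_root p hζ
  refine ⟨χ.compAddMonoidHom (Algebra.trace (ZMod p) K).toAddMonoidHom,
    AddChar.IsPrimitive.of_ne_one ?_, fun x => ?_⟩
  · obtain ⟨a, ha⟩ := FiniteField.trace_to_zmod_nondegenerate K one_ne_zero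
    rw [one_mul] at ha
    exact AddChar.ne_one_iff.2 ⟨a, fun hf => ha <| (hχ.zmod_char_eq_one_iff p _).mp hf⟩
  · have h := Algebra.trace_eq_of_algEquiv
      (FiniteField.frobeniusAlgEquivOfAlgebraic (ZMod p) K) x
    rw [FiniteField.coe_frobeniusAlgEquivOfAlgebraic, ZMod.card] at h
    exact congrArg χ h

/-- If `q ≡ 2 ^ u + 1` modulo `2 ^ (u + 1)` with `u ≥ 2`, then `q ^ 2 ^ i - 1` is an odd
multiple of `2 ^ (u + i)`. -/
theorem pow_two_pow_eq_odd_mul_add_one {u q : ℕ} (hu : 2 ≤ u)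
    (hmod : q % 2 ^ (u + 1) = 2 ^ u + 1) (i : ℕ) :
    ∃ c, q ^ 2 ^ i = 2 ^ (u + i) * (2 * c + 1) + 1 := by
  induction i with
  | zero =>
    refine ⟨q / 2 ^ (u + 1), ?_⟩
    have h := Nat.div_add_mod q (2 ^ (u + 1))
    rw [hmod] at h
    rw [pow_zero, pow_one, ← h, h]
    conv_lhs => rw [← h]
    ring
  | succ i ih =>
    obtain ⟨c, hc⟩ := ih
    obtain ⟨v, rfl⟩ := Nat.exists_eq_add_of_le hu
    refine ⟨c + 2 ^ (v + i) * (2 * c + 1) ^ 2, ?_⟩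
    rw [pow_succ 2 i, pow_mul, hc]
    ring

/-- The powers `q ^ 2 ^ i` move every exponent not divisible by `2 ^ (t - u)` by an odd multiple
of `2 ^ (t - 1)`. -/
theorem exists_pow_sub_one_mul_eq_odd_mul {u q t n : ℕ} (hu : 2 ≤ u)
    (hmod : q % 2 ^ (u + 1) = 2 ^ u + 1) (ht : u + 1 ≤ t) (hn : ¬ 2 ^ (t - u) ∣ n) :
    ∃ i r c, q ^ 2 ^ i = 2 * r + 1 ∧ n * (2 * r) = 2 ^ (t - 1) * (2 * c + 1) := by
  have hn0 : n ≠ 0 := by rintro rfl; exact hn (dvd_zero _)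
  obtain ⟨a, b, hb, rfl⟩ := Nat.exists_eq_two_pow_mul_odd hn0
  have ha : a < t - u := by
    by_contra! h
    exact hn ((pow_dvd_pow 2 h).trans (dvd_mul_right _ _))
  obtain ⟨d, rfl⟩ := hb
  obtain ⟨c, hc⟩ := pow_two_pow_eq_odd_mul_add_one hu hmod (t - 1 - a - u)
  refine ⟨t - 1 - a - u, 2 ^ (t - 1 - a - 1) * (2 * c + 1), 2 * c * d + c + d, ?_, ?_⟩
  · rw [hc, show u + (t - 1 - a - u) = (t - 1 - a - 1) + 1 by omega]
    ring
  · obtain ⟨e, he⟩ : ∃ e, t - 1 - a - 1 = e := ⟨_, rfl⟩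
    rw [he, show t - 1 = e + 1 + a by omega]
    ring

/-- Convolution and Fourier transform: if the squares of the Fourier transforms of a family sum to
a constant away from `0` and to `0` at `0`, then the self-convolutions sum to a constant. -/
theorem card_mul_sum_convolution_eq {K ι : Type} [Field K] [Fintype K] [Fintype ι]
    {ψ : AddChar K ℂ} (hψ : ψ.IsPrimitive) (f : ι → K → ℂ) (E : ℂ)
    (h0 : ∑ i, (∑ x, f i x) ^ 2 = 0)
    (hE : ∀ b ≠ 0, ∑ i, (∑ x, f i x * ψ (b * x)) ^ 2 = E) {g : K} (hg : g ≠ 0) :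
    (Fintype.card K : ℂ) * ∑ i, ∑ x, f i x * f i (g - x) = -E := by
  have key : ∑ b, ψ (b * (-g)) * ∑ i, (∑ x, f i x * ψ (b * x)) ^ 2
      = (Fintype.card K : ℂ) * ∑ i, ∑ x, f i x * f i (g - x) := by
    have hterm : ∀ i, ∑ b, ψ (b * (-g)) * (∑ x, f i x * ψ (b * x)) ^ 2
        = (Fintype.card K : ℂ) * ∑ x, f i x * f i (g - x) := by
      intro i
      have : ∀ b, ψ (b * (-g)) * (∑ x, f i x * ψ (b * x)) ^ 2
          = ∑ x, ∑ y, f i x * f i y * ψ (b * (y - (g - x))) := by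
        intro b
        rw [sq, Finset.sum_mul_sum, Finset.mul_sum]
        refine Finset.sum_congr rfl fun x _ => ?_
        rw [Finset.mul_sum]
        refine Finset.sum_congr rfl fun y _ => ?_
        rw [show b * (y - (g - x)) = b * (-g) + (b * x + b * y) by ring,
          AddChar.map_add_eq_mul, AddChar.map_add_eq_mul]
        ring
      simp_rw [this]
      rw [Finset.sum_comm, Finset.mul_sum]
      refine Finset.sum_congr rfl fun x _ => ?_
      rw [Finset.sum_comm]
      simp_rw [← Finset.mul_sum, AddChar.sum_mulShift _ hψ, sub_eq_zero]
      simp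
      ring
    simp_rw [Finset.mul_sum]
    rw [Finset.sum_comm]
    simp_rw [← Finset.mul_sum, hterm, Finset.mul_sum]
  have hsum := AddChar.sum_mulShift (-g) hψ
  rw [if_neg (neg_ne_zero.2 hg), Fintype.sum_eq_add_sum_compl (0 : K)] at hsum
  rw [← key, Fintype.sum_eq_add_sum_compl (0 : K)]
  have h1 : ∑ b ∈ {(0 : K)}ᶜ, ψ (b * (-g)) * ∑ i, (∑ x, f i x * ψ (b * x)) ^ 2
      = (∑ b ∈ {(0 : K)}ᶜ, ψ (b * (-g))) * E := by
    rw [Finset.sum_mul]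
    refine Finset.sum_congr rfl fun b hb => ?_
    rw [hE b (by simpa using hb)]
  rw [h1]
  simp only [zero_mul, AddChar.map_zero_eq_one, mul_one, h0, one_mul, Nat.cast_zero] at hsum ⊢
  linear_combination E * hsum

/-- A weighted character sum vanishes if its weight changes sign under a substitution that
preserves the character values. -/
theorem sum_mul_addChar_eq_zero_s1 {K : Type} [Field K] [Fintype K] {ψ : AddChar K ℂ} {d : K → ℂ}
    {b : K} (hb : b ≠ 0) {r : ℕ} (hinj : Function.Injective fun x : K => x ^ (r + 1))
    (hψ : ∀ x, ψ (x ^ (r + 1)) = ψ x) (hd : ∀ y, d (b ^ r * y ^ (r + 1)) = -d y) :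
    ∑ y, d y * ψ (b * y) = 0 := by
  have hbij : Function.Bijective fun y : K => b ^ r * y ^ (r + 1) :=
    Finite.injective_iff_bijective.1 fun x y h => hinj (mul_left_cancel₀ (pow_ne_zero r hb) h)
  have h : ∑ y, d y * ψ (b * y) = -∑ y, d y * ψ (b * y) := by
    conv_lhs => rw [← hbij.sum_comp]
    rw [← Finset.sum_neg_distrib]
    refine Finset.sum_congr rfl fun y _ => ?_
    rw [hd, show b * (b ^ r * y ^ (r + 1)) = (b * y) ^ (r + 1) by ring, hψ, neg_mul]
  exact self_eq_neg.1 h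

/-- A function that is periodic with period `M * L` and constant on the intervals
`(M * j, M * (j + 1)]` has constant sums over `L` points at distance `M`. -/
theorem sum_progression_const {M L : ℕ} (hM : 0 < M) {P : ℕ → ℂ}
    (hstep : ∀ n, ¬ M ∣ n → P (n + 1) = P n) (hper : ∀ n, P (n + M * L) = P n) (n : ℕ) :
    ∑ ℓ ∈ range L, P (n + M * ℓ) = ∑ ℓ ∈ range L, P (0 + M * ℓ) := by
  induction n with
  | zero => rfl
  | succ n ih =>
    rw [← ih]
    by_cases hn : M ∣ n
    · have hconst : ∀ j k, k < M → P (n + M * j + 1 + k) = P (n + M * j + 1) := by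
        intro j k
        induction k with
        | zero => intro _; rfl
        | succ k ihk =>
          intro hk
          rw [← ihk (by omega), ← hstep (n + M * j + 1 + k)]
          · rfl
          · rw [add_assoc, Nat.dvd_add_right (hn.add (dvd_mul_right _ _))]
            exact Nat.not_dvd_of_pos_of_lt (by omega) (by omega)
      have hshift : ∀ ℓ, P (n + 1 + M * ℓ) = P (n + M * (ℓ + 1)) := by
        intro ℓ
        rw [show n + M * (ℓ + 1) = n + M * ℓ + 1 + (M - 1) by rw [mul_add]; omega,
          hconst ℓ (M - 1) (by omega), add_right_comm]
      simp_rw [hshift]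
      have := (Finset.sum_range_succ (fun ℓ => P (n + M * ℓ)) L).symm.trans
        (Finset.sum_range_succ' (fun ℓ => P (n + M * ℓ)) L)
      rw [hper, mul_zero, add_zero] at this
      exact (add_right_cancel this).symm
    · refine Finset.sum_congr rfl fun ℓ _ => ?_
      rw [add_right_comm]
      exact hstep _ fun h => hn ((Nat.dvd_add_left (dvd_mul_right M ℓ)).1 h)

/-- The square wave of half-period `H`. -/
def squareWave (H n : ℕ) : ℤ := (-1) ^ (n / H)

theorem squareWave_add_mul {H : ℕ} (hH : 0 < H) (n k : ℕ) :
    squareWave H (n + H * k) = (-1) ^ k * squareWave H n := by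
  rw [squareWave, squareWave, Nat.add_mul_div_left _ _ hH, pow_add, mul_comm]

theorem squareWave_succ {H n : ℕ} (h : ¬ H ∣ n + 1) : squareWave H (n + 1) = squareWave H n := by
  rw [squareWave, squareWave, Nat.succ_div, if_neg h, add_zero]

theorem squareWave_eq_of_modEq {H a b : ℕ} (hH : 0 < H) (h : a ≡ b [MOD 2 * H]) :
    squareWave H a = squareWave H b := by
  have hred : ∀ n, squareWave H n = squareWave H (n % (2 * H)) := by
    intro n
    conv_lhs => rw [← Nat.mod_add_div n (2 * H), mul_assoc, mul_left_comm,
      squareWave_add_mul hH, pow_mul]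
    simp
  rw [hred a, hred b, h]

theorem squareWave_eq_one_iff {H n : ℕ} (hH : 0 < H) :
    squareWave H n = 1 ↔ n % (2 * H) < H := by
  have h : n % (2 * H) = n % H + H * (n / H % 2) := by rw [mul_comm, Nat.mod_mul]
  have hlt := Nat.mod_lt n hH
  rw [squareWave]
  rcases Nat.even_or_odd (n / H) with he | ho
  · rw [h, Nat.even_iff.1 he, he.neg_one_pow]; simpa using hlt
  · rw [h, Nat.odd_iff.1 ho, ho.neg_one_pow]; simp

/-- A sign function: odd, zero at zero and `±1` elsewhere. -/
structure IsSignFun {K : Type} [AddCommGroup K] (s : K → ℤ) : Prop where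
  map_zero : s 0 = 0
  map_neg : ∀ x, s (-x) = -s x
  eq_or : ∀ x, x ≠ 0 → s x = 1 ∨ s x = -1

namespace IsSignFun

variable {K : Type} [AddCommGroup K] {s : K → ℤ}

theorem sq_eq (hs : IsSignFun s) (x : K) : s x ^ 2 = 1 - if x = 0 then 1 else 0 := by
  by_cases h : x = 0
  · simp [h, hs.map_zero]
  · rcases hs.eq_or x h with h' | h' <;> simp [h, h']

theorem two_mul_indicator (hs : IsSignFun s) (x : K) :
    2 * (if s x = 1 then 1 else 0) = s x + s x ^ 2 := by
  by_cases h : x = 0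
  · simp [h, hs.map_zero]
  · rcases hs.eq_or x h with h' | h' <;> simp [h']

variable [Fintype K]

theorem sum_eq_zero (hs : IsSignFun s) : ∑ x, s x = 0 := by
  have h : ∑ x, s x = -∑ x, s x := by
    rw [← Finset.sum_neg_distrib, ← Equiv.sum_comp (Equiv.neg K) s]
    simp [hs.map_neg]
  omega

theorem isSkewSet (hs : IsSignFun s) {B : Finset K} (hB : ∀ x, x ∈ B ↔ s x = 1) :
    IsSkewSet B := by
  have hneg : ∀ x, x ∈ B.image (fun x => -x) ↔ s x = -1 := by
    intro x
    simp only [Finset.mem_image, hB]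
    constructor
    · rintro ⟨y, hy, rfl⟩
      rw [hs.map_neg, hy]
    · intro h
      exact ⟨-x, by rw [hs.map_neg, h, neg_neg], neg_neg x⟩
  constructor
  · ext x
    simp only [Finset.mem_inter, hneg, hB, Finset.notMem_empty, iff_false]
    omega
  · ext x
    simp only [Finset.mem_union, hneg, hB, Finset.mem_sdiff, Finset.mem_univ, true_and,
      Finset.mem_singleton]
    constructor
    · rintro h rfl
      rw [hs.map_zero] at h
      omega
    · exact hs.eq_or x

theorem two_mul_card (hs : IsSignFun s) {B : Finset K} (hB : ∀ x, x ∈ B ↔ s x = 1) :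
    2 * (B.card : ℤ) = Fintype.card K - 1 := by
  have h : (B.card : ℤ) = ∑ x, if s x = 1 then 1 else 0 := by
    rw [Finset.sum_boole]
    congr 2
    ext x
    simp [hB]
  rw [h, Finset.mul_sum]
  simp_rw [hs.two_mul_indicator, Finset.sum_add_distrib, hs.sum_eq_zero, hs.sq_eq]
  simp

theorem four_mul_card_differences (hs : IsSignFun s) {B : Finset K} (hB : ∀ x, x ∈ B ↔ s x = 1)
    {g : K} (hg : g ≠ 0) :
    4 * (((B ×ˢ B).filter (fun p => p.1 ≠ p.2 ∧ p.1 - p.2 = g)).card : ℤ)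
      = Fintype.card K - 2 - ∑ x, s x * s (g - x) := by
  have hcard : (((B ×ˢ B).filter (fun p => p.1 ≠ p.2 ∧ p.1 - p.2 = g)).card : ℤ)
      = ∑ x, (if s x = 1 then 1 else 0) * (if s (x - g) = 1 then 1 else 0) := by
    simp_rw [ite_zero_mul_ite_zero, mul_one]
    rw [Finset.sum_boole]
    congr 1
    refine Finset.card_bij (fun p _ => p.1) ?_ ?_ ?_
    · rintro ⟨x, y⟩ h
      simp only [Finset.mem_filter, Finset.mem_product, hB] at h
      simp only [Finset.mem_filter, Finset.mem_univ, true_and]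
      rw [← h.2.2, sub_sub_cancel]
      exact h.1
    · rintro ⟨x, y⟩ h ⟨x', y'⟩ h' hxx
      simp only [Finset.mem_filter] at h h' hxx
      subst hxx
      have := h.2.2.trans h'.2.2.symm
      rw [sub_right_inj] at this
      rw [this]
    · intro x hx
      simp only [Finset.mem_filter, Finset.mem_univ, true_and] at hx
      refine ⟨(x, x - g), ?_, rfl⟩
      simp only [Finset.mem_filter, Finset.mem_product, hB, sub_sub_cancel, and_true]
      exact ⟨hx, fun h => hg (sub_eq_self.1 h.symm)⟩
  have hterm : ∀ x, 4 * ((if s x = 1 then 1 else 0) * (if s (x - g) = 1 then 1 else 0) : ℤ)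
      = -(s x * s (g - x)) + (s x + s (x - g) + 1) - (if x = g then s x + 1 else 0)
        - (if x = 0 then s (x - g) + 1 else 0) := by
    intro x
    have h1 := hs.two_mul_indicator x
    have h2 := hs.two_mul_indicator (x - g)
    rw [show s (g - x) = -s (x - g) by rw [← hs.map_neg, neg_sub]]
    have h3 := hs.sq_eq x
    have h4 := hs.sq_eq (x - g)
    rw [sub_eq_zero] at h4
    have h5 : (2 * (if s x = 1 then 1 else 0)) * (2 * (if s (x - g) = 1 then 1 else 0))
        = (s x + s x ^ 2) * (s (x - g) + s (x - g) ^ 2) := by rw [h1, h2]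
    rw [h3, h4] at h5
    refine (Eq.trans (by ring) h5).trans ?_
    by_cases hx : x = 0
    · subst hx
      simp [hg.symm, hs.map_zero]
    · by_cases hxg : x = g
      · subst hxg
        simp [hx, hs.map_zero]
      · simp [hx, hxg]
        ring
  have hshift : ∑ x, s (x - g) = 0 := by
    rw [← hs.sum_eq_zero]
    exact (Equiv.subRight g).sum_comp s
  rw [hcard, Finset.mul_sum]
  simp_rw [hterm, Finset.sum_sub_distrib, Finset.sum_add_distrib, hshift, hs.sum_eq_zero]
  simp [hs.map_neg]
  ring

end IsSignFun

theorem orderOf_eq_card_sub_one_of_forall_eq_pow {K : Type} [Field K] [Fintype K] {ω : K}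
    (hω0 : ω ≠ 0) (hω : ∀ x : K, x ≠ 0 → ∃ n : ℕ, x = ω ^ n) :
    orderOf ω = Fintype.card K - 1 := by
  have h := orderOf_eq_card_of_forall_mem_powers (g := Units.mk0 ω hω0) fun x => by
    obtain ⟨n, hn⟩ := hω x x.ne_zero
    exact ⟨n, Units.ext (by simp [hn])⟩
  rw [← orderOf_units, Units.val_mk0, Nat.card_eq_fintype_card, Fintype.card_units] at h
  exact h

/-- The square wave of the discrete logarithm. -/
theorem exists_sign_eq_squareWave {K : Type} [Field K] [Fintype K] {ω : K}
    (hω0 : ω ≠ 0) (hω : ∀ x : K, x ≠ 0 → ∃ n : ℕ, x = ω ^ n) {H c : ℕ} (hH : 0 < H)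
    (hcard : Fintype.card K = 2 * H * (2 * c + 1) + 1) :
    ∃ s : K → ℤ, IsSignFun s ∧ ∀ n, s (ω ^ n) = squareWave H n := by
  have hord := orderOf_eq_card_sub_one_of_forall_eq_pow hω0 hω
  rw [hcard, Nat.add_sub_cancel] at hord
  obtain ⟨s, hs0, hsdef⟩ : ∃ s : K → ℤ, s 0 = 0 ∧
      ∀ x (h : x ≠ 0), s x = squareWave H (hω x h).choose :=
    ⟨fun x => if h : x = 0 then 0 else squareWave H (hω x h).choose, dif_pos rfl,
      fun _ h => dif_neg h⟩
  have hs : ∀ n, s (ω ^ n) = squareWave H n := by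
    intro n
    have hn : ω ^ n ≠ 0 := pow_ne_zero n hω0
    rw [hsdef _ hn]
    refine squareWave_eq_of_modEq hH (Nat.ModEq.of_mul_right (2 * c + 1) ?_)
    have := (hω _ hn).choose_spec
    generalize (hω _ hn).choose = m at this ⊢
    rw [← hord, ← Units.val_mk0 hω0, orderOf_units]
    refine (pow_eq_pow_iff_modEq (x := Units.mk0 ω hω0)).1 (Units.ext ?_)
    simpa using this.symm
  refine ⟨s, ⟨hs0, fun x => ?_, fun x hx => ?_⟩, hs⟩
  · by_cases hx : x = 0
    · simp [hx, hs0]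
    have hneg : ω ^ (H * (2 * c + 1)) = -1 := by
      have h1 : ω ^ (H * (2 * c + 1)) * ω ^ (H * (2 * c + 1)) = 1 := by
        rw [← pow_add, ← two_mul, ← mul_assoc, ← hord, pow_orderOf_eq_one]
      refine (mul_self_eq_one_iff.1 h1).resolve_left fun h => ?_
      have hpos : 0 < H * (2 * c + 1) := by positivity
      have := Nat.le_of_dvd hpos (orderOf_dvd_of_pow_eq_one h)
      rw [hord, mul_assoc] at this
      omega
    obtain ⟨n, rfl⟩ := hω x hx
    rw [show -ω ^ n = ω ^ (n + H * (2 * c + 1)) by rw [pow_add, hneg, mul_neg_one], hs, hs,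
      squareWave_add_mul hH]
    simp [pow_add, pow_mul]
  · obtain ⟨n, rfl⟩ := hω x hx
    rw [hs]
    exact neg_one_pow_eq_or ℤ _

theorem mem_biUnion_cycClass_iff {K : Type} [Field K] [Fintype K] {ω : K}
    (hω0 : ω ≠ 0) (hω : ∀ x : K, x ≠ 0 → ∃ n : ℕ, x = ω ^ n) {H : ℕ} (hH : 0 < H) {s : K → ℤ}
    (hs0 : s 0 = 0) (hs : ∀ n, s (ω ^ n) = squareWave H n) (h : ℕ) (x : K) :
    x ∈ (Finset.range H).biUnion (fun j => cycClass ω (2 * H) (h + j)) ↔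
      s (x * (ω ^ h)⁻¹) = 1 := by
  have hh : ω ^ h ≠ 0 := pow_ne_zero h hω0
  simp only [Finset.mem_biUnion, Finset.mem_range, cycClass, Finset.mem_filter, Finset.mem_univ,
    true_and]
  constructor
  · rintro ⟨j, hj, k, rfl⟩
    rw [add_assoc, pow_add, mul_comm, inv_mul_cancel_left₀ hh, hs, squareWave_eq_one_iff hH,
      Nat.add_mul_mod_self_left, Nat.mod_eq_of_lt (by omega)]
    exact hj
  · intro hx
    have hx0 : x * (ω ^ h)⁻¹ ≠ 0 := by
      intro h0
      rw [h0, hs0] at hx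
      omega
    obtain ⟨n, hn⟩ := hω _ hx0
    rw [hn, hs, squareWave_eq_one_iff hH] at hx
    refine ⟨n % (2 * H), hx, n / (2 * H), ?_⟩
    rw [add_assoc, Nat.mod_add_div, pow_add, ← hn, mul_comm, inv_mul_cancel_right₀ hh]

/-- The Fourier transform of the square wave of the discrete logarithm changes sign under a
shift by the half-period. -/
theorem sum_squareWave_addChar_add_half {K : Type} [Field K] [Fintype K] {ω : K}
    (hω0 : ω ≠ 0) (hω : ∀ x : K, x ≠ 0 → ∃ n : ℕ, x = ω ^ n) {H : ℕ} (hH : 0 < H) {s : K → ℤ}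
    (hs0 : s 0 = 0) (hs : ∀ n, s (ω ^ n) = squareWave H n) (ψ : AddChar K ℂ) (n : ℕ) :
    ∑ x, (s x : ℂ) * ψ (ω ^ (n + H) * x) = -∑ x, (s x : ℂ) * ψ (ω ^ n * x) := by
  have hneg : ∀ x, s (ω ^ H * x) = -s x := by
    intro x
    by_cases hx : x = 0
    · simp [hx, hs0]
    · obtain ⟨m, rfl⟩ := hω x hx
      have := squareWave_add_mul hH m 1
      rw [mul_one] at this
      rw [mul_comm, ← pow_add, hs, hs, this]
      ring
  rw [← (mulLeft_bijective₀ (ω ^ H) (pow_ne_zero H hω0)).sum_comp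
    (fun x => (s x : ℂ) * ψ (ω ^ n * x)), ← Finset.sum_neg_distrib]
  refine Finset.sum_congr rfl fun x _ => ?_
  rw [hneg, pow_add, mul_assoc]
  push_cast
  ring

/-- The Fourier transform of the square wave of the discrete logarithm is unchanged by a unit
shift at any exponent that some Frobenius power moves by an odd multiple of the half-period. -/
theorem sum_squareWave_addChar_succ {K : Type} [Field K] [Fintype K] {ω : K}
    (hω0 : ω ≠ 0) (hω : ∀ x : K, x ≠ 0 → ∃ n : ℕ, x = ω ^ n) {e : ℕ} {s : K → ℤ}
    (hs0 : s 0 = 0) (hs : ∀ n, s (ω ^ n) = squareWave (2 ^ e) n) {ψ : AddChar K ℂ} {n r c : ℕ}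
    (hinj : Function.Injective fun x : K => x ^ (2 * r + 1))
    (hψ : ∀ x, ψ (x ^ (2 * r + 1)) = ψ x) (hn : n * (2 * r) = 2 ^ e * (2 * c + 1)) :
    ∑ x, (s x : ℂ) * ψ (ω ^ (n + 1) * x) = ∑ x, (s x : ℂ) * ψ (ω ^ n * x) := by
  have hH : 0 < 2 ^ e := by positivity
  have hwave : ∀ m, squareWave (2 ^ e) (2 ^ e * (2 * c + 1) + (m + 1) * (2 * r) + m)
      - squareWave (2 ^ e) (2 ^ e * (2 * c + 1) + (m + 1) * (2 * r) + m + 1)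
      = -(squareWave (2 ^ e) m - squareWave (2 ^ e) (m + 1)) := by
    intro m
    by_cases hm : 2 ^ e ∣ m + 1
    · obtain ⟨k, hk⟩ := hm
      have hshift : ∀ a, squareWave (2 ^ e) (2 ^ e * (2 * c + 1) + (m + 1) * (2 * r) + a)
          = -squareWave (2 ^ e) a := by
        intro a
        rw [hk, show 2 ^ e * (2 * c + 1) + 2 ^ e * k * (2 * r) + a
          = a + 2 ^ e * (2 * (c + k * r) + 1) by ring, squareWave_add_mul hH,
          Odd.neg_one_pow ⟨_, rfl⟩, neg_one_mul]
      rw [add_assoc _ m 1, hshift, hshift]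
      ring
    · rw [squareWave_succ hm, squareWave_succ]
      · ring
      · rw [show 2 ^ e * (2 * c + 1) + (m + 1) * (2 * r) + m + 1
          = 2 ^ e * (2 * c + 1) + (m + 1) * (2 * r + 1) by ring,
          Nat.dvd_add_right (dvd_mul_right _ _)]
        intro h
        refine hm (Nat.Coprime.dvd_of_dvd_mul_right ?_ h)
        exact Nat.Coprime.pow_left e (Nat.coprime_two_left.2 ⟨r, rfl⟩)
  have hzero : ∑ y, ((s (ω⁻¹ * y) : ℂ) - s y) * ψ (ω ^ n * y) = 0 := by
    refine sum_mul_addChar_eq_zero_s1 (d := fun y => (s (ω⁻¹ * y) : ℂ) - s y)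
      (pow_ne_zero n hω0) hinj hψ fun y => ?_
    by_cases hy : y = 0
    · simp [hy, hs0]
    · obtain ⟨m, hm⟩ := hω (ω⁻¹ * y) (mul_ne_zero (inv_ne_zero hω0) hy)
      obtain rfl : y = ω ^ (m + 1) := by rw [pow_succ', ← hm, mul_inv_cancel_left₀ hω0]
      have hz : (ω ^ n) ^ (2 * r) * (ω ^ (m + 1)) ^ (2 * r + 1)
          = ω ^ (2 ^ e * (2 * c + 1) + (m + 1) * (2 * r) + m + 1) := by
        rw [← hn]
        ring
      have hinv : ∀ k, ω⁻¹ * ω ^ (k + 1) = ω ^ k := fun k => by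
        rw [pow_succ', inv_mul_cancel_left₀ hω0]
      rw [hz, hinv, hinv, hs, hs, hs, hs]
      exact_mod_cast hwave m
  simp_rw [sub_mul, Finset.sum_sub_distrib] at hzero
  rw [← sub_eq_zero.1 hzero, ← (mulLeft_bijective₀ ω hω0).sum_comp
    (fun y => (s (ω⁻¹ * y) : ℂ) * ψ (ω ^ n * y))]
  refine Finset.sum_congr rfl fun x _ => ?_
  rw [inv_mul_cancel_left₀ hω0, pow_succ, mul_assoc]

/-- A prime power whose power is the cardinality of a finite field is a power of the
characteristic. -/
theorem exists_eq_ringChar_pow {K : Type} [Field K] [Fintype K] {q m : ℕ} (hq : IsPrimePow q)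
    (hm : m ≠ 0) (hK : Fintype.card K = q ^ m) : ∃ k, q = ringChar K ^ k := by
  obtain ⟨p, k, hp, hk, rfl⟩ := hq
  refine ⟨k, ?_⟩
  obtain ⟨n, hchar, hn⟩ := FiniteField.card K (ringChar K)
  have : p ∣ ringChar K := by
    refine hp.nat_prime.dvd_of_dvd_pow (n := n) ?_
    rw [← hn, hK]
    exact dvd_pow (dvd_pow_self p hk.ne') hm
  rw [(Nat.prime_dvd_prime_iff_eq hp.nat_prime hchar).1 this]

/-- Let `u ≥ 2`, let `q` be a prime power with `q ≡ 2^u + 1 (mod 2^(u+1))`,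
`t ≥ u + 1`, `N = 2^t` and `f = 2^(t-u)`.  With `ω` a primitive element of
`F_{q^f}` and `D_h = ∪_{j=0}^{N/2-1} C_{h+j}^{(N, q^f)}`, the family
`{D_{2^(t-u) ℓ} : ℓ = 0, …, 2^(u-1)-1}` is a skew Hadamard difference family
in `(F_{q^f}, +)`. -/
theorem lifted_cyclotomic_blocks_skew_hadamard_df
    (u : ℕ) (hu : 2 ≤ u) (q : ℕ) (hq : IsPrimePow q)
    (hmod : q % 2 ^ (u + 1) = 2 ^ u + 1)
    (t : ℕ) (ht : u + 1 ≤ t)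
    (K : Type) [Field K] [Fintype K] (hK : Fintype.card K = q ^ (2 ^ (t - u)))
    (ω : K) (hω : ∀ x : K, x ≠ 0 → ∃ n : ℕ, x = ω ^ n)
    (D : ℕ → Finset K)
    (hD : ∀ h, D h = (Finset.range (2 ^ t / 2)).biUnion
            (fun j => cycClass ω (2 ^ t) (h + j))) :
    ∃ k lam : ℕ,
      IsDiffFamily (fun ℓ : Fin (2 ^ (u - 1)) => D (2 ^ (t - u) * ℓ)) k lam ∧
      ∀ ℓ : Fin (2 ^ (u - 1)), IsSkewSet (D (2 ^ (t - u) * ℓ)) := by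
  have hH : 0 < 2 ^ (t - 1) := by positivity
  have h2H : 2 ^ t = 2 * 2 ^ (t - 1) := by rw [← pow_succ']; congr 1; omega
  have hML : 2 ^ (t - u) * 2 ^ (u - 1) = 2 ^ (t - 1) := by rw [← pow_add]; congr 1; omega
  obtain ⟨c, hc⟩ := pow_two_pow_eq_odd_mul_add_one hu hmod (t - u)
  rw [← hK, show u + (t - u) = t by omega, h2H] at hc
  have hω0 : ω ≠ 0 := by
    rintro rfl
    have hle : Fintype.card K ≤ 2 := by
      rw [← Finset.card_univ]
      refine (Finset.card_le_card (t := {0, 1}) fun x _ => ?_).trans Finset.card_le_two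
      by_cases hx : x = 0
      · simp [hx]
      · obtain ⟨n, rfl⟩ := hω x hx
        rcases n with _ | n
        · simp
        · simp at hx
    have : 0 < 2 ^ (t - 1) * (2 * c + 1) := by positivity
    rw [hc, mul_assoc] at hle
    omega
  obtain ⟨s, hs, hsω⟩ := exists_sign_eq_squareWave hω0 hω hH hc
  have hD' : ∀ h x, x ∈ D h ↔ s (x * (ω ^ h)⁻¹) = 1 := by
    intro h x
    rw [hD, show 2 ^ t / 2 = 2 ^ (t - 1) by omega, h2H]
    exact mem_biUnion_cycClass_iff hω0 hω hH hs.map_zero hsω h x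
  have hsign : ∀ h, IsSignFun fun x => s (x * (ω ^ h)⁻¹) := fun h =>
    ⟨by simp [hs.map_zero], fun x => by rw [neg_mul, hs.map_neg],
      fun x hx => hs.eq_or _ (mul_ne_zero hx (inv_ne_zero (pow_ne_zero h hω0)))⟩
  obtain ⟨ψ, hψ, hfrob⟩ := exists_primitive_addChar_frobenius_invariant K
  obtain ⟨k, hk⟩ := exists_eq_ringChar_pow hq (by positivity) hK
  have : Fact (ringChar K).Prime := ⟨CharP.char_is_prime K _⟩
  have hfrob' : ∀ i x, ψ (x ^ ringChar K ^ i) = ψ x := by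
    intro i x
    induction i with
    | zero => simp
    | succ i ih => rw [pow_succ, pow_mul, hfrob, ih]
  set F : K → ℂ := fun b => ∑ x, (s x : ℂ) * ψ (b * x) with hF
  have hstep : ∀ n, ¬ 2 ^ (t - u) ∣ n → F (ω ^ (n + 1)) ^ 2 = F (ω ^ n) ^ 2 := by
    intro n hn
    obtain ⟨i, r, d, hr, hd⟩ := exists_pow_sub_one_mul_eq_odd_mul hu hmod ht hn
    rw [hk, ← pow_mul] at hr
    congr 1
    refine sum_squareWave_addChar_succ hω0 hω hs.map_zero hsω ?_ ?_ hd
    · rw [← hr]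
      exact iterateFrobenius_inj K (ringChar K) _
    · rw [← hr]
      exact hfrob' _
  have hper : ∀ n, F (ω ^ (n + 2 ^ (t - u) * 2 ^ (u - 1))) ^ 2 = F (ω ^ n) ^ 2 := by
    intro n
    rw [hML, hF]
    simp only
    rw [sum_squareWave_addChar_add_half hω0 hω hH hs.map_zero hsω, neg_sq]
  have hconst := sum_progression_const (P := fun n => F (ω ^ n) ^ 2) (by positivity) hstep hper
  have htransform : ∀ h b, ∑ x, (s (x * (ω ^ h)⁻¹) : ℂ) * ψ (b * x) = F (b * ω ^ h) := by
    intro h b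
    rw [hF, ← (mulRight_bijective₀ (ω ^ h) (pow_ne_zero h hω0)).sum_comp]
    refine Finset.sum_congr rfl fun x _ => ?_
    rw [mul_inv_cancel_right₀ (pow_ne_zero h hω0), mul_assoc, mul_comm x]
  have hconv := fun g (hg : g ≠ 0) => card_mul_sum_convolution_eq hψ
    (fun (ℓ : Fin (2 ^ (u - 1))) x => (s (x * (ω ^ (2 ^ (t - u) * (ℓ : ℕ)))⁻¹) : ℂ))
    (∑ ℓ ∈ range (2 ^ (u - 1)), F (ω ^ (0 + 2 ^ (t - u) * ℓ)) ^ 2)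
    (by
      refine Finset.sum_eq_zero fun ℓ _ => ?_
      rw [sq_eq_zero_iff]
      exact_mod_cast (hsign _).sum_eq_zero)
    (fun b hb => by
      obtain ⟨n, rfl⟩ := hω b hb
      simp_rw [htransform, ← pow_add]
      rw [Fin.sum_univ_eq_sum_range (fun ℓ => F (ω ^ (n + 2 ^ (t - u) * ℓ)) ^ 2)]
      exact hconst n) hg
  have hQ : (Fintype.card K : ℂ) ≠ 0 := Nat.cast_ne_zero.2 Fintype.card_ne_zero
  refine ⟨(D 0).card, ∑ ℓ : Fin (2 ^ (u - 1)),
    ((D (2 ^ (t - u) * ℓ) ×ˢ D (2 ^ (t - u) * ℓ)).filter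
      (fun p => p.1 ≠ p.2 ∧ p.1 - p.2 = 1)).card, ⟨fun ℓ => ?_, fun g hg => ?_⟩,
    fun ℓ => (hsign _).isSkewSet (hD' _)⟩
  · have h1 := (hsign _).two_mul_card (hD' (2 ^ (t - u) * ℓ))
    have h2 := (hsign _).two_mul_card (hD' 0)
    dsimp only
    omega
  · have heq := mul_left_cancel₀ hQ ((hconv g hg).trans (hconv 1 one_ne_zero).symm)
    have heq' : ∑ ℓ : Fin (2 ^ (u - 1)), ∑ x, s (x * (ω ^ (2 ^ (t - u) * (ℓ : ℕ)))⁻¹)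
          * s ((g - x) * (ω ^ (2 ^ (t - u) * (ℓ : ℕ)))⁻¹)
        = ∑ ℓ : Fin (2 ^ (u - 1)), ∑ x, s (x * (ω ^ (2 ^ (t - u) * (ℓ : ℕ)))⁻¹)
          * s ((1 - x) * (ω ^ (2 ^ (t - u) * (ℓ : ℕ)))⁻¹) := by
      exact_mod_cast heq
    have hcount : ∀ g : K, g ≠ 0 → (4 : ℤ) * ((∑ ℓ : Fin (2 ^ (u - 1)),
        ((D (2 ^ (t - u) * ℓ) ×ˢ D (2 ^ (t - u) * ℓ)).filter
          (fun p => p.1 ≠ p.2 ∧ p.1 - p.2 = g)).card : ℕ) : ℤ)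
        = ∑ ℓ : Fin (2 ^ (u - 1)), ((Fintype.card K : ℤ) - 2)
          - ∑ ℓ : Fin (2 ^ (u - 1)), ∑ x, s (x * (ω ^ (2 ^ (t - u) * (ℓ : ℕ)))⁻¹)
            * s ((g - x) * (ω ^ (2 ^ (t - u) * (ℓ : ℕ)))⁻¹) := by
      intro g hg
      rw [Nat.cast_sum, Finset.mul_sum, ← Finset.sum_sub_distrib]
      exact Finset.sum_congr rfl fun ℓ _ => (hsign _).four_mul_card_differences (hD' _) hg
    have h1 := hcount g hg
    have h2 := hcount 1 one_ne_zero
    rw [heq', ← h2] at h1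
    exact_mod_cast mul_left_cancel₀ four_ne_zero h1
end

section
/- Let u ≥ 2 be an integer and q a prime power with q ≡ 2^u + 1 (mod 2^{u+1}). Let γ be a primitive element of F_q and for h = 0,1,…,2^u−1 set B_h = ∪_{j=0}^{2^{u−1}−1} C_{h+j}^{(2^u,q)} (indices mod 2^u). Then the family {B_0, B_1, …, B_{2^{u−1}−1}} is a skew Hadamard difference family in (F_q,+). -/
open Finset
open scoped Classical

/-- Ordered pairs of `B` with difference `g`. -/
noncomputable def diffPairs {G : Type} [AddCommGroup G] (B : Finset G) (g : G) : Finset (G × G) :=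
  (B ×ˢ B).filter (fun p => p.1 ≠ p.2 ∧ p.1 - p.2 = g)

theorem card_diffPairs_of_mul {F : Type} [Field F] {γ : F} (hγ : γ ≠ 0) {B C : Finset F}
    (h : ∀ x, γ * x ∈ C ↔ x ∈ B) (g : F) :
    (diffPairs C (γ * g)).card = (diffPairs B g).card := by
  symm
  refine Finset.card_bij (fun p _ => (γ * p.1, γ * p.2)) ?_ ?_ ?_
  · rintro ⟨x, y⟩ hp
    simp only [diffPairs, mem_filter, mem_product] at hp ⊢
    refine ⟨⟨(h x).2 hp.1.1, (h y).2 hp.1.2⟩, fun e => hp.2.1 (mul_left_cancel₀ hγ e), ?_⟩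
    rw [← mul_sub, hp.2.2]
  · rintro ⟨x, y⟩ _ ⟨x', y'⟩ _ e
    simp only [Prod.mk.injEq] at e ⊢
    exact ⟨mul_left_cancel₀ hγ e.1, mul_left_cancel₀ hγ e.2⟩
  · rintro ⟨x, y⟩ hp
    simp only [diffPairs, mem_filter, mem_product] at hp
    obtain ⟨x, rfl⟩ : ∃ z, x = γ * z := ⟨γ⁻¹ * x, by field_simp⟩
    obtain ⟨y, rfl⟩ : ∃ z, y = γ * z := ⟨γ⁻¹ * y, by field_simp⟩
    refine ⟨(x, y), ?_, rfl⟩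
    simp only [diffPairs, mem_filter, mem_product]
    refine ⟨⟨(h x).1 hp.1.1, (h y).1 hp.1.2⟩, fun e => hp.2.1 (congrArg _ e), ?_⟩
    apply mul_left_cancel₀ hγ
    rw [mul_sub, hp.2.2]

theorem card_diffPairs_of_neg {G : Type} [AddCommGroup G] {B C : Finset G}
    (h : ∀ x, x ∈ C ↔ -x ∈ B) (g : G) :
    (diffPairs C g).card = (diffPairs B g).card := by
  refine Finset.card_bij (fun p _ => (-p.2, -p.1)) ?_ ?_ ?_
  · rintro ⟨x, y⟩ hp
    simp only [diffPairs, mem_filter, mem_product] at hp ⊢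
    refine ⟨⟨(h y).1 hp.1.2, (h x).1 hp.1.1⟩, fun e => hp.2.1 (neg_injective e).symm, ?_⟩
    rw [← hp.2.2]
    abel
  · rintro ⟨x, y⟩ _ ⟨x', y'⟩ _ e
    simp only [Prod.mk.injEq, neg_inj] at e ⊢
    exact ⟨e.2, e.1⟩
  · rintro ⟨x, y⟩ hp
    simp only [diffPairs, mem_filter, mem_product] at hp
    refine ⟨(-y, -x), ?_, by simp⟩
    simp only [diffPairs, mem_filter, mem_product]
    refine ⟨⟨(h _).2 (by simpa using hp.1.2), (h _).2 (by simpa using hp.1.1)⟩,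
      fun e => hp.2.1 (neg_injective e).symm, ?_⟩
    rw [← hp.2.2]
    abel

/-- If multiplication by `γ` maps `B h` onto `B (h + 1)` and `B (h + M) = -B h`, then the number
of representations of `g` as a difference in `B 0, …, B (M - 1)` is unchanged under `g ↦ γ g`. -/
theorem sum_card_diffPairs_mul {F : Type} [Field F] {γ : F} (hγ : γ ≠ 0) {B : ℕ → Finset F}
    {M : ℕ} (hshift : ∀ h x, γ * x ∈ B (h + 1) ↔ x ∈ B h)
    (hneg : ∀ h x, x ∈ B (h + M) ↔ -x ∈ B h) (g : F) :
    ∑ i ∈ range M, (diffPairs (B i) (γ * g)).card = ∑ i ∈ range M, (diffPairs (B i) g).card := by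
  have hM : (diffPairs (B M) (γ * g)).card = (diffPairs (B 0) (γ * g)).card :=
    card_diffPairs_of_neg (by simpa using hneg 0) _
  have hsum := (sum_range_succ (fun i => (diffPairs (B i) (γ * g)).card) M).symm.trans
    (sum_range_succ' _ M)
  simp only [card_diffPairs_of_mul hγ (hshift _), hM] at hsum
  exact Nat.add_right_cancel hsum

theorem orderOf_of_forall_eq_pow {F : Type} [Field F] [Fintype F] {γ : F} (h0 : γ ≠ 0)
    (hγ : ∀ x : F, x ≠ 0 → ∃ n : ℕ, x = γ ^ n) : orderOf γ = Fintype.card F - 1 := by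
  have h : ∀ x : Fˣ, x ∈ Subgroup.zpowers (Units.mk0 γ h0) := by
    intro x
    obtain ⟨n, hn⟩ := hγ x x.ne_zero
    exact ⟨n, Units.ext (by simp [hn])⟩
  have := orderOf_eq_card_of_forall_mem_zpowers h
  rw [← orderOf_units, Units.val_mk0, Nat.card_eq_fintype_card, Fintype.card_units] at this
  exact this

theorem neg_one_eq_pow_of_orderOf {F : Type} [Field F] {γ : F} {m : ℕ} (hm : m ≠ 0)
    (h : orderOf γ = 2 * m) : -1 = γ ^ m := by
  have hsq : γ ^ m * γ ^ m = 1 := by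
    rw [← pow_add, ← two_mul, ← h, pow_orderOf_eq_one]
  rcases mul_self_eq_one_iff.1 hsq with h1 | h1
  · have := Nat.le_of_dvd (Nat.pos_of_ne_zero hm) (h ▸ orderOf_dvd_of_pow_eq_one h1)
    omega
  · exact h1.symm

/-- Let `u ≥ 2` and let `q` be a prime power with `q ≡ 2^u + 1 (mod 2^(u+1))`.
With `γ` a primitive element of `F_q` and
`B_h = ∪_{j=0}^{2^(u-1)-1} C_{h+j}^{(2^u, q)}`, the family
`{B_0, …, B_{2^(u-1)-1}}` is a skew Hadamard difference family in `(F_q, +)`. -/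
theorem cyclotomic_blocks_skew_hadamard_df
    (u : ℕ) (hu : 2 ≤ u) (q : ℕ) (hq : IsPrimePow q)
    (hmod : q % 2 ^ (u + 1) = 2 ^ u + 1)
    (F : Type) [Field F] [Fintype F] (hF : Fintype.card F = q)
    (γ : F) (hγ : ∀ x : F, x ≠ 0 → ∃ n : ℕ, x = γ ^ n)
    (B : ℕ → Finset F)
    (hB : ∀ h, B h = (Finset.range (2 ^ (u - 1))).biUnion
            (fun j => cycClass γ (2 ^ u) (h + j))) :
    ∃ k lam : ℕ,
      IsDiffFamily (fun i : Fin (2 ^ (u - 1)) => B i) k lam ∧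
      ∀ i : Fin (2 ^ (u - 1)), IsSkewSet (B i) := by
  obtain ⟨M, hM⟩ : ∃ M, M = 2 ^ (u - 1) := ⟨_, rfl⟩
  have hM0 : 0 < M := hM ▸ by positivity
  have hN : 2 ^ u = 2 * M := by
    rw [hM, ← pow_succ']
    congr 1
    omega
  obtain ⟨s, hs⟩ : ∃ s, q - 1 = 2 * (M + 2 * M * s) := by
    refine ⟨q / 2 ^ (u + 1), ?_⟩
    have hdiv := Nat.mod_add_div q (2 ^ (u + 1))
    rw [hmod, pow_succ, hN] at hdiv
    rw [pow_succ, hN]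
    conv_lhs => rw [← hdiv]
    rw [Nat.add_right_comm, Nat.add_sub_cancel]
    ring
  have h0 : γ ≠ 0 := by
    rintro rfl
    have hsub : (univ : Finset F) ⊆ {0, 1} := by
      intro x _
      by_cases hx : x = 0
      · simp [hx]
      · obtain ⟨n, rfl⟩ := hγ x hx
        rcases n with - | n <;> simp
    have hcard := (card_le_card hsub).trans card_le_two
    rw [card_univ, hF] at hcard
    omega
  have hord : orderOf γ = 2 * (M + 2 * M * s) := by
    rw [orderOf_of_forall_eq_pow h0 hγ, hF, hs]
  have hneg1 : -1 = γ ^ (M + 2 * M * s) := neg_one_eq_pow_of_orderOf (by omega) hord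
  have hmem : ∀ h x, x ∈ B h ↔ ∃ j < M, ∃ i, x = γ ^ (h + j + 2 * M * i) := by
    intro h x
    simp [hB, cycClass, hN, ← hM]
  have hshift : ∀ h x, γ * x ∈ B (h + 1) ↔ x ∈ B h := by
    intro h x
    simp only [hmem]
    refine exists_congr fun j => and_congr_right fun _ => exists_congr fun i => ?_
    rw [show h + 1 + j + 2 * M * i = (h + j + 2 * M * i) + 1 by ring, pow_succ',
      mul_right_inj' h0]
  have hneg : ∀ h x, x ∈ B (h + M) ↔ -x ∈ B h := by
    intro h x
    simp only [hmem]
    constructor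
    · rintro ⟨j, hj, i, rfl⟩
      refine ⟨j, hj, i + s + 1, ?_⟩
      rw [← neg_one_mul, hneg1, ← pow_add]
      congr 1
      ring
    · rintro ⟨j, hj, i, hx⟩
      refine ⟨j, hj, i + s, ?_⟩
      rw [← neg_neg x, hx, ← neg_one_mul, hneg1, ← pow_add]
      congr 1
      ring
  have hdisj : ∀ h x, x ∈ B h → -x ∉ B h := by
    intro h x hx hx'
    rw [← hneg] at hx'
    obtain ⟨j, hj, i, rfl⟩ := (hmem _ _).1 hx
    obtain ⟨j', hj', i', e⟩ := (hmem _ _).1 hx'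
    have e1 : h + j + 2 * M * i ≡ h + M + j' + 2 * M * i' [MOD orderOf γ] :=
      by
      rw [← Units.val_mk0 h0, orderOf_units]
      exact pow_eq_pow_iff_modEq.1 (Units.ext (by simpa using e))
    have e2 : h + j + 2 * M * i ≡ h + (M + j') + 2 * M * i' [MOD 2 * M] := by
      rw [← add_assoc]
      exact e1.of_dvd ⟨1 + 2 * s, by rw [hord]; ring⟩
    have e3 : j ≡ M + j' [MOD 2 * M] := by
      have : h + j ≡ h + (M + j') [MOD 2 * M] := by
        simpa [Nat.ModEq, Nat.add_mul_mod_self_left] using e2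
      exact this.add_left_cancel'
    have := Nat.ModEq.eq_of_lt_of_lt e3 (by omega) (by omega)
    omega
  have hcover : ∀ h x, x ≠ 0 → x ∈ B h ∨ -x ∈ B h := by
    intro h x hx
    obtain ⟨n, rfl⟩ := hγ x hx
    obtain ⟨d, hd⟩ : ∃ d, n + orderOf γ * h = h + d :=
      Nat.exists_eq_add_of_le (le_add_left (Nat.le_mul_of_pos_left _ (by omega)))
    have hpow : γ ^ n = γ ^ (h + d) := by
      rw [← hd, pow_add, pow_mul, pow_orderOf_eq_one, one_pow, mul_one]
    have hdm := Nat.mod_add_div d (2 * M)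
    have hlt := Nat.mod_lt d (show 0 < 2 * M by omega)
    rw [← hneg, hmem, hmem, hpow]
    rcases lt_or_ge (d % (2 * M)) M with hr | hr
    · exact Or.inl ⟨d % (2 * M), hr, d / (2 * M), by congr 1; omega⟩
    · exact Or.inr ⟨d % (2 * M) - M, by omega, d / (2 * M), by congr 1; omega⟩
  have hzero : ∀ h, (0 : F) ∉ B h := by
    intro h hx
    exact hdisj h 0 hx (by simpa using hx)
  have hcard : ∀ h, (B h).card = (B 0).card := by
    intro h
    induction h with
    | zero => rfl
    | succ h ih =>
      rw [← ih]
      symm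
      refine card_bij (fun x _ => γ * x) (fun x hx => (hshift h x).2 hx)
        (fun x _ y _ e => mul_left_cancel₀ h0 e) fun y hy => ?_
      refine ⟨γ⁻¹ * y, (hshift h _).1 ?_, ?_⟩ <;> rw [mul_inv_cancel_left₀ h0]
      exact hy
  refine ⟨(B 0).card, ∑ i ∈ range M, (diffPairs (B i) 1).card, ⟨fun i => hcard i, ?_⟩, ?_⟩
  · intro g hg
    obtain ⟨n, rfl⟩ := hγ g hg
    refine (Fin.sum_univ_eq_sum_range (fun i => (diffPairs (B i) (γ ^ n)).card) _).trans ?_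
    rw [← hM]
    clear hg
    induction n with
    | zero => rw [pow_zero]
    | succ n ih => rw [pow_succ', sum_card_diffPairs_mul h0 hshift hneg, ih]
  · intro i
    have himg : ∀ x, x ∈ (B i).image (fun x => -x) ↔ -x ∈ B i := by
      intro x
      simp [neg_eq_iff_eq_neg]
    constructor
    · ext x
      simp only [mem_inter, himg, notMem_empty, iff_false, not_and]
      exact hdisj i x
    · ext x
      simp only [mem_union, himg, mem_sdiff, mem_univ, true_and, mem_singleton]
      refine ⟨?_, hcover i x⟩
      rintro hx rfl
      exact hzero i (by simpa using hx)
end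

section
/- Let u ≥ 2 be an integer, q a prime power with q ≡ 2^u + 1 (mod 2^{u+1}), t ≥ u+1 an integer, N = 2^t and f = 2^{t−u}. Let ω be a primitive element of F_{q^f}, put γ = ω^{(q^f−1)/(q−1)}, let χ_N be a multiplicative character of F_{q^f} of order N, let χ' be the multiplicative character of F_q of order 2^u such that χ_N^{2^{t−u}} is the lift of χ' (i.e., χ_N^{2^{t−u}}(x) = χ'(x^{(q^f−1)/(q−1)}) for all x ∈ F_{q^f}^*), and let η' be the quadratic character of F_q. Then there exists an integer b with 0 ≤ b ≤ 2^u−1 such that G_{q^f}(χ_N) = χ'(γ)^{−b} · q^{f/2−1} · G_q(χ') · G_q(η'); in particular G_{q^f}(χ_N) = ε q^{f/2−1} G_q(χ') G_q(η') for some complex 2^u-th root of unity ε. -/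
open Finset
open scoped Classical

/-- The canonical additive character `ψ(x) = ζ_p^(Tr_{Q/p}(x))` of a finite
field, where `p` is the characteristic. -/
noncomputable def psiF (F : Type) [Field F] [Fintype F] : F → ℂ :=
  letI := ZMod.algebra F (ringChar F)
  fun x => Complex.exp (2 * Real.pi * Complex.I *
    ((Algebra.trace (ZMod (ringChar F)) F x).val : ℂ) / (ringChar F : ℂ))

/-- The Gauss sum `G_Q(χ) = ∑_{x ∈ F_Q^*} χ(x) ψ(x)` with respect to the
canonical additive character. -/
noncomputable def gaussF {F : Type} [Field F] [Fintype F] (χ : MulChar F ℂ) : ℂ :=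
  ∑ x ∈ (Finset.univ \ {0} : Finset F), χ x * psiF F x


/-- The canonical additive character of a finite field, bundled as an `AddChar`. -/
noncomputable def psiAddChar (F : Type) [Field F] [Fintype F] : AddChar F ℂ :=
  haveI : Fact (ringChar F).Prime := ⟨CharP.char_is_prime F _⟩
  letI := ZMod.algebra F (ringChar F)
  (ZMod.stdAddChar (N := ringChar F)).compAddMonoidHom
    (Algebra.trace (ZMod (ringChar F)) F).toAddMonoidHom

lemma psiAddChar_apply {F : Type} [Field F] [Fintype F] (x : F) :
    psiAddChar F x = psiF F x := by
  have : Fact (ringChar F).Prime := ⟨CharP.char_is_prime F _⟩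
  let := ZMod.algebra F (ringChar F)
  change ZMod.stdAddChar (Algebra.trace (ZMod (ringChar F)) F x) = _
  rw [ZMod.stdAddChar_apply, ZMod.toCircle_apply]
  rfl

lemma psiAddChar_eq_stdAddChar_trace {F : Type} [Field F] [Fintype F] (p : ℕ) [Fact p.Prime]
    [inst : Algebra (ZMod p) F] (x : F) :
    psiAddChar F x = ZMod.stdAddChar (Algebra.trace (ZMod p) F x) := by
  have : CharP F p := (Algebra.charP_iff (ZMod p) F p).mp inferInstance
  obtain rfl : ringChar F = p := ringChar.eq F p ▸ rfl
  obtain rfl : inst = ZMod.algebra F (ringChar F) := Subsingleton.elim _ _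
  rfl

lemma psiAddChar_ne_one (F : Type) [Field F] [Fintype F] : psiAddChar F ≠ 1 := by
  have : Fact (ringChar F).Prime := ⟨CharP.char_is_prime F _⟩
  let := ZMod.algebra F (ringChar F)
  obtain ⟨b, hb⟩ := FiniteField.trace_to_zmod_nondegenerate F (one_ne_zero (α := F))
  intro h
  apply hb
  apply ZMod.injective_stdAddChar
  rw [← psiAddChar_eq_stdAddChar_trace, h, AddChar.map_zero_eq_one]
  rfl

lemma psiAddChar_isPrimitive (F : Type) [Field F] [Fintype F] : (psiAddChar F).IsPrimitive :=
  AddChar.IsPrimitive.of_ne_one (psiAddChar_ne_one F)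

lemma psiAddChar_trace {L K : Type} [Field L] [Fintype L] [Field K] [Fintype K] [Algebra L K]
    (z : K) : psiAddChar K z = psiAddChar L (Algebra.trace L K z) := by
  have : Fact (ringChar L).Prime := ⟨CharP.char_is_prime L _⟩
  let := ZMod.algebra L (ringChar L)
  have : CharP K (ringChar L) := charP_of_injective_algebraMap' L _
  let := ZMod.algebra K (ringChar L)
  have : IsScalarTower (ZMod (ringChar L)) L K :=
    .of_algebraMap_eq' (Subsingleton.elim _ _)
  rw [psiAddChar_eq_stdAddChar_trace (ringChar L), psiAddChar_eq_stdAddChar_trace (ringChar L),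
    Algebra.trace_trace]

lemma gaussF_eq_gaussSum {F : Type} [Field F] [Fintype F] (χ : MulChar F ℂ) :
    gaussF χ = gaussSum χ (psiAddChar F) := by
  rw [gaussF, gaussSum]
  simp_rw [psiAddChar_apply]
  apply Finset.sum_subset (Finset.subset_univ _)
  intro x _ hx
  have : x = 0 := by simpa using hx
  rw [this, MulChar.map_zero, zero_mul]

section QuadraticExtension

variable {L K : Type} [Field L] [Fintype L] [Field K] [Fintype K] [Algebra L K]

lemma finrank_eq_two_of_card (hcard : Fintype.card K = Fintype.card L ^ 2) :
    Module.finrank L K = 2 := by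
  rw [Module.card_eq_pow_finrank (K := L)] at hcard
  exact Nat.pow_right_injective Fintype.one_lt_card hcard

lemma algebraMap_trace_of_card_sq (hcard : Fintype.card K = Fintype.card L ^ 2) (z : K) :
    algebraMap L K (Algebra.trace L K z) = z + z ^ Fintype.card L := by
  rw [FiniteField.algebraMap_trace_eq_sum_pow, finrank_eq_two_of_card hcard]
  simp [Finset.sum_range_succ]

lemma algebraMap_norm_of_card_sq (hcard : Fintype.card K = Fintype.card L ^ 2) (z : K) :
    algebraMap L K (Algebra.norm L z) = z * z ^ Fintype.card L := by
  rw [FiniteField.algebraMap_norm_eq_prod_pow, finrank_eq_two_of_card hcard]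
  simp [Finset.prod_range_succ]

end QuadraticExtension

lemma sum_comp_sq {L : Type} [Field L] [Fintype L] (hL : ringChar L ≠ 2) (h : L → ℂ) :
    ∑ b, h (b ^ 2) = ∑ c, (1 + ((quadraticChar L c : ℤ) : ℂ)) * h c := by
  rw [← Finset.sum_fiberwise_of_maps_to (s := univ) (t := univ) (g := fun b : L => b ^ 2)
    (fun _ _ => mem_univ _)]
  refine Finset.sum_congr rfl fun c _ => ?_
  have hc := quadraticChar_card_sqrts hL c
  rw [Finset.sum_congr rfl (g := fun _ => h c)
    (fun b hb => by rw [(Finset.mem_filter.mp hb).2]), Finset.sum_const, nsmul_eq_mul]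
  congr 1
  rw [add_comm]
  exact_mod_cast (by rw [← hc, Set.toFinset_ofPred] :
    ((#{b : L | b ^ 2 = c} : ℕ) : ℤ) = quadraticChar L c + 1)

/-- Summing `h` over `b²` and over `δ b²` with `δ` a nonsquare covers everything twice. -/
lemma sum_comp_sq_add_sum_comp_mul_sq {L : Type} [Field L] [Fintype L] (hL : ringChar L ≠ 2)
    {δ : L} (hδ : ¬ IsSquare δ) (h : L → ℂ) :
    ∑ b, h (b ^ 2) + ∑ b, h (δ * b ^ 2) = 2 * ∑ c, h c := by
  have hδ0 : δ ≠ 0 := by rintro rfl; exact hδ (IsSquare.zero)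
  have hδq : quadraticChar L δ = -1 := quadraticChar_neg_one_iff_not_isSquare.mpr hδ
  have h2 : ∑ b, h (δ * b ^ 2) = ∑ c, (1 - ((quadraticChar L c : ℤ) : ℂ)) * h c := by
    rw [sum_comp_sq hL (fun c => h (δ * c)), ← Equiv.sum_comp (Equiv.mulLeft₀ δ hδ0)
      (fun c => (1 - ((quadraticChar L c : ℤ) : ℂ)) * h c)]
    refine Finset.sum_congr rfl fun c _ => ?_
    change _ = (1 - ((quadraticChar L (δ * c) : ℤ) : ℂ)) * h (δ * c)
    rw [map_mul, hδq]
    push_cast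
    ring
  rw [sum_comp_sq hL, h2, ← Finset.sum_add_distrib, Finset.mul_sum]
  exact Finset.sum_congr rfl fun c _ => by ring

lemma exists_sqrt_of_not_isSquare {L K : Type} [Field L] [Fintype L] [Field K] [Fintype K]
    [Algebra L K] (hcard : Fintype.card K = Fintype.card L ^ 2) (hL : ringChar L ≠ 2)
    {δ : L} (hδ : ¬ IsSquare δ) :
    ∃ s : K, s ^ 2 = algebraMap L K δ ∧ s ^ Fintype.card L = -s := by
  have hδ0 : δ ≠ 0 := by rintro rfl; exact hδ (IsSquare.zero)
  have hodd := Nat.two_mul_odd_div_two (FiniteField.odd_card_of_char_ne_two hL)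
  set Q := Fintype.card L with hQ
  have hQ1 : 1 < Q := Fintype.one_lt_card
  have hK : ringChar K ≠ 2 := by rwa [← Algebra.ringChar_eq L K]
  have hdiv : Fintype.card K / 2 = (Q - 1) * ((Q + 1) / 2) := by
    obtain ⟨m, hm⟩ : ∃ m, Q = 2 * m + 1 := ⟨Q / 2, by omega⟩
    rw [hcard, hm]
    have e1 : (2 * m + 1) ^ 2 / 2 = 2 * m * (m + 1) := by
      have : (2 * m + 1) ^ 2 = 2 * (2 * m * (m + 1)) + 1 := by ring
      omega
    rw [e1]
    have : (2 * m + 1 + 1) / 2 = m + 1 := by omega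
    rw [this]; simp
  have hsq : IsSquare (algebraMap L K δ) := by
    rw [FiniteField.isSquare_iff hK (by simpa using hδ0), ← map_pow, hdiv, pow_mul,
      FiniteField.pow_card_sub_one_eq_one δ hδ0]
    simp
  obtain ⟨s, hs⟩ := hsq
  rw [← pow_two] at hs
  refine ⟨s, hs.symm, ?_⟩
  have h1 : δ ^ (Q / 2) = -1 :=
    (FiniteField.pow_dichotomy hL hδ0).resolve_left
      (fun h => hδ ((FiniteField.isSquare_iff hL hδ0).mpr h))
  have : Q = 2 * (Q / 2) + 1 := by omega
  rw [this, pow_succ, pow_mul, ← hs, ← map_pow, h1]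
  simp

/-- The Hasse–Davenport lifting relation for quadratic extensions. -/
theorem gaussSum_norm_quadratic {L K : Type} [Field L] [Fintype L] [Field K] [Fintype K]
    [Algebra L K] (hcard : Fintype.card K = Fintype.card L ^ 2) (hL : ringChar L ≠ 2)
    {χ : MulChar L ℂ} (hχ : χ ≠ 1) (ψ : AddChar L ℂ) {χK : MulChar K ℂ} {ψK : AddChar K ℂ}
    (hχK : ∀ z, χK z = χ (Algebra.norm L z)) (hψK : ∀ z, ψK z = ψ (Algebra.trace L K z)) :
    gaussSum χK ψK = -(gaussSum χ ψ) ^ 2 := by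
  obtain ⟨δ, hδ⟩ := FiniteField.exists_nonsquare hL
  obtain ⟨s, hs, hsQ⟩ := exists_sqrt_of_not_isSquare (K := K) hcard hL hδ
  have h2 : (2 : L) ≠ 0 := Ring.two_ne_zero hL
  have hfrob (a b : L) : (algebraMap L K a + algebraMap L K b * s) ^ Fintype.card L =
      algebraMap L K a - algebraMap L K b * s := by
    have := map_add (FiniteField.frobeniusAlgHom L K) (algebraMap L K a) (algebraMap L K b * s)
    rw [map_mul] at this
    simp only [AlgHom.commutes] at this
    simp only [FiniteField.coe_frobeniusAlgHom] at this
    rw [this, hsQ]; ring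
  have hinj := (algebraMap L K).injective
  have htr (a b : L) : Algebra.trace L K (algebraMap L K a + algebraMap L K b * s) = a + a := by
    apply hinj
    rw [algebraMap_trace_of_card_sq hcard, hfrob, map_add]
    ring
  have hnorm (a b : L) : Algebra.norm L (algebraMap L K a + algebraMap L K b * s) =
      a ^ 2 - δ * b ^ 2 := by
    apply hinj
    rw [algebraMap_norm_of_card_sq hcard, hfrob, map_sub, map_mul, ← hs, map_pow, map_pow]
    ring
  have hbij : Function.Bijective
      (fun ab : L × L => algebraMap L K ab.1 + algebraMap L K ab.2 * s) := by
    rw [Fintype.bijective_iff_injective_and_card]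
    refine ⟨?_, by simp [hcard, pow_two]⟩
    rintro ⟨a, b⟩ ⟨a', b'⟩ h
    have h1 : a = a' := by
      have := htr a b
      have h' := htr a' b'
      simp only at h
      rw [h, h'] at this
      have h3 : (2 : L) * a' = 2 * a := by rw [two_mul, two_mul]; exact this
      exact (mul_left_cancel₀ h2 h3).symm
    subst h1
    have hs0 : s ≠ 0 := by
      rintro rfl
      apply hδ
      have : δ = 0 := hinj (by rw [← hs]; simp)
      exact this ▸ IsSquare.zero
    have : algebraMap L K b = algebraMap L K b' := mul_right_cancel₀ hs0 (add_left_cancel h)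
    rw [hinj this]
  have hbij2 : Function.Bijective (fun ab : L × L => (ab.1 + ab.2, ab.1 - ab.2)) := by
    rw [Fintype.bijective_iff_injective_and_card]
    refine ⟨?_, rfl⟩
    rintro ⟨a, b⟩ ⟨a', b'⟩ h
    simp only [Prod.mk.injEq] at h
    obtain ⟨h3, h4⟩ := h
    have ha : a = a' := mul_left_cancel₀ h2 (by linear_combination h3 + h4)
    subst ha
    rw [add_left_cancel h3]
  have e1 : gaussSum χK ψK = ∑ a, (∑ b, χ (a ^ 2 - δ * b ^ 2)) * ψ (a + a) := by
    rw [gaussSum, ← hbij.sum_comp, Fintype.sum_prod_type]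
    simp_rw [hχK, hψK, htr, hnorm, Finset.sum_mul]
  have e2 : gaussSum χ ψ ^ 2 = ∑ a, (∑ b, χ (a ^ 2 - b ^ 2)) * ψ (a + a) := by
    rw [pow_two, gaussSum, Finset.sum_mul_sum, ← Fintype.sum_prod_type', ← hbij2.sum_comp,
      Fintype.sum_prod_type]
    simp_rw [Finset.sum_mul]
    refine Finset.sum_congr rfl fun a _ => Finset.sum_congr rfl fun b _ => ?_
    rw [mul_mul_mul_comm, ← map_mul, ← AddChar.map_add_eq_mul]
    congr 2 <;> ring
  rw [eq_neg_iff_add_eq_zero, e1, e2, ← Finset.sum_add_distrib]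
  refine Finset.sum_eq_zero fun a _ => ?_
  rw [← add_mul, add_comm, sum_comp_sq_add_sum_comp_mul_sq hL hδ (fun c => χ (a ^ 2 - c)),
    show ∑ c, χ (a ^ 2 - c) = 0 from ((Equiv.subLeft (a ^ 2)).sum_comp χ).trans
      (MulChar.sum_eq_zero_of_ne_one hχ)]
  simp

lemma mulChar_eq_quadraticChar_of_orderOf {F : Type} [Field F] [Fintype F]
    {η : MulChar F ℂ} (hη : orderOf η = 2) (x : F) :
    η x = ((quadraticChar F x : ℤ) : ℂ) := by
  have hsq : ∀ y : F, y ≠ 0 → IsSquare y → η y = 1 := by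
    rintro y hy ⟨z, rfl⟩
    have hz : z ≠ 0 := by rintro rfl; simp at hy
    rw [map_mul, ← pow_two, ← MulChar.pow_apply' _ two_ne_zero, ← hη, pow_orderOf_eq_one,
      MulChar.one_apply (isUnit_iff_ne_zero.mpr hz)]
  have hne : η ≠ 1 := by rintro rfl; simp at hη
  obtain ⟨a, ha⟩ := MulChar.ne_one_iff.mp hne
  have ha0 : (a : F) ≠ 0 := a.ne_zero
  have hans : ¬ IsSquare (a : F) := fun h => ha (hsq _ ha0 h)
  have ha2 : η a ^ 2 = 1 := by
    rw [← map_pow]; exact hsq _ (pow_ne_zero _ ha0) (IsSquare.sq _)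
  have ham : η a = -1 := (mul_self_eq_one_iff.mp (by rw [← pow_two, ha2])).resolve_left ha
  rcases eq_or_ne x 0 with rfl | hx
  · rw [MulChar.map_zero, MulChar.map_zero, Int.cast_zero]
  by_cases hxs : IsSquare x
  · rw [hsq x hx hxs, (quadraticChar_one_iff_isSquare hx).mpr hxs]; simp
  · have hqx := quadraticChar_neg_one_iff_not_isSquare.mpr hxs
    have hqa := quadraticChar_neg_one_iff_not_isSquare.mpr hans
    have hax : IsSquare ((a : F) * x) := by
      rw [← quadraticChar_one_iff_isSquare (mul_ne_zero ha0 hx), map_mul, hqx, hqa]; norm_num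
    have := hsq _ (mul_ne_zero ha0 hx) hax
    rw [map_mul, ham] at this
    rw [hqx]
    push_cast
    linear_combination -this

/-- The Hasse–Davenport product relation for the prime `2`. -/
theorem gaussSum_mul_gaussSum_quadratic {F : Type} [Field F] [Fintype F]
    (hF : ringChar F ≠ 2) {χ η : MulChar F ℂ} (hη : orderOf η = 2) (hχ : χ ^ 2 ≠ 1)
    {ψ : AddChar F ℂ} (hψ : ψ.IsPrimitive) :
    χ 4 * (gaussSum χ ψ * gaussSum (χ * η) ψ) = gaussSum (χ ^ 2) ψ * gaussSum η ψ := by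
  have h2 : (2 : F) ≠ 0 := Ring.two_ne_zero hF
  have hχ1 : χ ≠ 1 := by rintro rfl; simp at hχ
  have hη2 : η ^ 2 = 1 := hη ▸ pow_orderOf_eq_one η
  have hχη : χ * η ≠ 1 := by
    intro h
    apply hχ
    have := congrArg (· ^ 2) h
    simpa [mul_pow, hη2] using this
  have hJ : χ 4 * jacobiSum χ χ = jacobiSum χ η := by
    have hbij : Function.Bijective (fun x : F => 2 * x - 1) := by
      rw [← Finite.injective_iff_bijective]
      intro x y h
      exact mul_left_cancel₀ h2 (sub_left_injective h)
    have e1 : χ 4 * jacobiSum χ χ = ∑ y, χ (1 - y ^ 2) := by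
      rw [jacobiSum, Finset.mul_sum, ← hbij.sum_comp (fun y => χ (1 - y ^ 2))]
      refine Finset.sum_congr rfl fun x _ => ?_
      rw [← map_mul, ← map_mul]
      congr 1; ring
    rw [e1, sum_comp_sq hF (fun c => χ (1 - c)), jacobiSum_comm, jacobiSum]
    simp_rw [add_mul, one_mul, Finset.sum_add_distrib, mulChar_eq_quadraticChar_of_orderOf hη]
    rw [show ∑ c, χ (1 - c) = 0 from ((Equiv.subLeft 1).sum_comp χ).trans
      (MulChar.sum_eq_zero_of_ne_one hχ1), zero_add]
  have hcard : (Fintype.card F : ℂ) ≠ 0 := by exact_mod_cast Fintype.card_ne_zero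
  have hG := gaussSum_ne_zero_of_nontrivial hcard hχ1 hψ
  have j1 := jacobiSum_mul_nontrivial (by rwa [← pow_two]) ψ (χ := χ) (φ := χ)
  have j2 := jacobiSum_mul_nontrivial hχη ψ
  rw [← pow_two] at j1
  apply mul_left_cancel₀ hG
  linear_combination (- χ 4 * gaussSum (χ * η) ψ) * j1 +
    gaussSum (χ * η) ψ * gaussSum (χ ^ 2) ψ * hJ + gaussSum (χ ^ 2) ψ * j2

lemma gaussSum_pow_card {L K : Type} [Field L] [Fintype L] [Field K] [Fintype K] [Algebra L K]
    (hcard : Fintype.card K = Fintype.card L ^ 2) (χ : MulChar K ℂ) :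
    gaussSum (χ ^ Fintype.card L) (psiAddChar K) = gaussSum χ (psiAddChar K) := by
  have hψ (z : K) : psiAddChar K z = psiAddChar K (z ^ Fintype.card L) := by
    have htr : Algebra.trace L K z = Algebra.trace L K (z ^ Fintype.card L) := by
      apply (algebraMap L K).injective
      rw [algebraMap_trace_of_card_sq hcard, algebraMap_trace_of_card_sq hcard, ← pow_mul,
        ← pow_two, ← hcard, FiniteField.pow_card, add_comm]
    rw [psiAddChar_trace (L := L) z, psiAddChar_trace (L := L) (z ^ Fintype.card L), htr]
  have hbij : Function.Bijective (fun z : K => z ^ Fintype.card L) :=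
    (FiniteField.frobeniusAlgEquivOfAlgebraic L K).bijective
  rw [gaussSum, gaussSum, ← hbij.sum_comp (fun z => χ z * psiAddChar K z)]
  refine Finset.sum_congr rfl fun z _ => ?_
  rw [MulChar.pow_apply' _ Fintype.card_ne_zero, ← hψ z, map_pow]

lemma gaussSum_sq_of_orderOf {F : Type} [Field F] [Fintype F] {η : MulChar F ℂ}
    (hη : orderOf η = 2) {ψ : AddChar F ℂ} (hψ : ψ.IsPrimitive) :
    gaussSum η ψ ^ 2 = η (-1) * Fintype.card F := by
  refine gaussSum_sq (fun h => by simp [h] at hη) (fun x => ?_) hψ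
  rw [mulChar_eq_quadraticChar_of_orderOf hη]
  rcases quadraticChar_isQuadratic F x with h | h | h <;> simp [h]

lemma ringChar_ne_two_of_card {F : Type} [Field F] [Fintype F] {s m : ℕ} (hs : s ≠ 0)
    (hF : Fintype.card F = 1 + 2 ^ s * m) : ringChar F ≠ 2 := by
  rw [Ne, FiniteField.even_card_iff_char_two, hF]
  obtain ⟨r, rfl⟩ := Nat.exists_eq_succ_of_ne_zero hs
  rw [pow_succ, mul_assoc, mul_comm, mul_assoc]
  omega

/-- Descent of a Gauss sum of a character of `2`-power order along a quadratic extension. -/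
theorem gaussF_quadratic_descent {L K : Type} [Field L] [Fintype L] [Field K] [Fintype K]
    [Algebra L K] (hcard : Fintype.card K = Fintype.card L ^ 2) {u s m : ℕ} (hu : 2 ≤ u)
    (hus : u ≤ s) (hL : Fintype.card L = 1 + 2 ^ s * m) (hm : Odd m) {χ : MulChar K ℂ}
    (hχ : orderOf χ = 2 ^ (s + 1)) (hχ2 : χ 2 ^ 2 ^ u = 1) {χ₁ : MulChar L ℂ}
    (hlift : ∀ z, (χ ^ 2) z = χ₁ (Algebra.norm L z)) {R : ℂ}
    (hR : R ^ 2 = Fintype.card L ∨ R ^ 2 = -Fintype.card L) :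
    ∃ ε : ℂ, ε ^ 2 ^ u = 1 ∧ gaussF χ = ε * R * gaussF χ₁ := by
  have hLc : ringChar L ≠ 2 := ringChar_ne_two_of_card (by omega) hL
  have hKc : ringChar K ≠ 2 := by rwa [← Algebra.ringChar_eq L K]
  have hη : orderOf (χ ^ 2 ^ s) = 2 := by
    rw [orderOf_pow_of_dvd (by positivity) (hχ ▸ pow_dvd_pow 2 (by omega)), hχ, pow_succ,
      Nat.mul_div_cancel_left _ (by positivity)]
  have hmul : χ * χ ^ 2 ^ s = χ ^ Fintype.card L := by
    obtain ⟨j, rfl⟩ := hm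
    rw [hL, show 1 + 2 ^ s * (2 * j + 1) = 2 ^ (s + 1) * j + (1 + 2 ^ s) by ring, pow_add,
      pow_mul, ← hχ, pow_orderOf_eq_one, one_pow, one_mul, pow_add, pow_one]
  have hχsq : χ ^ 2 ≠ 1 := by
    intro h
    have h1 := Nat.le_of_dvd (by norm_num) (hχ ▸ orderOf_dvd_of_pow_eq_one h)
    have h2 : 2 ^ 2 ≤ 2 ^ (s + 1) := Nat.pow_le_pow_right (by norm_num) (by omega)
    omega
  have hχ₁ : χ₁ ≠ 1 := by
    rintro rfl
    apply hχsq
    ext z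
    rw [hlift, MulChar.one_apply (z.isUnit.map _), MulChar.one_apply z.isUnit]
  have hψ := psiAddChar_isPrimitive K
  have hprod := gaussSum_mul_gaussSum_quadratic hKc hη hχsq hψ
  rw [hmul, gaussSum_pow_card hcard,
    gaussSum_norm_quadratic hcard hLc hχ₁ (psiAddChar L) hlift psiAddChar_trace] at hprod
  have hηsq := gaussSum_sq_of_orderOf hη hψ
  have hη1 : (χ ^ 2 ^ s) (-1) = 1 := by
    rw [MulChar.pow_apply' _ (by positivity), ← map_pow,
      (Nat.even_pow.mpr ⟨even_two, by omega⟩).neg_one_pow, map_one]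
  rw [hη1, one_mul, hcard, Nat.cast_pow, sq_eq_sq_iff_eq_or_eq_neg] at hηsq
  have hQ : (Fintype.card L : ℂ) ≠ 0 := by exact_mod_cast Fintype.card_ne_zero
  have hG₁ := gaussSum_ne_zero_of_nontrivial hQ hχ₁ (psiAddChar_isPrimitive L)
  have hR0 : R ≠ 0 := by
    rintro rfl
    rcases hR with h | h
    · exact hQ (by linear_combination -h)
    · exact hQ (by linear_combination h)
  rw [gaussF_eq_gaussSum, gaussF_eq_gaussSum]
  set G := gaussSum χ (psiAddChar K)
  set G₁ := gaussSum χ₁ (psiAddChar L)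
  set H := gaussSum (χ ^ 2 ^ s) (psiAddChar K)
  refine ⟨G / (R * G₁), ?_, by field_simp⟩
  have hσ : (χ 4 * (G / (R * G₁)) ^ 2) ^ 2 = 1 := by
    have hRH : (H / R ^ 2) ^ 2 = 1 := by
      rcases hηsq with h | h <;> rcases hR with h' | h' <;> rw [h, h'] <;> field_simp
    have : χ 4 * (G / (R * G₁)) ^ 2 = - (H / R ^ 2) := by
      field_simp
      linear_combination hprod
    rw [this, neg_sq, hRH]
  obtain ⟨v, rfl⟩ : ∃ v, u = v + 2 := ⟨u - 2, by omega⟩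
  have h4 : χ 4 = χ 2 ^ 2 := by rw [← map_pow]; norm_num
  have := congrArg (· ^ 2 ^ v) hσ
  simp only [one_pow, h4] at this
  rw [← mul_pow, ← pow_mul, ← pow_mul, mul_pow, show 2 * (2 * 2 ^ v) = 2 ^ (v + 2) by ring,
    hχ2, one_mul] at this
  exact this

lemma exists_mulChar_norm {L K : Type} [Field L] [Fintype L] [Field K] [Fintype K]
    [Algebra L K] (hcard : Fintype.card K = Fintype.card L ^ 2) {φ : MulChar K ℂ}
    (hφ : φ ^ (Fintype.card L - 1) = 1) :
    ∃ χ : MulChar L ℂ, ∀ z, φ z = χ (Algebra.norm L z) := by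
  set Q := Fintype.card L
  have hQ : 1 < Q := Fintype.one_lt_card
  have hN := FiniteField.unitsMap_norm_surjective L K
  set N : Kˣ →* Lˣ := Units.map (Algebra.norm L)
  have hker : N.ker ≤ φ.toUnitHom.ker := by
    intro x hx
    obtain ⟨g, hg⟩ := IsCyclic.exists_generator (α := Kˣ)
    obtain ⟨n, rfl⟩ : x ∈ Submonoid.powers g := by rw [mem_powers_iff_mem_zpowers]; apply hg
    have hx1 : (g ^ n) ^ (Q + 1) = 1 := by
      have h1 : Algebra.norm L ((g ^ n : Kˣ) : K) = 1 := congrArg Units.val hx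
      have h2 := algebraMap_norm_of_card_sq hcard ((g ^ n : Kˣ) : K)
      rw [h1, map_one, ← pow_succ'] at h2
      exact Units.ext (by simpa using h2.symm)
    have hord : orderOf g = (Q - 1) * (Q + 1) := by
      rw [orderOf_eq_card_of_forall_mem_zpowers hg, Nat.card_units, Nat.card_eq_fintype_card,
        hcard, mul_comm, ← Nat.sq_sub_sq, one_pow]
    rw [← pow_mul] at hx1
    have hdvd := orderOf_dvd_of_pow_eq_one hx1
    rw [hord] at hdvd
    obtain ⟨j, rfl⟩ := Nat.dvd_of_mul_dvd_mul_right (by omega) hdvd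
    rw [MonoidHom.mem_ker]
    ext
    beta_reduce
    rw [MulChar.coe_toUnitHom, mul_comm, pow_mul, Units.val_pow_eq_pow_val, map_pow,
      ← MulChar.pow_apply' _ (by omega), hφ, MulChar.one_apply_coe]
    rfl
  refine ⟨MulChar.ofUnitHom (N.liftOfSurjective hN ⟨φ.toUnitHom, hker⟩), fun z => ?_⟩
  rcases eq_or_ne z 0 with rfl | hz
  · rw [Algebra.norm_zero, MulChar.map_zero, MulChar.map_zero]
  · have h1 : Algebra.norm L z = (N (Units.mk0 z hz) : L) := rfl
    have h2 : N.liftOfSurjective hN ⟨φ.toUnitHom, hker⟩ (N (Units.mk0 z hz)) =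
      φ.toUnitHom (Units.mk0 z hz) := MonoidHom.liftOfRightInverse_comp_apply ..
    rw [h1, MulChar.ofUnitHom_coe, h2, MulChar.coe_toUnitHom, Units.val_mk0]

lemma apply_two_pow_eq_one {F K : Type} [Field F] [Fintype F] [Field K] [Fintype K]
    [Algebra F K] {u m n : ℕ} (hu : u ≠ 0) (hF : Fintype.card F = 1 + 2 ^ u * m) (hm : Odd m)
    {χ : MulChar K ℂ} (hχ : χ ^ 2 ^ n = 1) : χ 2 ^ 2 ^ u = 1 := by
  have h2 : (2 : F) ≠ 0 := Ring.two_ne_zero (ringChar_ne_two_of_card hu hF)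
  have h2K : (2 : K) ≠ 0 := by
    have := (map_ne_zero (algebraMap F K)).mpr h2
    rwa [map_ofNat] at this
  have h1 : (χ 2 ^ 2 ^ u) ^ m = 1 := by
    have := FiniteField.pow_card_sub_one_eq_one (2 : F) h2
    rw [hF, Nat.add_sub_cancel_left] at this
    rw [← pow_mul, ← map_pow]
    have h3 : (2 : K) ^ (2 ^ u * m) = 1 := by simpa [map_ofNat] using congrArg (algebraMap F K) this
    rw [h3, map_one]
  have h3 : (χ 2 ^ 2 ^ u) ^ 2 ^ n = 1 := by
    rw [pow_right_comm, ← MulChar.pow_apply' _ (by positivity), hχ,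
      MulChar.one_apply (isUnit_iff_ne_zero.mpr h2K), one_pow]
  have hc : Nat.Coprime m (2 ^ n) := Nat.Coprime.pow_right n hm.coprime_two_right
  rw [← orderOf_eq_one_iff]
  exact Nat.eq_one_of_dvd_coprimes hc (orderOf_dvd_of_pow_eq_one h1)
    (orderOf_dvd_of_pow_eq_one h3)

lemma exists_odd_pow_two_pow {u m : ℕ} (hu : 2 ≤ u) (hm : Odd m) (k : ℕ) :
    ∃ m', Odd m' ∧ (1 + 2 ^ u * m) ^ 2 ^ k = 1 + 2 ^ (u + k) * m' := by
  induction k with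
  | zero => exact ⟨m, hm, by simp⟩
  | succ k ih =>
    obtain ⟨m', hm', h⟩ := ih
    obtain ⟨v, rfl⟩ : ∃ v, u = v + 2 := ⟨u - 2, by omega⟩
    refine ⟨m' * (1 + 2 * (2 ^ (v + k) * m')), hm'.mul ?_, ?_⟩
    · exact ⟨2 ^ (v + k) * m', by ring⟩
    · rw [pow_succ 2 k, pow_mul, h]; ring

/-- Iterated quadratic descent of a Gauss sum of `2`-power order from degree `2 ^ k` down to `F`. -/
theorem gaussF_descent {u m k : ℕ} (hu : 2 ≤ u) (hm : Odd m) (hk : 1 ≤ k)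
    {F : Type} [Field F] [Fintype F] (hF : Fintype.card F = 1 + 2 ^ u * m)
    {χ' η' : MulChar F ℂ} (hη' : orderOf η' = 2)
    {K : Type} [Field K] [Fintype K] [Algebra F K]
    (hK : Fintype.card K = Fintype.card F ^ 2 ^ k)
    {χ : MulChar K ℂ} (hχ : orderOf χ = 2 ^ (u + k))
    (hlift : ∀ z, (χ ^ 2 ^ k) z = χ' (Algebra.norm F z)) :
    ∃ ε : ℂ, ε ^ 2 ^ u = 1 ∧
      gaussF χ = ε * (Fintype.card F : ℂ) ^ (2 ^ k / 2 - 1) * gaussF χ' * gaussF η' := by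
  induction k, hk using Nat.le_induction generalizing K with
  | base =>
    have hR : gaussF η' ^ 2 = Fintype.card F ∨ gaussF η' ^ 2 = -Fintype.card F := by
      rw [gaussF_eq_gaussSum, gaussSum_sq_of_orderOf hη' (psiAddChar_isPrimitive F)]
      rcases mul_self_eq_one_iff.mp (show η' (-1) * η' (-1) = 1 by rw [← map_mul]; simp)
        with h | h <;> simp [h]
    obtain ⟨ε, hε, h⟩ := gaussF_quadratic_descent hK hu le_rfl hF hm hχ
      (apply_two_pow_eq_one (by omega) hF hm (hχ ▸ pow_orderOf_eq_one χ)) hlift hR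
    exact ⟨ε, hε, by rw [h]; norm_num; ring⟩
  | succ k hk ih =>
    have : Fact (ringChar F).Prime := ⟨CharP.char_is_prime F _⟩
    let L := FiniteField.Extension F (ringChar F) (2 ^ k)
    let _ : Fintype L := Fintype.ofFinite L
    have hFL : Module.finrank F L = 2 ^ k := FiniteField.finrank_extension F (ringChar F) (2 ^ k)
    have hFK : Module.finrank F K = 2 ^ (k + 1) := by
      rw [Module.card_eq_pow_finrank (K := F)] at hK
      exact Nat.pow_right_injective Fintype.one_lt_card hK
    obtain ⟨f⟩ := FiniteField.nonempty_algHom_of_finrank_dvd (F := F) (K := L) (L := K)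
      (by rw [hFL, hFK]; exact pow_dvd_pow 2 (by omega))
    let _ : Algebra L K := f.toRingHom.toAlgebra
    have : IsScalarTower F L K := .of_algebraMap_eq fun x => (f.commutes x).symm
    have hL : Fintype.card L = Fintype.card F ^ 2 ^ k := by
      rw [Module.card_eq_pow_finrank (K := F), hFL]
    have hLK : Fintype.card K = Fintype.card L ^ 2 := by rw [hK, hL, ← pow_mul, pow_succ]
    obtain ⟨m', hm', hLm⟩ := exists_odd_pow_two_pow hu hm k
    rw [← hF, ← hL] at hLm
    obtain ⟨χ₁, hχ₁⟩ := exists_mulChar_norm hLK (φ := χ ^ 2) (by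
      rw [hLm, Nat.add_sub_cancel_left, ← pow_mul, ← mul_assoc, ← pow_succ', pow_mul, add_assoc,
        ← hχ, pow_orderOf_eq_one, one_pow])
    have hpow (n : ℕ) (hn : n ≠ 0) (z : K) :
        (χ₁ ^ n) (Algebra.norm L z) = ((χ ^ 2) ^ n) z := by
      rw [MulChar.pow_apply' _ hn, MulChar.pow_apply' _ hn, hχ₁]
    have hord : orderOf χ₁ = 2 ^ (u + k) := by
      have : orderOf (χ ^ 2) = 2 ^ (u + k) := by
        rw [orderOf_pow_of_dvd two_ne_zero (hχ ▸ dvd_pow_self 2 (by omega)), hχ, ← add_assoc,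
          pow_succ, Nat.mul_div_cancel _ two_pos]
      rw [← this, orderOf_eq_orderOf_iff]
      intro n
      rcases eq_or_ne n 0 with rfl | hn
      · simp
      constructor <;> intro h
      · ext z
        rw [← hpow n hn, h, MulChar.one_apply (z.isUnit.map _), MulChar.one_apply z.isUnit]
      · ext y
        obtain ⟨z, hz⟩ := FiniteField.unitsMap_norm_surjective L K y
        have hz' : Algebra.norm L (z : K) = y := congrArg Units.val hz
        rw [← hz', hpow n hn, h, hz', MulChar.one_apply z.isUnit, MulChar.one_apply y.isUnit]
    obtain ⟨ε₁, hε₁, h₁⟩ := ih hL hord fun y => by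
      obtain ⟨z, rfl⟩ := FiniteField.norm_surjective L K y
      rw [hpow _ (by positivity), ← pow_mul, ← pow_succ', hlift, Algebra.norm_norm]
    obtain ⟨ε₂, hε₂, h₂⟩ := gaussF_quadratic_descent hLK hu (by omega) hLm hm' hχ
      (apply_two_pow_eq_one (by omega) hF hm (n := u + (k + 1)) (hχ ▸ pow_orderOf_eq_one χ)) hχ₁
      (R := (Fintype.card F : ℂ) ^ (2 ^ k / 2)) (Or.inl (by
        rw [hL, ← pow_mul, Nat.div_mul_cancel (dvd_pow_self 2 (by omega))]; push_cast; rfl))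
    refine ⟨ε₂ * ε₁, by rw [mul_pow, hε₁, hε₂, one_mul], ?_⟩
    have hexp : 2 ^ (k + 1) / 2 - 1 = 2 ^ k / 2 + (2 ^ k / 2 - 1) := by
      obtain ⟨j, rfl⟩ : ∃ j, k = j + 1 := ⟨k - 1, by omega⟩
      have := Nat.one_le_two_pow (n := j)
      simp only [pow_succ]
      omega
    rw [h₂, h₁, hexp, pow_add]
    ring

/-- **Gauss sum reduction.**  Let `u ≥ 2`, `q` a prime power with
`q ≡ 2^u + 1 (mod 2^(u+1))`, `t ≥ u+1`, `N = 2^t`, `f = 2^(t-u)`.  Let `ω` be a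
primitive element of `F_{q^f}`, `γ = ω^((q^f-1)/(q-1))` (a primitive element of
the subfield `F_q`), `χ_N` of order `N` on `F_{q^f}`, `χ'` of order `2^u` on
`F_q` such that `χ_N^(2^(t-u))` is the lift of `χ'`, and `η'` the quadratic
character of `F_q`.  Then there is `b` with `0 ≤ b ≤ 2^u - 1` such that
`G_{q^f}(χ_N) = χ'(γ)^(-b) q^(f/2-1) G_q(χ') G_q(η')`; in particular
`G_{q^f}(χ_N) = ε q^(f/2-1) G_q(χ') G_q(η')` for some `2^u`-th root of unity
`ε`. -/
theorem gauss_sum_reduction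
    (u : ℕ) (hu : 2 ≤ u) (q : ℕ) (hq : IsPrimePow q)
    (hmod : q % 2 ^ (u + 1) = 2 ^ u + 1)
    (t : ℕ) (ht : u + 1 ≤ t)
    (F K : Type) [Field F] [Fintype F] [Field K] [Fintype K]
    (hF : Fintype.card F = q) (hK : Fintype.card K = q ^ (2 ^ (t - u)))
    (ι : F →+* K)
    (ω : K) (hω : ∀ x : K, x ≠ 0 → ∃ n : ℕ, x = ω ^ n)
    (γ : F) (hγ : ι γ = ω ^ ((q ^ (2 ^ (t - u)) - 1) / (q - 1)))
    (χN : MulChar K ℂ) (hχN : orderOf χN = 2 ^ t)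
    (χ' : MulChar F ℂ) (hχ' : orderOf χ' = 2 ^ u)
    (hlift : ∀ (x : K) (y : F), ι y = x ^ ((q ^ (2 ^ (t - u)) - 1) / (q - 1)) →
      (χN ^ (2 ^ (t - u))) x = χ' y)
    (η' : MulChar F ℂ) (hη' : orderOf η' = 2) :
    ∃ b : ℕ, b ≤ 2 ^ u - 1 ∧
      gaussF χN = (χ' γ) ^ (-(b : ℤ)) * (q : ℂ) ^ (2 ^ (t - u) / 2 - 1) *
        gaussF χ' * gaussF η' ∧
      ∃ ε : ℂ, ε ^ (2 ^ u) = 1 ∧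
        gaussF χN = ε * (q : ℂ) ^ (2 ^ (t - u) / 2 - 1) * gaussF χ' * gaussF η' := by
  obtain ⟨k, rfl⟩ : ∃ k, t = u + k := ⟨t - u, by omega⟩
  rw [Nat.add_sub_cancel_left] at *
  let _ : Algebra F K := ι.toAlgebra
  have hι (y : F) : algebraMap F K y = ι y := rfl
  obtain ⟨m, hm, hFm⟩ : ∃ m, Odd m ∧ Fintype.card F = 1 + 2 ^ u * m := by
    refine ⟨2 * (q / 2 ^ (u + 1)) + 1, odd_two_mul_add_one _, ?_⟩
    rw [hF]
    conv_lhs => rw [← Nat.div_add_mod q (2 ^ (u + 1)), hmod]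
    ring
  subst hF
  have hnorm (z : K) : (χN ^ 2 ^ k) z = χ' (Algebra.norm F z) := by
    refine hlift z _ ?_
    rw [← hι, FiniteField.algebraMap_norm_eq_pow, Nat.card_eq_fintype_card,
      Nat.card_eq_fintype_card, hK]
  obtain ⟨ε, hε, hG⟩ := gaussF_descent hu hm (by omega) hFm hη' hK hχN hnorm
  have hω0 : ω ≠ 0 := by
    rintro rfl
    have hchar : ringChar K ≠ 2 := by
      rw [← Algebra.ringChar_eq F K]
      exact ringChar_ne_two_of_card (by omega) hFm
    obtain ⟨n, hn⟩ := hω (-1) (by simp)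
    rcases eq_or_ne n 0 with rfl | h
    · exact Ring.neg_one_ne_one_of_char_ne_two hchar (by simpa using hn)
    · simp [zero_pow h] at hn
  have hγ' : orderOf (χ' γ) = 2 ^ u := by
    rw [← hlift ω γ hγ, MulChar.pow_apply' _ (by positivity)]
    have hχω : orderOf (χN ω) = 2 ^ (u + k) := by
      rw [← hχN, orderOf_eq_orderOf_iff]
      intro n
      rcases eq_or_ne n 0 with rfl | hn
      · simp
      rw [← MulChar.pow_apply' _ hn]
      constructor <;> intro h
      · ext z
        obtain ⟨j, hj⟩ := hω z z.ne_zero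
        rw [hj, map_pow, h, one_pow, ← hj, MulChar.one_apply z.isUnit]
      · rw [h, MulChar.one_apply (isUnit_iff_ne_zero.mpr hω0)]
    rw [orderOf_pow_of_dvd (by positivity) (hχω ▸ pow_dvd_pow 2 (by omega)), hχω, pow_add,
      Nat.mul_div_cancel _ (by positivity)]
  have hprim : IsPrimitiveRoot (χ' γ)⁻¹ (2 ^ u) :=
    (hγ' ▸ IsPrimitiveRoot.orderOf (χ' γ)).inv
  obtain ⟨b, hb, hbε⟩ := hprim.eq_pow_of_pow_eq_one hε
  refine ⟨b, by omega, ?_, ε, hε, hG⟩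
  rw [hG, ← hbε, zpow_neg, zpow_natCast, inv_pow]
end

section
/- Let u ≥ 2 be an integer, q a prime power with q ≡ 2^u + 1 (mod 2^{u+1}), t ≥ u+1 an integer, N = 2^t and f = 2^{t−u}. Let χ_N be a multiplicative character of F_{q^f} of order N and let η be the quadratic character of F_{q^f}. Then G_{q^f}(χ_N)^f = χ_N(f·1)^{−f} · q^{f(f/2−1)} · G_{q^f}(χ_N^f) · G_{q^f}(η), where f·1 denotes the image of the integer f in F_{q^f}. -/
open Finset
open scoped Classical

/-- The canonical additive character of `K`, bundled as an `AddChar`. -/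
noncomputable def canonicalAddChar (K : Type) [Field K] [Fintype K] : AddChar K ℂ :=
  letI := ZMod.algebra K (ringChar K)
  haveI : NeZero (ringChar K) := ⟨CharP.char_ne_zero_of_finite K (ringChar K)⟩
  (ZMod.stdAddChar (N := ringChar K)).compAddMonoidHom
    (Algebra.trace (ZMod (ringChar K)) K).toAddMonoidHom

section

variable {K : Type} [Field K] [Fintype K]

lemma canonicalAddChar_apply (x : K) : canonicalAddChar K x = psiF K x := by
  have : NeZero (ringChar K) := ⟨CharP.char_ne_zero_of_finite K (ringChar K)⟩
  let := ZMod.algebra K (ringChar K)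
  set y := Algebra.trace (ZMod (ringChar K)) K x with hy
  have h := ZMod.stdAddChar_coe (N := ringChar K) (y.val : ℤ)
  have h2 : (((y.val : ℕ) : ℤ) : ZMod (ringChar K)) = y := by simp
  rw [h2] at h
  calc canonicalAddChar K x = ZMod.stdAddChar y := rfl
    _ = _ := by rw [h]; rfl

lemma gaussF_eq_gaussSum_s4 (χ : MulChar K ℂ) :
    gaussF χ = gaussSum χ (canonicalAddChar K) := by
  unfold gaussF gaussSum
  simp only [canonicalAddChar_apply]
  refine Finset.sum_subset (Finset.subset_univ _) fun x _ hx => ?_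
  have : x = 0 := by simpa using hx
  rw [this, MulChar.map_zero, zero_mul]

lemma canonicalAddChar_isPrimitive : (canonicalAddChar K).IsPrimitive := by
  have : Fact (ringChar K).Prime := ⟨CharP.char_is_prime K (ringChar K)⟩
  let := ZMod.algebra K (ringChar K)
  have : FiniteDimensional (ZMod (ringChar K)) K := Module.Finite.of_finite
  refine AddChar.IsPrimitive.of_ne_one fun h => ?_
  obtain ⟨x, hx⟩ := Algebra.trace_surjective (ZMod (ringChar K)) K 1
  have h1 : canonicalAddChar K x = ZMod.stdAddChar (1 : ZMod (ringChar K)) := by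
    rw [← hx]; rfl
  rw [h, AddChar.one_apply, ← AddChar.map_zero_eq_one (ZMod.stdAddChar (N := ringChar K))] at h1
  exact zero_ne_one (ZMod.injective_stdAddChar h1)

lemma canonicalAddChar_pow_ringChar (x : K) :
    canonicalAddChar K (x ^ ringChar K) = canonicalAddChar K x := by
  have : Fact (ringChar K).Prime := ⟨CharP.char_is_prime K (ringChar K)⟩
  let := ZMod.algebra K (ringChar K)
  have : FiniteDimensional (ZMod (ringChar K)) K := Module.Finite.of_finite
  have h := Algebra.trace_eq_of_algEquiv
    (FiniteField.frobeniusAlgEquivOfAlgebraic (ZMod (ringChar K)) K) x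
  rw [FiniteField.coe_frobeniusAlgEquivOfAlgebraic, ZMod.card] at h
  exact congrArg ZMod.stdAddChar h

lemma gaussSum_pow_ringChar (χ : MulChar K ℂ) :
    gaussSum (χ ^ ringChar K) (canonicalAddChar K) = gaussSum χ (canonicalAddChar K) := by
  have : Fact (ringChar K).Prime := ⟨CharP.char_is_prime K (ringChar K)⟩
  unfold gaussSum
  refine Fintype.sum_bijective (frobenius K (ringChar K)) ?_ _ _ fun x => ?_
  · exact Finite.injective_iff_bijective.mp (frobenius_inj K _)
  · rw [frobenius_def, canonicalAddChar_pow_ringChar, map_pow,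
      MulChar.pow_apply' _ (Fact.out : (ringChar K).Prime).ne_zero]

lemma gaussSum_pow_ringChar_pow (χ : MulChar K ℂ) (m : ℕ) :
    gaussSum (χ ^ ringChar K ^ m) (canonicalAddChar K) = gaussSum χ (canonicalAddChar K) := by
  induction m with
  | zero => simp
  | succ m ih => rw [pow_succ, pow_mul, gaussSum_pow_ringChar, ih]

/-- A complex multiplicative character of order two of a finite field is the quadratic
character. -/
lemma MulChar.apply_eq_quadraticChar {η : MulChar K ℂ} (hη : orderOf η = 2) (a : K) :
    η a = (quadraticChar K a : ℂ) := by
  have hsq : η ^ 2 = 1 := hη ▸ pow_orderOf_eq_one η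
  have hne : η ≠ 1 := by rintro rfl; simp at hη
  have hpm : ∀ a : K, a ≠ 0 → η a ^ 2 = 1 := fun a ha => by
    rw [← MulChar.pow_apply' η two_ne_zero, hsq, MulChar.one_apply ha.isUnit]
  have hsquare : ∀ a : K, a ≠ 0 → quadraticChar K a = 1 → η a = 1 := fun a ha h => by
    obtain ⟨c, rfl⟩ := (quadraticChar_one_iff_isSquare ha).mp h
    have hc : c ≠ 0 := by rintro rfl; simp at ha
    rw [map_mul, ← pow_two, hpm c hc]
  obtain ⟨b, hb⟩ := MulChar.ne_one_iff.mp hne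
  have hb1 : η b = -1 :=
    (mul_self_eq_one_iff.mp (pow_two (η b) ▸ hpm b b.ne_zero)).resolve_left hb
  have hqb : quadraticChar K b = -1 :=
    (quadraticChar_dichotomy b.ne_zero).resolve_left fun h => hb (hsquare b b.ne_zero h)
  rcases eq_or_ne a 0 with rfl | ha
  · simp
  rcases quadraticChar_dichotomy ha with h | h
  · rw [h, hsquare a ha h]; simp
  · have := hsquare (a * b) (mul_ne_zero ha b.ne_zero) (by rw [map_mul, h, hqb]; norm_num)
    rw [map_mul, hb1] at this
    rw [h]; push_cast; linear_combination -this

lemma sum_mulChar_one_sub_sq {χ η : MulChar K ℂ} (hK : ringChar K ≠ 2) (hχ : χ ≠ 1)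
    (hη : orderOf η = 2) : ∑ y : K, χ (1 - y ^ 2) = jacobiSum χ η := by
  have h1 : ∑ y : K, χ (1 - y ^ 2) = ∑ z : K, (η z + 1) * χ (1 - z) := by
    rw [← Finset.sum_fiberwise Finset.univ (fun y : K => y ^ 2)]
    refine Finset.sum_congr rfl fun z _ => ?_
    have hc := quadraticChar_card_sqrts hK z
    rw [Finset.sum_congr rfl (g := fun _ => χ (1 - z)) (by
      intro y hy; rw [(Finset.mem_filter.mp hy).2]), Finset.sum_const, nsmul_eq_mul,
      MulChar.apply_eq_quadraticChar hη]
    congr 1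
    have h2 : ({y ∈ (Finset.univ : Finset K) | y ^ 2 = z}) = {x : K | x ^ 2 = z}.toFinset := by
      ext; simp
    rw [h2]
    exact_mod_cast hc
  have h3 : ∑ z : K, χ (1 - z) = 0 := by
    rw [← MulChar.sum_eq_zero_of_ne_one hχ]
    exact (Equiv.subLeft (1 : K)).sum_comp χ
  rw [h1, jacobiSum_comm, jacobiSum]
  simp only [add_mul, one_mul, Finset.sum_add_distrib, h3, add_zero]

lemma mulChar_four_mul_jacobiSum_self {χ η : MulChar K ℂ} (hK : ringChar K ≠ 2) (hχ : χ ≠ 1)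
    (hη : orderOf η = 2) : χ 4 * jacobiSum χ χ = jacobiSum χ η := by
  have h2 := Ring.two_ne_zero hK
  rw [← sum_mulChar_one_sub_sq hK hχ hη, jacobiSum, Finset.mul_sum]
  let e : K ≃ K := (Equiv.mulLeft₀ 2 h2).trans (Equiv.subLeft 1)
  rw [← e.sum_comp fun y => χ (1 - y ^ 2)]
  refine Finset.sum_congr rfl fun x _ => ?_
  have : e x = 1 - 2 * x := rfl
  rw [this, ← map_mul, ← map_mul]
  congr 1
  ring

/-- The duplication formula for a character `χ` whose Gauss sum is unchanged on twisting by the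
quadratic character. -/
lemma gaussSum_sq_of_gaussSum_mul_eq {χ η : MulChar K ℂ} (hK : ringChar K ≠ 2)
    (hχ : χ ≠ 1) (hχ2 : χ ^ 2 ≠ 1) (hχη : χ * η ≠ 1) (hη : orderOf η = 2)
    {ψ : AddChar K ℂ} (hψ : ψ.IsPrimitive) (h : gaussSum (χ * η) ψ = gaussSum χ ψ) :
    gaussSum χ ψ ^ 2 = (χ 4)⁻¹ * gaussSum (χ ^ 2) ψ * gaussSum η ψ := by
  have hcard : (Fintype.card K : ℂ) ≠ 0 := Nat.cast_ne_zero.mpr Fintype.card_ne_zero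
  have hG := gaussSum_ne_zero_of_nontrivial hcard hχ hψ
  have hJη : jacobiSum χ η = gaussSum η ψ := by
    have := jacobiSum_mul_nontrivial hχη ψ
    rw [h] at this
    exact mul_left_cancel₀ hG this
  have hJ := jacobiSum_mul_nontrivial (χ := χ) (φ := χ) (by rwa [← pow_two]) ψ
  have h4 := mulChar_four_mul_jacobiSum_self hK hχ hη
  have h4' : χ 4 ≠ 0 := MulChar.apply_ne_zero_iff.mpr <| IsUnit.mk0 _ <| by
    rw [show (4 : K) = 2 ^ 2 by norm_num]
    exact pow_ne_zero 2 (Ring.two_ne_zero hK)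
  rw [← pow_two, ← pow_two] at hJ
  rw [← hJ, ← hJη, ← h4]
  field_simp

end

lemma exists_pow_two_pow_eq {q u : ℕ} (hu : 2 ≤ u) (hmod : q % 2 ^ (u + 1) = 2 ^ u + 1)
    (i : ℕ) : ∃ c, q ^ 2 ^ i = 1 + 2 ^ (u + i) + c * 2 ^ (u + i + 1) := by
  induction i with
  | zero =>
    refine ⟨q / 2 ^ (u + 1), ?_⟩
    have := Nat.mod_add_div q (2 ^ (u + 1))
    rw [hmod] at this
    simp only [pow_zero, pow_one, add_zero]
    linarith
  | succ i ih =>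
    obtain ⟨c, hc⟩ := ih
    obtain ⟨v, rfl⟩ := Nat.exists_eq_add_of_le hu
    refine ⟨c + 2 ^ (v + i) * (1 + 2 * c) ^ 2, ?_⟩
    rw [pow_succ, pow_mul, hc]
    ring

section

variable {K : Type} [Field K] [Fintype K] {q u : ℕ}

lemma MulChar.pow_eq_of_orderOf_eq_two {χ η : MulChar K ℂ} {s : ℕ}
    (hχ : orderOf χ = 2 ^ (s + 1)) (hη : orderOf η = 2) : χ ^ 2 ^ s = η := by
  have h : orderOf (χ ^ 2 ^ s) = 2 := by
    rw [orderOf_pow_of_dvd (by positivity) (by rw [hχ, pow_succ]; exact dvd_mul_right _ _), hχ,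
      pow_succ, Nat.mul_div_cancel_left _ (by positivity)]
  exact MulChar.ext' fun a => by rw [apply_eq_quadraticChar h, apply_eq_quadraticChar hη]

lemma gaussSum_pow_two_pow (hu : 2 ≤ u) (hmod : q % 2 ^ (u + 1) = 2 ^ u + 1)
    {m : ℕ} (hq : q = ringChar K ^ m) (hK : ringChar K ≠ 2) {η : MulChar K ℂ}
    (hη : orderOf η = 2) (k : ℕ) (χ : MulChar K ℂ) (hχ : orderOf χ = 2 ^ (u + k)) :
    gaussSum χ (canonicalAddChar K) ^ 2 ^ k = ((χ ((2 ^ k : ℕ) : K))⁻¹) ^ 2 ^ k *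
      gaussSum (χ ^ 2 ^ k) (canonicalAddChar K) *
      gaussSum η (canonicalAddChar K) ^ (2 ^ k - 1) := by
  induction k generalizing χ with
  | zero => simp
  | succ k ih =>
    have hχη : χ ^ 2 ^ (u + k) = η := MulChar.pow_eq_of_orderOf_eq_two hχ hη
    have hlt : 2 ^ 2 ≤ 2 ^ (u + k) := Nat.pow_le_pow_right (by norm_num) (by omega)
    have hne : ∀ n, 0 < n → n < 2 ^ (u + (k + 1)) → χ ^ n ≠ 1 := fun n h0 h1 =>
      pow_ne_one_of_lt_orderOf h0.ne' (hχ ▸ h1)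
    have hsucc : 2 ^ (u + (k + 1)) = 2 * 2 ^ (u + k) := by rw [← add_assoc, pow_succ, mul_comm]
    have htwist : gaussSum (χ * η) (canonicalAddChar K) = gaussSum χ (canonicalAddChar K) := by
      obtain ⟨c, hc⟩ := exists_pow_two_pow_eq hu hmod k
      rw [← gaussSum_pow_ringChar_pow χ (m * 2 ^ k), pow_mul, ← hq, hc, pow_add, pow_add, hχη,
        pow_one, mul_comm c, pow_mul, add_assoc u k 1, ← hχ, pow_orderOf_eq_one, one_pow, mul_one]
    have hsq := gaussSum_sq_of_gaussSum_mul_eq hK (by simpa using hne 1 (by norm_num) (by omega))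
      (hne 2 (by norm_num) (by omega))
      (by rw [← hχη, ← pow_succ']; exact hne _ (by omega) (by omega)) hη
      canonicalAddChar_isPrimitive htwist
    have hord : orderOf (χ ^ 2) = 2 ^ (u + k) := by
      rw [orderOf_pow_of_dvd two_ne_zero (by rw [hχ, hsucc]; exact dvd_mul_right _ _), hχ, hsucc,
        Nat.mul_div_cancel_left _ two_pos]
    have hexp : 2 ^ (k + 1) - 1 = (2 ^ k - 1) + 2 ^ k := by
      have := Nat.one_le_two_pow (n := k)
      rw [pow_succ]; omega
    rw [hexp, pow_succ', pow_mul, hsq, mul_pow, mul_pow, ih _ hord, pow_add, ← pow_mul,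
      MulChar.pow_apply' _ two_ne_zero, show (4 : K) = 2 ^ 2 by norm_num]
    push_cast
    simp only [map_pow, map_mul]
    ring

end

/-- Let `u ≥ 2`, `q` a prime power with `q ≡ 2^u + 1 (mod 2^(u+1))`, `t ≥ u+1`,
`N = 2^t`, `f = 2^(t-u)`.  If `χ_N` is a multiplicative character of order `N`
of `F_{q^f}` and `η` is the quadratic character of `F_{q^f}`, then
`G(χ_N)^f = χ_N(f)^(-f) q^(f(f/2-1)) G(χ_N^f) G(η)`. -/
theorem gauss_sum_power_identity
    (u : ℕ) (hu : 2 ≤ u) (q : ℕ) (hq : IsPrimePow q)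
    (hmod : q % 2 ^ (u + 1) = 2 ^ u + 1)
    (t : ℕ) (ht : u + 1 ≤ t)
    (K : Type) [Field K] [Fintype K] (hK : Fintype.card K = q ^ (2 ^ (t - u)))
    (χN : MulChar K ℂ) (hχN : orderOf χN = 2 ^ t)
    (η : MulChar K ℂ) (hη : orderOf η = 2) :
    gaussF χN ^ (2 ^ (t - u)) =
      (χN ((2 ^ (t - u) : ℕ) : K)) ^ (-(2 ^ (t - u) : ℤ)) *
        (q : ℂ) ^ (2 ^ (t - u) * (2 ^ (t - u) / 2 - 1)) *
        gaussF (χN ^ (2 ^ (t - u))) * gaussF η := by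
  obtain ⟨k, rfl⟩ := Nat.exists_eq_add_of_le ht
  have hk : u + 1 + k - u = k + 1 := by omega
  rw [hk] at hK ⊢
  obtain ⟨n, hp, hcard⟩ := FiniteField.card K (ringChar K)
  obtain ⟨m, -, hm⟩ := (Nat.dvd_prime_pow hp).mp
    (hcard ▸ hK ▸ dvd_pow_self q (by positivity) : q ∣ ringChar K ^ (n : ℕ))
  have hodd : ringChar K ≠ 2 := by
    intro h2
    have h1 : q % 2 = 1 := by
      rw [← Nat.mod_mod_of_dvd q (dvd_pow_self 2 (Nat.succ_ne_zero u)), hmod, Nat.add_mod,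
        Nat.mod_eq_zero_of_dvd (dvd_pow_self 2 (by omega : u ≠ 0))]
    have h3 := FiniteField.even_card_iff_char_two.mp h2
    rw [hK, Nat.pow_mod, h1, one_pow] at h3
    norm_num at h3
  have hmain := gaussSum_pow_two_pow hu hmod hm hodd hη (k + 1) χN
    (by rw [hχN]; congr 1; omega)
  have hχη : χN ^ 2 ^ (u + k) = η :=
    MulChar.pow_eq_of_orderOf_eq_two (by rw [hχN]; congr 1; omega) hη
  have hneg : η (-1) = 1 := by
    rw [← hχη, MulChar.pow_apply' _ (by positivity), ← map_pow,
      Even.neg_one_pow (even_two.pow_of_ne_zero (by omega)), map_one]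
  have hη1 : η ≠ 1 := by rintro rfl; simp at hη
  have hG := gaussSum_sq hη1
    (MulChar.isQuadratic_iff_sq_eq_one.mpr (hη ▸ pow_orderOf_eq_one η))
    (canonicalAddChar_isPrimitive (K := K))
  rw [hneg, one_mul, hK] at hG
  have hexp : 2 ^ (k + 1) - 1 = 2 * (2 ^ (k + 1) / 2 - 1) + 1 := by
    have := Nat.one_le_two_pow (n := k)
    rw [pow_succ]; omega
  simp only [gaussF_eq_gaussSum_s4]
  rw [hmain, hexp, pow_succ (gaussSum η _), pow_mul (gaussSum η _), hG, pow_mul (q : ℂ), zpow_neg, inv_pow,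
    show ((2 : ℤ) ^ (k + 1)) = ((2 ^ (k + 1) : ℕ) : ℤ) by push_cast; rfl, zpow_natCast]
  push_cast
  ring
end

section
/- Let u ≥ 2 be an integer, q a prime power with q ≡ 2^u + 1 (mod 2^{u+1}), t ≥ u+1 an integer, N = 2^t and f = 2^{t−u}. Let ω be a primitive element of F_{q^f}, γ = ω^{(q^f−1)/(q−1)}, χ_N a multiplicative character of F_{q^f} of order N, χ' the multiplicative character of F_q of order 2^u with χ_N^{2^{t−u}}(x) = χ'(x^{(q^f−1)/(q−1)}), η' the quadratic character of F_q, and let b be an integer such that G_{q^f}(χ_N) = χ'(γ)^{−b} q^{f/2−1} G_q(χ') G_q(η'). Set D_h = ∪_{j=0}^{N/2−1} C_{h+j}^{(N,q^f)} and B_0 = ∪_{j=0}^{2^{u−1}−1} C_j^{(2^u,q)} (cyclotomic classes with respect to ω and γ respectively). For 0 ≤ a,h ≤ N−1, let j be the unique element of {0,1,…,2^{t−u}−1} with 2^{t−u} dividing a+h+j and set j_{a,h} = (a+h+j)/2^{t−u}. Then ψ_{F_{q^f}}(ω^a D_h) = (−1 + q^{f/2−1} G_q(η'))/2 + q^{f/2−1}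 G_q(η') · ψ_{F_q}(γ^{b+j_{a,h}} B_0). -/
open Finset
open scoped Classical

open Polynomial IntermediateField

lemma exists_addChar_eq_psiF (F : Type) [Field F] [Fintype F] :
    ∃ ψ : AddChar F ℂ, ψ ≠ 1 ∧ ∀ x, ψ x = psiF F x := by
  let := ZMod.algebra F (ringChar F)
  have : Fact (ringChar F).Prime := ⟨CharP.char_is_prime F _⟩
  let T : F →+ ZMod (ringChar F) := (Algebra.trace (ZMod (ringChar F)) F).toAddMonoidHom
  have hψ (x : F) : (ZMod.stdAddChar.compAddMonoidHom T : AddChar F ℂ) x = psiF F x := by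
    have hv : ((T x).val : ℤ) = T x := by simp
    rw [AddChar.compAddMonoidHom_apply, ← hv, ZMod.stdAddChar_coe]
    simp only [psiF, Int.cast_natCast]
    rfl
  refine ⟨_, fun h1 => ?_, hψ⟩
  obtain ⟨x, hx⟩ := Algebra.trace_surjective (ZMod (ringChar F)) F 1
  have hx1 := DFunLike.congr_fun h1 x
  have hTx : T x = 1 := hx
  rw [AddChar.compAddMonoidHom_apply, hTx, AddChar.one_apply,
    ← AddChar.map_zero_eq_one (ZMod.stdAddChar (N := ringChar F))] at hx1
  exact one_ne_zero (ZMod.injective_stdAddChar hx1)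

lemma psiF_zero (F : Type) [Field F] [Fintype F] : psiF F 0 = 1 := by
  obtain ⟨ψ, -, hψ⟩ := exists_addChar_eq_psiF F
  rw [← hψ, AddChar.map_zero_eq_one]

lemma sum_psiF_ne_zero (F : Type) [Field F] [Fintype F] :
    ∑ x : F with x ≠ 0, psiF F x = -1 := by
  obtain ⟨ψ, hψ1, hψ⟩ := exists_addChar_eq_psiF F
  have h := AddChar.sum_eq_zero_of_ne_one hψ1
  rw [← Finset.sum_filter_add_sum_filter_not _ (fun x : F => x ≠ 0)] at h
  have h0 : ∑ x : F with x = 0, psiF F x = 1 := by simp [Finset.sum_filter, psiF_zero]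
  simp only [not_not, hψ, h0] at h
  linear_combination h

lemma psiF_mem_adjoin (F : Type) [Field F] [Fintype F] (p : ℕ) (hp : ringChar F = p) (x : F) :
    psiF F x ∈ ℚ⟮Complex.exp (2 * Real.pi * Complex.I / p)⟯ := by
  subst hp
  simp only [psiF]
  have hmul (n : ℕ) (y z : ℂ) : y * n / z = n * (y / z) := by ring
  rw [hmul, Complex.exp_nat_mul]
  exact pow_mem (mem_adjoin_simple_self ℚ _) _

/-- Powers of a primitive `2 ^ t`-th root of unity with exponents below `2 ^ (t - 1)` are linearly
independent over the `p`-th cyclotomic field, for odd `p`. -/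
lemma eq_zero_of_sum_mul_pow_eq_zero {p t : ℕ} (hp : 0 < p) (hodd : Odd p) (ht : 0 < t)
    {ξ ζ : ℂ} (hξ : IsPrimitiveRoot ξ p) (hζ : IsPrimitiveRoot ζ (2 ^ t))
    (c : ℕ → ℂ) (hc : ∀ i, c i ∈ ℚ⟮ξ⟯) (hsum : ∑ i ∈ range (2 ^ (t - 1)), c i * ζ ^ i = 0)
    {i : ℕ} (hi : i < 2 ^ (t - 1)) : c i = 0 := by
  have hξint : IsIntegral ℚ ξ := (hξ.isIntegral hp).tower_top
  have hζint : IsIntegral ℚ ζ := (hζ.isIntegral (by positivity)).tower_top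
  have hζint' : IsIntegral ℚ⟮ξ⟯ ζ := hζint.tower_top
  have : FiniteDimensional ℚ ℚ⟮ξ⟯ := adjoin.finiteDimensional hξint
  have : FiniteDimensional ℚ⟮ξ⟯ ℚ⟮ξ⟯⟮ζ⟯ := adjoin.finiteDimensional hζint'
  have : FiniteDimensional ℚ ℚ⟮ξ⟯⟮ζ⟯ := FiniteDimensional.trans ℚ ℚ⟮ξ⟯ ℚ⟮ξ⟯⟮ζ⟯
  have hcop : Nat.Coprime p (2 ^ t) := Nat.Coprime.pow_right _ (Nat.coprime_two_right.mpr hodd)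
  have hfr : Module.finrank ℚ ℚ⟮ξ⟯ = p.totient := by
    rw [adjoin.finrank hξint, ← cyclotomic_eq_minpoly_rat hξ hp, natDegree_cyclotomic]
  have hdeg : 2 ^ (t - 1) ≤ (minpoly ℚ⟮ξ⟯ ζ).natDegree := by
    have hξ' : IsPrimitiveRoot (algebraMap ℚ⟮ξ⟯ ℚ⟮ξ⟯⟮ζ⟯ (AdjoinSimple.gen ℚ ξ)) p :=
      IsPrimitiveRoot.of_map_of_injective (f := algebraMap ℚ⟮ξ⟯⟮ζ⟯ ℂ) hξ
        (algebraMap ℚ⟮ξ⟯⟮ζ⟯ ℂ).injective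
    have hζ' : IsPrimitiveRoot (AdjoinSimple.gen ℚ⟮ξ⟯ ζ) (2 ^ t) :=
      IsPrimitiveRoot.of_map_of_injective (f := algebraMap ℚ⟮ξ⟯⟮ζ⟯ ℂ) hζ
        (algebraMap ℚ⟮ξ⟯⟮ζ⟯ ℂ).injective
    have h := hξ'.lcm_totient_le_finrank hζ'
      (cyclotomic.irreducible_rat (Nat.lcm_pos hp (by positivity)))
    rw [hcop.lcm_eq_mul, Nat.totient_mul hcop, ← Module.finrank_mul_finrank ℚ ℚ⟮ξ⟯ ℚ⟮ξ⟯⟮ζ⟯, hfr,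
      Nat.totient_prime_pow Nat.prime_two ht, adjoin.finrank hζint'] at h
    simpa using Nat.le_of_mul_le_mul_left h (Nat.totient_pos.mpr hp)
  have hli := (linearIndependent_pow (K := ℚ⟮ξ⟯) ζ).comp (Fin.castLE hdeg)
    (Fin.castLE_injective hdeg)
  rw [Fintype.linearIndependent_iff] at hli
  have h0 := hli (fun i => ⟨c i, hc i⟩) ?_ ⟨i, hi⟩
  · exact congrArg Subtype.val h0
  · rw [← hsum, ← Fin.sum_univ_eq_sum_range (fun i => c i * ζ ^ i)]
    rfl

lemma zpow_eq_zpow_iff_of_generates {F : Type} [Field F] [Fintype F] {g : F} (hg0 : g ≠ 0)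
    (hg : ∀ x : F, x ≠ 0 → ∃ n : ℕ, x = g ^ n) (m n : ℤ) :
    g ^ m = g ^ n ↔ ((Fintype.card F - 1 : ℕ) : ℤ) ∣ n - m := by
  have hmem (x : Fˣ) : x ∈ Subgroup.zpowers (Units.mk0 g hg0) := by
    obtain ⟨k, hk⟩ := hg x x.ne_zero
    exact ⟨k, by ext; simp [hk]⟩
  rw [← Fintype.card_units, ← Nat.card_eq_fintype_card,
    ← orderOf_eq_card_of_forall_mem_zpowers hmem,
    orderOf_dvd_iff_zpow_eq_one, zpow_sub, mul_inv_eq_one, eq_comm, Units.ext_iff]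
  simp

lemma exists_discreteLog {F : Type} [Field F] [Fintype F] {g : F} (hg0 : g ≠ 0)
    (hg : ∀ x : F, x ≠ 0 → ∃ n : ℕ, x = g ^ n) {M : ℕ} (hM : M ∣ Fintype.card F - 1) :
    ∃ ℓ : F → ZMod M, ∀ n : ℤ, ℓ (g ^ n) = n := by
  refine ⟨fun x => if h : ∃ n : ℤ, x = g ^ n then (h.choose : ZMod M) else 0, fun n => ?_⟩
  have h : ∃ k : ℤ, g ^ n = g ^ k := ⟨n, rfl⟩
  simp only [dif_pos h]
  rw [ZMod.intCast_eq_intCast_iff_dvd_sub]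
  exact (Int.natCast_dvd_natCast.mpr hM).trans
    ((zpow_eq_zpow_iff_of_generates hg0 hg _ _).mp h.choose_spec.symm)

lemma sum_zmod_eq_sum_range {M : ℕ} [NeZero M] (f : ZMod M → ℂ) (b : ZMod M) :
    ∑ c, f c = ∑ i ∈ range M, f (b + i) := by
  rw [← Equiv.sum_comp (Equiv.addLeft b) f]
  refine Finset.sum_bij' (fun c _ => c.val) (fun i _ => (i : ZMod M)) ?_ ?_ ?_ ?_ ?_
  · exact fun c _ => by simpa using ZMod.val_lt c
  · simp
  · simp
  · exact fun i hi => ZMod.val_cast_of_lt (by simpa using hi)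
  · simp

lemma sum_range_two_mul (m : ℕ) (f : ℕ → ℂ) :
    ∑ i ∈ range (2 * m), f i = ∑ i ∈ range m, f i + ∑ i ∈ range m, f (m + i) := by
  rw [two_mul, Finset.sum_range_add]

/-- The sum of the canonical additive character over a level set of `ℓ`. -/
noncomputable def levelSum {F : Type} [Field F] [Fintype F] {M : ℕ} (ℓ : F → ZMod M)
    (c : ZMod M) : ℂ :=
  ∑ x : F with x ≠ 0 ∧ ℓ x = c, psiF F x

/-- The difference of the level sums at `c` and `c + m`. -/
noncomputable def levelDiff {F : Type} [Field F] [Fintype F] {M : ℕ} (ℓ : F → ZMod M) (m : ℕ)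
    (c : ZMod M) : ℂ :=
  levelSum ℓ c - levelSum ℓ (c + m)

lemma sum_mul_levelSum {F : Type} [Field F] [Fintype F] {M : ℕ} [NeZero M] (ℓ : F → ZMod M)
    (w : ZMod M → ℂ) :
    ∑ c, w c * levelSum ℓ c = ∑ x : F with x ≠ 0, w (ℓ x) * psiF F x := by
  rw [← Finset.sum_fiberwise _ ℓ]
  refine Finset.sum_congr rfl fun c _ => ?_
  rw [levelSum, Finset.mul_sum, Finset.filter_filter]
  refine Finset.sum_congr rfl fun x hx => ?_
  rw [(Finset.mem_filter.mp hx).2.2]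

lemma sum_levelSum {F : Type} [Field F] [Fintype F] {M : ℕ} [NeZero M] (ℓ : F → ZMod M) :
    ∑ c, levelSum ℓ c = -1 := by
  simpa [sum_psiF_ne_zero] using sum_mul_levelSum ℓ 1

lemma levelDiff_add {F : Type} [Field F] [Fintype F] {m : ℕ} (ℓ : F → ZMod (2 * m))
    (c : ZMod (2 * m)) : levelDiff ℓ m (c + m) = -levelDiff ℓ m c := by
  have h : c + m + m = c := by
    have : ((2 * m : ℕ) : ZMod (2 * m)) = 0 := ZMod.natCast_self _
    push_cast at this
    linear_combination this
  rw [levelDiff, levelDiff, h]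
  ring

lemma sum_range_levelDiff {F : Type} [Field F] [Fintype F] {m : ℕ} [NeZero (2 * m)]
    (ℓ : F → ZMod (2 * m)) (c : ZMod (2 * m)) :
    ∑ i ∈ range m, levelDiff ℓ m (c + i) = 2 * ∑ i ∈ range m, levelSum ℓ (c + i) + 1 := by
  have h := sum_levelSum ℓ
  rw [sum_zmod_eq_sum_range _ c, sum_range_two_mul] at h
  simp only [levelDiff, Finset.sum_sub_distrib]
  have h' : ∑ i ∈ range m, levelSum ℓ (c + i + m) = ∑ i ∈ range m, levelSum ℓ (c + (m + i : ℕ)) :=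
    Finset.sum_congr rfl fun i _ => by push_cast; ring_nf
  rw [h']
  linear_combination -h

lemma zpow_mul_gaussF {F : Type} [Field F] [Fintype F] {g : F} (hg0 : g ≠ 0)
    (hg : ∀ x : F, x ≠ 0 → ∃ n : ℕ, x = g ^ n) {m : ℕ} [NeZero (2 * m)]
    {ℓ : F → ZMod (2 * m)} (hℓ : ∀ n : ℤ, ℓ (g ^ n) = n)
    (χ : MulChar F ℂ) (hχ : (χ g) ^ m = -1) (b : ℤ) :
    (χ g) ^ (-b) * gaussF χ = ∑ i ∈ range m, levelDiff ℓ m (b + i) * (χ g) ^ i := by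
  set z := χ g with hz
  have hz0 : z ≠ 0 := fun h => by
    have := (hg0.isUnit.map χ).ne_zero
    exact this h
  have hz2 : z ^ (2 * m) = 1 := by rw [mul_comm, pow_mul, hχ]; norm_num
  have hval (n : ℤ) : z ^ ((n : ZMod (2 * m)).val) = z ^ n := by
    have h := ZMod.val_intCast (n := 2 * m) n
    rw [← zpow_natCast, h]
    conv_rhs => rw [← Int.emod_add_mul_ediv n (2 * m : ℕ), zpow_add₀ hz0, zpow_mul, zpow_natCast,
      hz2, one_zpow, mul_one]
  have h1 : z ^ (-b) * gaussF χ = ∑ c : ZMod (2 * m), z ^ (c - b).val * levelSum ℓ c := by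
    rw [sum_mul_levelSum ℓ (fun c => z ^ (c - (b : ZMod (2 * m))).val), gaussF, Finset.mul_sum]
    refine Finset.sum_congr (by ext; simp) fun x hx => ?_
    obtain ⟨n, rfl⟩ := hg x (by simpa using hx)
    have hn := hℓ n
    rw [zpow_natCast] at hn
    rw [hn, ← Int.cast_sub, hval, map_pow, ← hz, ← mul_assoc, ← zpow_natCast z n, ← zpow_add₀ hz0]
    ring_nf
  rw [h1, sum_zmod_eq_sum_range _ (b : ZMod (2 * m))]
  have h2 (i : ℕ) : z ^ ((b + i - b : ZMod (2 * m))).val = z ^ i := by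
    rw [add_sub_cancel_left]
    simpa using hval i
  simp only [h2]
  rw [sum_range_two_mul, ← Finset.sum_add_distrib]
  refine Finset.sum_congr rfl fun i _ => ?_
  rw [levelDiff, pow_add, hχ]
  push_cast
  ring_nf

lemma mem_cycClass_iff {F : Type} [Field F] [Fintype F] {g : F} (hg0 : g ≠ 0)
    (hg : ∀ x : F, x ≠ 0 → ∃ n : ℕ, x = g ^ n) {M : ℕ} (hM : M ∣ Fintype.card F - 1)
    {ℓ : F → ZMod M} (hℓ : ∀ n : ℤ, ℓ (g ^ n) = n) (i : ℕ) (x : F) :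
    x ∈ cycClass g M i ↔ x ≠ 0 ∧ ℓ x = i := by
  simp only [cycClass, Finset.mem_filter, Finset.mem_univ, true_and]
  constructor
  · rintro ⟨j, rfl⟩
    refine ⟨pow_ne_zero _ hg0, ?_⟩
    rw [← zpow_natCast, hℓ]
    simp
  · rintro ⟨hx, hi⟩
    obtain ⟨n, rfl⟩ := hg x hx
    rw [← zpow_natCast, hℓ, Int.cast_natCast, ZMod.natCast_eq_natCast_iff] at hi
    have hpos : 1 ≤ Fintype.card F - 1 := by
      have := Fintype.one_lt_card (α := F)
      omega
    have hle : i ≤ n + (Fintype.card F - 1) * i := by nlinarith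
    have hmod : i ≡ n + (Fintype.card F - 1) * i [MOD M] := by
      have := (hM.mul_right i).modEq_zero_nat
      simpa using (hi.symm.add this.symm)
    obtain ⟨j, hj⟩ := (Nat.modEq_iff_dvd' hle).mp hmod
    refine ⟨j, ?_⟩
    rw [← hj, Nat.add_sub_cancel' hle, pow_add, pow_mul, FiniteField.pow_card_sub_one_eq_one g hg0,
      one_pow, mul_one]

lemma sum_cycClass {F : Type} [Field F] [Fintype F] {g : F} (hg0 : g ≠ 0)
    (hg : ∀ x : F, x ≠ 0 → ∃ n : ℕ, x = g ^ n) {M : ℕ} (hM : M ∣ Fintype.card F - 1)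
    {ℓ : F → ZMod M} (hℓ : ∀ n : ℤ, ℓ (g ^ n) = n) (i : ℕ) (e : ℤ) :
    ∑ x ∈ cycClass g M i, psiF F (g ^ e * x) = levelSum ℓ (e + i) := by
  have hmul (a : ℤ) (x : F) (hx : x ≠ 0) : ℓ (g ^ a * x) = a + ℓ x := by
    obtain ⟨n, rfl⟩ := hg x hx
    rw [← zpow_natCast, ← zpow_add₀ hg0, hℓ, hℓ]
    push_cast
    rfl
  have hne := zpow_ne_zero e hg0
  refine Finset.sum_bij' (fun x _ => g ^ e * x) (fun x _ => g ^ (-e) * x) ?_ ?_ ?_ ?_ ?_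
  · intro x hx
    rw [mem_cycClass_iff hg0 hg hM hℓ] at hx
    simp [hmul e x hx.1, hx.1, hx.2, hne]
  · intro x hx
    simp only [Finset.mem_filter, Finset.mem_univ, true_and] at hx
    rw [mem_cycClass_iff hg0 hg hM hℓ, hmul (-e) x hx.1, hx.2]
    exact ⟨mul_ne_zero (zpow_ne_zero _ hg0) hx.1, by push_cast; ring⟩
  · intro x _
    simp [hne]
  · intro x _
    simp [hne]
  · intro x _
    rfl

lemma sum_biUnion_cycClass {F : Type} [Field F] [Fintype F] {g : F} (hg0 : g ≠ 0)
    (hg : ∀ x : F, x ≠ 0 → ∃ n : ℕ, x = g ^ n) {M m : ℕ} (hM : M ∣ Fintype.card F - 1)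
    (hm : m ≤ M) {ℓ : F → ZMod M} (hℓ : ∀ n : ℤ, ℓ (g ^ n) = n) (h : ℕ) (e : ℤ) :
    ∑ x ∈ (range m).biUnion (fun j => cycClass g M (h + j)), psiF F (g ^ e * x) =
      ∑ j ∈ range m, levelSum ℓ (e + h + j) := by
  rw [Finset.sum_biUnion]
  · refine Finset.sum_congr rfl fun j _ => ?_
    rw [sum_cycClass hg0 hg hM hℓ]
    push_cast
    ring_nf
  · intro j hj k hk hjk
    rw [Function.onFun, Finset.disjoint_left]
    intro x hx hx'
    rw [mem_cycClass_iff hg0 hg hM hℓ] at hx hx'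
    have heq := hx.2.symm.trans hx'.2
    push_cast at heq
    rw [add_right_inj, ZMod.natCast_eq_natCast_iff] at heq
    simp only [Finset.coe_range, Set.mem_Iio] at hj hk
    exact hjk (heq.eq_of_lt_of_lt (hj.trans_le hm) (hk.trans_le hm))

lemma sum_range_ite_dvd {d m s j : ℕ} (hj : j < d) (hd : d ∣ s + j) (f : ℕ → ℂ) :
    ∑ i ∈ range (d * m), (if d ∣ s + i then f ((s + i) / d) else 0) =
      ∑ k ∈ range m, f ((s + j) / d + k) := by
  have hd0 : 0 < d := by omega
  rw [← Finset.sum_filter]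
  symm
  refine Finset.sum_bij (fun k _ => j + d * k) ?_ ?_ ?_ ?_
  · intro k hk
    simp only [Finset.mem_filter, Finset.mem_range] at hk ⊢
    refine ⟨by nlinarith, ?_⟩
    rw [← add_assoc]
    exact hd.add (dvd_mul_right _ _)
  · intro k _ k' _ h
    exact Nat.eq_of_mul_eq_mul_left hd0 (by omega)
  · intro i hi
    simp only [Finset.mem_filter, Finset.mem_range] at hi
    have hmod : i % d = j := by
      have h1 : i ≡ j [MOD d] := Nat.ModEq.add_left_cancel' s
        ((hi.2.modEq_zero_nat).trans hd.modEq_zero_nat.symm)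
      rw [h1, Nat.mod_eq_of_lt hj]
    refine ⟨i / d, ?_, ?_⟩
    · exact Finset.mem_range.mpr (Nat.div_lt_of_lt_mul hi.1)
    · rw [← hmod, Nat.mod_add_div]
  · intro k _
    rw [← add_assoc, Nat.add_mul_div_left _ _ hd0]

lemma eq_ite_dvd_of_antiperiodic {d m : ℕ} (hd : 0 < d) (hm : 0 < m) {A B : ℕ → ℂ}
    (hA : ∀ i, A (i + d * m) = -A i) (hB : ∀ i, B (i + m) = -B i)
    (hAB : ∀ i < d * m, A i = if d ∣ i then B (i / d) else 0) (i : ℕ) :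
    A i = if d ∣ i then B (i / d) else 0 := by
  induction i using Nat.strong_induction_on with
  | _ i ih =>
    rcases lt_or_ge i (d * m) with hi | hi
    · exact hAB i hi
    · obtain ⟨k, rfl⟩ := Nat.exists_eq_add_of_le' hi
      have hpos : 0 < d * m := by positivity
      rw [hA, ih k (by omega), Nat.add_mul_div_left _ _ hd, hB]
      simp only [Nat.dvd_add_left (dvd_mul_right d m)]
      split_ifs <;> simp

lemma levelDiff_mem_adjoin {F : Type} [Field F] [Fintype F] {p M : ℕ} (hp : ringChar F = p)
    (ℓ : F → ZMod M) (m : ℕ) (c : ZMod M) :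
    levelDiff ℓ m c ∈ ℚ⟮Complex.exp (2 * Real.pi * Complex.I / p)⟯ :=
  sub_mem (sum_mem fun x _ => psiF_mem_adjoin F p hp x) (sum_mem fun x _ => psiF_mem_adjoin F p hp x)

lemma gaussF_mem_adjoin_of_orderOf_eq_two {F : Type} [Field F] [Fintype F] {p : ℕ}
    (hp : ringChar F = p) {η : MulChar F ℂ} (hη : orderOf η = 2) :
    gaussF η ∈ ℚ⟮Complex.exp (2 * Real.pi * Complex.I / p)⟯ := by
  refine sum_mem fun x hx => mul_mem ?_ (psiF_mem_adjoin F p hp x)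
  have hx0 : x ≠ 0 := by simpa using hx
  have h2 : η ^ 2 = 1 := hη ▸ pow_orderOf_eq_one η
  have hsq : (η x) ^ 2 = 1 := by
    rw [← MulChar.pow_apply' η two_ne_zero, h2, MulChar.one_apply hx0.isUnit]
  rcases eq_or_eq_neg_of_sq_eq_sq (η x) 1 (by rw [hsq, one_pow]) with h | h <;> rw [h]
  · exact one_mem _
  · exact neg_mem (one_mem _)

lemma isPrimitiveRoot_apply_generator {F : Type} [Field F] [Fintype F] {g : F} (hg0 : g ≠ 0)
    (hg : ∀ x : F, x ≠ 0 → ∃ n : ℕ, x = g ^ n) (χ : MulChar F ℂ) :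
    IsPrimitiveRoot (χ g) (orderOf χ) := by
  have key (k : ℕ) (hk : 0 < k) : (χ g) ^ k = 1 ↔ χ ^ k = 1 := by
    rw [← MulChar.pow_apply' χ hk.ne']
    constructor
    · intro h
      ext x
      obtain ⟨n, hn⟩ := hg x x.ne_zero
      rw [hn, map_pow, map_pow, h, MulChar.one_apply hg0.isUnit]
    · intro h
      rw [h, MulChar.one_apply hg0.isUnit]
  have hpos : 0 < orderOf χ := χ.orderOf_pos
  refine (IsPrimitiveRoot.iff hpos).mpr ⟨(key _ hpos).mpr (pow_orderOf_eq_one χ), ?_⟩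
  intro l hl hlt h
  exact absurd (orderOf_le_of_pow_eq_one hl ((key l hl).mp h)) (by omega)

lemma generates_of_map_eq_pow {F K : Type} [Field F] [Fintype F] [Field K] [Fintype K]
    (ι : F →+* K) {ω : K} (hω0 : ω ≠ 0) (hω : ∀ x : K, x ≠ 0 → ∃ n : ℕ, x = ω ^ n) {f : ℕ}
    (hK : Fintype.card K = Fintype.card F ^ f) {γ : F}
    (hγ : ι γ = ω ^ ((Fintype.card F ^ f - 1) / (Fintype.card F - 1))) (y : F) (hy : y ≠ 0) :
    ∃ n : ℕ, y = γ ^ n := by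
  obtain ⟨n, hn⟩ := hω (ι y) (by simpa using hy)
  have hpos : 0 < Fintype.card F - 1 := by
    have := Fintype.one_lt_card (α := F)
    omega
  have hdiv : (Fintype.card F ^ f - 1) / (Fintype.card F - 1) * (Fintype.card F - 1) =
      Fintype.card F ^ f - 1 :=
    Nat.div_mul_cancel (by simpa using Nat.sub_dvd_pow_sub_pow (Fintype.card F) 1 f)
  set e := (Fintype.card F ^ f - 1) / (Fintype.card F - 1)
  have h1 : ω ^ (n * (Fintype.card F - 1)) = 1 := by
    rw [pow_mul, ← hn, ← map_pow, FiniteField.pow_card_sub_one_eq_one y hy, map_one]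
  have h2 := (zpow_eq_zpow_iff_of_generates hω0 hω 0 (n * (Fintype.card F - 1) : ℕ)).mp
    (by rw [zpow_zero, zpow_natCast, h1])
  rw [sub_zero, Int.natCast_dvd_natCast, hK, ← hdiv] at h2
  obtain ⟨k, rfl⟩ := Nat.dvd_of_mul_dvd_mul_right hpos h2
  refine ⟨k, ι.injective ?_⟩
  rw [hn, map_pow, hγ, ← pow_mul]

/-- **Character values of `D_h`.**  With the notation of the paper
(`N = 2^t`, `f = 2^(t-u)`, `D_h = ∪_{j=0}^{N/2-1} C_{h+j}^{(N,q^f)}`,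
`B_0 = ∪_{j=0}^{2^(u-1)-1} C_j^{(2^u,q)}`, and `j_{a,h} = (a+h+j)/2^(t-u)`
for the unique `0 ≤ j < 2^(t-u)` with `2^(t-u) ∣ a+h+j`):
`ψ_{F_{q^f}}(ω^a D_h) = (-1 + q^(f/2-1) G_q(η'))/2
    + q^(f/2-1) G_q(η') ψ_{F_q}(γ^(b+j_{a,h}) B_0)`. -/
theorem character_values_of_Dh
    (u : ℕ) (hu : 2 ≤ u) (q : ℕ) (hq : IsPrimePow q)
    (hmod : q % 2 ^ (u + 1) = 2 ^ u + 1)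
    (t : ℕ) (ht : u + 1 ≤ t)
    (F K : Type) [Field F] [Fintype F] [Field K] [Fintype K]
    (hF : Fintype.card F = q) (hK : Fintype.card K = q ^ (2 ^ (t - u)))
    (ι : F →+* K)
    (ω : K) (hω : ∀ x : K, x ≠ 0 → ∃ n : ℕ, x = ω ^ n)
    (γ : F) (hγ : ι γ = ω ^ ((q ^ (2 ^ (t - u)) - 1) / (q - 1)))
    (χN : MulChar K ℂ) (hχN : orderOf χN = 2 ^ t)
    (χ' : MulChar F ℂ) (hχ' : orderOf χ' = 2 ^ u)
    (hlift : ∀ (x : K) (y : F), ι y = x ^ ((q ^ (2 ^ (t - u)) - 1) / (q - 1)) →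
      (χN ^ (2 ^ (t - u))) x = χ' y)
    (η' : MulChar F ℂ) (hη' : orderOf η' = 2)
    (b : ℤ)
    (hb : gaussF χN = (χ' γ) ^ (-b) * (q : ℂ) ^ (2 ^ (t - u) / 2 - 1) *
      gaussF χ' * gaussF η')
    (D : ℕ → Finset K)
    (hD : ∀ h, D h = (Finset.range (2 ^ t / 2)).biUnion
            (fun j => cycClass ω (2 ^ t) (h + j)))
    (B₀ : Finset F)
    (hB₀ : B₀ = (Finset.range (2 ^ (u - 1))).biUnion
            (fun j => cycClass γ (2 ^ u) j))
    (a h : ℕ) (ha : a ≤ 2 ^ t - 1) (hh : h ≤ 2 ^ t - 1)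
    (j : ℕ) (hj : j < 2 ^ (t - u)) (hjdvd : 2 ^ (t - u) ∣ a + h + j) :
    ∑ x ∈ D h, psiF K (ω ^ a * x) =
      (-1 + (q : ℂ) ^ (2 ^ (t - u) / 2 - 1) * gaussF η') / 2 +
        (q : ℂ) ^ (2 ^ (t - u) / 2 - 1) * gaussF η' *
          ∑ x ∈ B₀, psiF F (γ ^ (b + (((a + h + j) / 2 ^ (t - u) : ℕ) : ℤ)) * x) := by
  obtain ⟨v, rfl⟩ : ∃ v, u = v + 1 := ⟨u - 1, by omega⟩
  obtain ⟨T, rfl⟩ : ∃ T, t = T + 1 := ⟨t - 1, by omega⟩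
  have hd0 : 0 < 2 ^ (T + 1 - (v + 1)) := by positivity
  have hdm : 2 ^ (T + 1 - (v + 1)) * 2 ^ v = 2 ^ T := by
    rw [← pow_add]
    congr 1
    omega
  have hζN := isPrimitiveRoot_apply_generator (g := ω) ?_ hω χN
  swap
  · rintro rfl
    refine absurd (hχN ▸ orderOf_eq_one_iff.mpr (?_ : χN = 1)) (Nat.one_lt_two_pow (by omega)).ne'
    ext x
    obtain ⟨n, hn⟩ := hω x x.ne_zero
    rcases Nat.eq_zero_or_pos n with rfl | hn0
    · rw [hn, pow_zero, map_one, map_one]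
    · rw [zero_pow hn0.ne'] at hn
      exact absurd hn x.ne_zero
  have hω0 : ω ≠ 0 := by
    rintro rfl
    rw [MulChar.map_zero] at hζN
    exact hζN.ne_zero χN.orderOf_pos.ne' rfl
  have hγ0 : γ ≠ 0 := fun h0 => by
    rw [h0, map_zero] at hγ
    exact pow_ne_zero _ hω0 hγ.symm
  have hγgen := generates_of_map_eq_pow ι hω0 hω (hF ▸ hK) (hF ▸ hγ)
  have hNdvd : 2 * 2 ^ T ∣ Fintype.card K - 1 := by
    rw [← pow_succ', ← hχN]
    exact χN.orderOf_dvd_card_sub_one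
  have hMdvd : 2 * 2 ^ v ∣ Fintype.card F - 1 := by
    rw [← pow_succ', ← hχ']
    exact χ'.orderOf_dvd_card_sub_one
  rw [hχN] at hζN
  have hχγ : χ' γ = χN ω ^ 2 ^ (T + 1 - (v + 1)) := by
    rw [← hlift ω γ hγ, MulChar.pow_apply' χN hd0.ne']
  have hζT : χN ω ^ 2 ^ T = -1 := by
    have h2 : IsPrimitiveRoot (χN ω ^ 2 ^ T) 2 := hζN.pow (by positivity) (pow_succ _ _)
    exact h2.eq_neg_one_of_two_right
  have hζv : χ' γ ^ 2 ^ v = -1 := by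
    rw [hχγ, ← pow_mul, hdm, hζT]
  have hqodd : Odd (Fintype.card F) := by
    rw [hF, Nat.odd_iff, ← Nat.mod_mod_of_dvd q (dvd_pow_self 2 (Nat.succ_ne_zero (v + 1))), hmod,
      pow_succ]
    omega
  obtain ⟨p, hp⟩ : ∃ p, ringChar F = p := ⟨_, rfl⟩
  have hcharF : CharP F p := hp ▸ ringChar.charP F
  have hprime : p.Prime := CharP.char_is_prime F p
  have hcharK : CharP K p := charP_of_injective_ringHom ι.injective p
  have hpK : ringChar K = p := ringChar.eq K p ▸ rfl
  have hpodd : Odd p := by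
    obtain ⟨n, -, hn⟩ := FiniteField.card F p
    rw [hn] at hqodd
    exact (Nat.odd_pow_iff n.ne_zero).mp hqodd
  have hξ : IsPrimitiveRoot (Complex.exp (2 * Real.pi * Complex.I / p)) p :=
    Complex.isPrimitiveRoot_exp p hprime.ne_zero
  obtain ⟨ℓK, hℓK⟩ := exists_discreteLog hω0 hω hNdvd
  obtain ⟨ℓF, hℓF⟩ := exists_discreteLog hγ0 hγgen hMdvd
  have : NeZero (2 * 2 ^ T) := ⟨by positivity⟩
  have : NeZero (2 * 2 ^ v) := ⟨by positivity⟩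
  set κ := (q : ℂ) ^ (2 ^ (T + 1 - (v + 1)) / 2 - 1) * gaussF η' with hκ
  have hκmem : κ ∈ ℚ⟮Complex.exp (2 * Real.pi * Complex.I / p)⟯ :=
    mul_mem (pow_mem (_root_.natCast_mem _ _) _) (gaussF_mem_adjoin_of_orderOf_eq_two hp hη')
  let A : ℕ → ℂ := fun i => levelDiff ℓK (2 ^ T) i
  let B : ℕ → ℂ := fun i => κ * levelDiff ℓF (2 ^ v) (b + i)
  generalize hd : 2 ^ (T + 1 - (v + 1)) = d at *
  have hsum : ∑ i ∈ range (2 ^ T), A i * χN ω ^ i =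
      ∑ i ∈ range (2 ^ T), (if d ∣ i then B (i / d) else 0) * χN ω ^ i := by
    have hK0 := zpow_mul_gaussF hω0 hω hℓK χN hζT 0
    have hFb := zpow_mul_gaussF hγ0 hγgen hℓF χ' hζv b
    simp only [neg_zero, zpow_zero, one_mul, Int.cast_zero, zero_add] at hK0
    have hmul : gaussF χN = κ * ((χ' γ) ^ (-b) * gaussF χ') := by
      rw [hb, hκ]
      ring
    have hite := sum_range_ite_dvd (m := 2 ^ v) (s := 0) (j := 0) hd0 (by simp)
      (fun i => B i * χN ω ^ (d * i))
    simp only [zero_add, Nat.zero_div, hdm] at hite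
    simp only [A]
    rw [← hK0, hmul, hFb, Finset.mul_sum]
    calc _ = ∑ k ∈ range (2 ^ v), B k * χN ω ^ (d * k) :=
          Finset.sum_congr rfl fun k _ => by rw [hχγ, ← pow_mul, ← mul_assoc]
      _ = _ := by
          rw [← hite]
          refine Finset.sum_congr rfl fun i _ => ?_
          split_ifs with hi
          · rw [Nat.mul_div_cancel' hi]
          · rw [zero_mul]
  have hAB (i : ℕ) : A i = if d ∣ i then B (i / d) else 0 := by
    refine eq_ite_dvd_of_antiperiodic hd0 (m := 2 ^ v) (by positivity) ?_ ?_ ?_ i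
    · intro i
      have := levelDiff_add ℓK (i : ZMod (2 * 2 ^ T))
      simp only [A, hdm, Nat.cast_add]
      exact this
    · intro i
      have := levelDiff_add ℓF (b + i : ZMod (2 * 2 ^ v))
      simp only [B, Nat.cast_add]
      rw [← add_assoc, this, mul_neg]
    · intro i hi
      rw [hdm] at hi
      refine sub_eq_zero.mp (eq_zero_of_sum_mul_pow_eq_zero (t := T + 1) hprime.pos hpodd
        (Nat.succ_pos T) hξ hζN (fun i => A i - if d ∣ i then B (i / d) else 0) ?_ ?_ hi)
      · intro i
        refine sub_mem (levelDiff_mem_adjoin hpK _ _ _) ?_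
        split_ifs
        · exact mul_mem hκmem (levelDiff_mem_adjoin hp _ _ _)
        · exact zero_mem _
      · simp only [sub_mul, Finset.sum_sub_distrib]
        exact sub_eq_zero.mpr hsum
  have hD' : ∑ x ∈ D h, psiF K (ω ^ a * x) =
      ∑ i ∈ range (2 ^ T), levelSum ℓK (((a + h : ℕ) : ZMod (2 * 2 ^ T)) + i) := by
    have := sum_biUnion_cycClass hω0 hω hNdvd (m := 2 ^ T) (by omega) hℓK h a
    rw [hD, pow_succ', Nat.mul_div_cancel_left _ two_pos]
    simpa using this
  have hB' : ∑ x ∈ B₀, psiF F (γ ^ (b + (((a + h + j) / d : ℕ) : ℤ)) * x) =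
      ∑ i ∈ range (2 ^ v), levelSum ℓF ((b + ((a + h + j) / d : ℕ) : ZMod (2 * 2 ^ v)) + i) := by
    have := sum_biUnion_cycClass hγ0 hγgen hMdvd (m := 2 ^ v) (by omega) hℓF 0
      (b + (((a + h + j) / d : ℕ) : ℤ))
    rw [hB₀, pow_succ', Nat.add_sub_cancel]
    simpa only [zero_add, Int.cast_add, Int.cast_natCast, Nat.cast_zero, add_zero] using this
  have hfin : ∑ i ∈ range (2 ^ T), A (a + h + i) =
      ∑ k ∈ range (2 ^ v), B ((a + h + j) / d + k) := by
    rw [← sum_range_ite_dvd hj hjdvd, hdm]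
    exact Finset.sum_congr rfl fun i _ => hAB _
  have hA2 := sum_range_levelDiff ℓK ((a + h : ℕ) : ZMod (2 * 2 ^ T))
  have hB2 := sum_range_levelDiff ℓF (b + ((a + h + j) / d : ℕ) : ZMod (2 * 2 ^ v))
  simp only [A, B, ← Finset.mul_sum] at hfin
  rw [← hD'] at hA2
  rw [← hB'] at hB2
  have hA3 : ∑ i ∈ range (2 ^ T), levelDiff ℓK (2 ^ T) ((a + h + i : ℕ) : ZMod (2 * 2 ^ T)) =
      2 * ∑ x ∈ D h, psiF K (ω ^ a * x) + 1 := by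
    rw [← hA2]
    exact Finset.sum_congr rfl fun i _ => by rw [Nat.cast_add (a + h) i]
  have hB3 : ∑ i ∈ range (2 ^ v),
      levelDiff ℓF (2 ^ v) (b + ((a + h + j) / d + i : ℕ) : ZMod (2 * 2 ^ v)) =
      2 * ∑ x ∈ B₀, psiF F (γ ^ (b + (((a + h + j) / d : ℕ) : ℤ)) * x) + 1 := by
    rw [← hB2]
    exact Finset.sum_congr rfl fun i _ => by
      rw [Nat.cast_add ((a + h + j) / d) i, ← add_assoc (b : ZMod (2 * 2 ^ v))]
  rw [hA3, hB3] at hfin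
  linear_combination hfin / 2
end
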